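/- Let (R,M,k) be a regular local ring which is a G-ring, with regular system of parameters (y,u_1,...,u_d), and let f ∈ M with f ∉ (u_1,...,u_d). Then there exists z ∈ R such that (z,u_1,...,u_d) is a regular system of parameters of R and Δ(f;u_1,...,u_d;z) = Δ(f;u_1,...,u_d), i.e. the characteristic polyhedron of f is computed by a regular system of parameters of R itself (no completion needed). -/

import Mathlib

/-!
Characteristic polyhedra of singularities without completion
(V. Cossart, O. Piltant), formalized statements.
-/

noncomputable section

open IsLocalRing TensorProduct

namespace CharPolyhedra

universe u v

/-! ### Polyhedral notions -/

/-- The nonnegative orthant in `ℝ^d`. -/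
def orthant (d : ℕ) : Set (Fin d → ℝ) := {x | ∀ i, 0 ≤ x i}

/-- An `F`-subset of `ℝ_{≥0}^d`: a closed convex subset stable under translation
by the nonnegative orthant. -/
def IsFSubset {d : ℕ} (Δ : Set (Fin d → ℝ)) : Prop :=
  Δ ⊆ orthant d ∧ IsClosed Δ ∧ Convex ℝ Δ ∧ ∀ v ∈ Δ, ∀ w ∈ orthant d, v + w ∈ Δ

/-- The smallest `F`-subset containing a given set of points. -/
def smallestFSubset {d : ℕ} (X : Set (Fin d → ℝ)) : Set (Fin d → ℝ) :=
  ⋂₀ {Δ | IsFSubset Δ ∧ X ⊆ Δ}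

/-- A vertex of an `F`-subset: a point cut out by a positive linear form. -/
def IsVertex {d : ℕ} (Δ : Set (Fin d → ℝ)) (v : Fin d → ℝ) : Prop :=
  ∃ L : Fin d → ℝ, (∀ i, 0 < L i) ∧ Δ ∩ {x | ∑ i, L i * x i = 1} = {v}

/-- A rational polyhedron: an `F`-subset cut out by finitely many nonnegative
rational linear forms. -/
def IsRationalPolyhedron {d : ℕ} (Δ : Set (Fin d → ℝ)) : Prop :=
  ∃ (n : ℕ) (L : Fin n → Fin d → ℚ), (∀ j i, 0 ≤ L j i) ∧
    Δ = {x | x ∈ orthant d ∧ ∀ j, 1 ≤ ∑ i, (L j i : ℝ) * x i}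

/-- `min {L(a) : a ∈ Δ}` for a linear form with rational coefficients `L`. -/
def ellOf {d : ℕ} (L : Fin d → ℚ) (Δ : Set (Fin d → ℝ)) : ℝ :=
  sInf ((fun x => ∑ i, (L i : ℝ) * x i) '' Δ)

/-! ### Regular local rings, systems of parameters -/

/-- A family `s` of `n` elements is a regular system of parameters of the local
ring `R`: it generates the maximal ideal and `n` equals the Krull dimension. -/
def IsSysOfParams (R : Type u) [CommRing R] [IsLocalRing R] {n : ℕ} (s : Fin n → R) : Prop :=
  Ideal.span (Set.range s) = maximalIdeal R ∧ ringKrullDim R = n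

/-- `(y, u 0, ..., u (d-1))` is a regular system of parameters of `R`. -/
def IsRSP (R : Type u) [CommRing R] [IsLocalRing R] {d : ℕ} (y : R) (u : Fin d → R) : Prop :=
  IsSysOfParams R (Fin.cons y u)

/-- A regular local ring: a Noetherian local ring whose maximal ideal is
generated by a regular system of parameters. -/
def IsRegularLocalRing (R : Type u) [CommRing R] [IsLocalRing R] : Prop :=
  IsNoetherianRing R ∧ ∃ (n : ℕ) (s : Fin n → R), IsSysOfParams R s

/-- A regular ring: a Noetherian ring all of whose localizations at primes are
regular local rings. -/
def IsRegularRing (A : Type u) [CommRing A] : Prop :=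
  IsNoetherianRing A ∧ ∀ (P : Ideal A) [P.IsPrime],
    IsRegularLocalRing (Localization.AtPrime P)

/-! ### Monomial expansions and polyhedra -/

variable {R : Type u} [CommRing R]

/-- The monomial `y^b u^a`, where `ab = (a, b)`. -/
def monomial {d : ℕ} (y : R) (u : Fin d → R) (ab : (Fin d → ℕ) × ℕ) : R :=
  y ^ ab.2 * ∏ i, u i ^ ab.1 i

/-- A finite expansion `f = Σ_{(a,b)} C_{a,b} y^b u^a` with all coefficients units. -/
def IsUnitExpansion {d : ℕ} (f y : R) (u : Fin d → R)
    (c : ((Fin d → ℕ) × ℕ) →₀ R) : Prop :=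
  (∀ ab ∈ c.support, IsUnit (c ab)) ∧ f = c.sum fun ab r => r * monomial y u ab

/-- The projection `(a, b) ↦ a / (m - b)` from the point `(0, m)`. -/
def projPoint {d : ℕ} (m : ℕ) (ab : (Fin d → ℕ) × ℕ) : Fin d → ℝ :=
  fun i => (ab.1 i : ℝ) / ((m : ℝ) - (ab.2 : ℝ))

/-- The projected points attached to (the support of) an expansion. -/
def expPoints {d : ℕ} (m : ℕ) (s : Finset ((Fin d → ℕ) × ℕ)) : Set (Fin d → ℝ) :=
  {x | ∃ ab ∈ s, ab.2 < m ∧ x = projPoint m ab}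

/-- The polyhedron `Δ(f; u; y)` computed with prescribed order `m`: the smallest
`F`-subset containing the projected supports of all finite unit-coefficient
expansions of `f` in the parameters `(y, u)`. -/
def DeltaOf {d : ℕ} (f y : R) (u : Fin d → R) (m : ℕ) : Set (Fin d → ℝ) :=
  smallestFSubset (⋃ c ∈ {c | IsUnitExpansion f y u c}, expPoints m c.support)

/-- The order of the image of `f` in `R/(u_1, ..., u_d)`, i.e. the largest `n`
with `f ∈ M^n + (u_1, ..., u_d)`. -/
def ordRes {d : ℕ} [IsLocalRing R] (f : R) (u : Fin d → R) : ℕ :=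
  sSup {n : ℕ | f ∈ (maximalIdeal R) ^ n ⊔ Ideal.span (Set.range u)}

/-- Hironaka's polyhedron `Δ(f; u_1, ..., u_d; y)`. -/
def Delta {d : ℕ} [IsLocalRing R] (f y : R) (u : Fin d → R) : Set (Fin d → ℝ) :=
  DeltaOf f y u (ordRes f u)

/-! ### Completion and the characteristic polyhedron -/

/-- The `M`-adic completion `R̂` of a local ring `R`. -/
abbrev Completion (R : Type u) [CommRing R] [IsLocalRing R] : Type u :=
  AdicCompletion (maximalIdeal R) R

/-- The canonical map `R → R̂`. -/
def cmpl {R : Type u} [CommRing R] [IsLocalRing R] : R →+* Completion R :=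
  algebraMap R (Completion R)

/-- `(ŷ, u_1, ..., u_d)` is a regular system of parameters of the completion
`R̂`: it generates the maximal ideal `M·R̂` of `R̂`. -/
def IsRSPhat (R : Type u) [CommRing R] [IsLocalRing R] {d : ℕ}
    (yh : Completion R) (u : Fin d → R) : Prop :=
  Ideal.span (insert yh (Set.range fun i => cmpl (u i)))
    = (maximalIdeal R).map (cmpl (R := R))

/-- Hironaka's characteristic polyhedron `Δ(f; u_1, ..., u_d)`: the intersection
of the `Δ(f; u; ŷ)` over all regular systems of parameters `(ŷ, u_1, ..., u_d)`
of the completion `R̂`. -/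
def CharPolyhedron {d : ℕ} [IsLocalRing R] (f : R) (u : Fin d → R) : Set (Fin d → ℝ) :=
  ⋂ yh ∈ {yh : Completion R | IsRSPhat R yh u},
    DeltaOf (cmpl f) yh (fun i => cmpl (u i)) (ordRes f u)

/-! ### G-rings, excellence -/

/-- A `κ`-algebra `A` is geometrically regular if `κ' ⊗[κ] A` is a regular ring
for every finite field extension `κ'/κ`. -/
def IsGeometricallyRegularAlgebra (κ : Type u) [Field κ] (A : Type v) [CommRing A]
    [Algebra κ A] : Prop :=
  ∀ (κ' : Type u) [Field κ'] [Algebra κ κ'] [Module.Finite κ κ'],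
    IsRegularRing (κ' ⊗[κ] A)

/-- A local ring has geometrically regular formal fibers if, for every prime
`P ⊂ R`, the formal fiber `κ(P) ⊗_R R̂` is a geometrically regular
`κ(P)`-algebra. -/
def HasGeomRegularFormalFibers (R : Type u) [CommRing R] [IsLocalRing R] : Prop :=
  ∀ (P : Ideal R) [P.IsPrime],
    IsGeometricallyRegularAlgebra (ResidueField (Localization.AtPrime P))
      (ResidueField (Localization.AtPrime P) ⊗[R] Completion R)

/-- A G-ring: a Noetherian ring all of whose localizations at primes have
geometrically regular formal fibers. -/
def IsGRing (A : Type u) [CommRing A] : Prop :=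
  IsNoetherianRing A ∧ ∀ (P : Ideal A) [P.IsPrime],
    HasGeomRegularFormalFibers (Localization.AtPrime P)

/-- A saturated chain of primes: each step is a covering relation. -/
def IsSaturatedChain {A : Type u} [CommRing A] (c : LTSeries (PrimeSpectrum A)) : Prop :=
  ∀ i : Fin c.length, c.toFun i.castSucc ⋖ c.toFun i.succ

/-- A catenary ring: any two saturated chains of primes with the same endpoints
have the same length. -/
def IsCatenary (A : Type u) [CommRing A] : Prop :=
  ∀ (c₁ c₂ : LTSeries (PrimeSpectrum A)), c₁.head = c₂.head → c₁.last = c₂.last →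
    IsSaturatedChain c₁ → IsSaturatedChain c₂ → c₁.length = c₂.length

/-- Universally catenary: all polynomial rings over `A` are catenary. -/
def IsUniversallyCatenary (A : Type u) [CommRing A] : Prop :=
  ∀ n : ℕ, IsCatenary (MvPolynomial (Fin n) A)

/-- The regular locus of any domain finite over `A` is open. -/
def HasOpenRegularLocus (A : Type u) [CommRing A] : Prop :=
  ∀ (B : Type u) [CommRing B] [IsDomain B] [Algebra A B] [Module.Finite A B],
    IsOpen {P : PrimeSpectrum B | IsRegularLocalRing (Localization.AtPrime P.asIdeal)}

/-- Quasi-excellent: a G-ring with open regular loci for finite domains over it. -/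
def IsQuasiExcellent (A : Type u) [CommRing A] : Prop :=
  IsGRing A ∧ HasOpenRegularLocus A

/-- Excellent: universally catenary and quasi-excellent. -/
def IsExcellent (A : Type u) [CommRing A] : Prop :=
  IsUniversallyCatenary A ∧ IsQuasiExcellent A

/-! ### Monomial valuations and associated graded rings -/

/-- The weight `l·b + L(a)` of the monomial `y^b u^a`. -/
def weight {d : ℕ} (l : ℝ) (L : Fin d → ℝ) (ab : (Fin d → ℕ) × ℕ) : ℝ :=
  l * (ab.2 : ℝ) + ∑ i, L i * (ab.1 i : ℝ)

/-- The ideal `I_λ` generated by the monomials `y^b u^a` with `l·b + L(a) ≥ λ`. -/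
def monIdeal {d : ℕ} (y : R) (u : Fin d → R) (l : ℝ) (L : Fin d → ℝ) (lam : ℝ) :
    Ideal R :=
  Ideal.span {g | ∃ ab : (Fin d → ℕ) × ℕ, g = monomial y u ab ∧ lam ≤ weight l L ab}

/-- The monomial valuation `v(g) := max {λ : g ∈ I_λ}`. -/
def vval {d : ℕ} (y : R) (u : Fin d → R) (l : ℝ) (L : Fin d → ℝ) (g : R) : ℝ :=
  sSup {lam : ℝ | g ∈ monIdeal y u l L lam}

/-- The Rees algebra `⊕_λ I_λ` of the filtration `(I_λ)`, realized inside the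
monoid algebra `R[ℝ]`. -/
def ReesAlgebra {d : ℕ} (y : R) (u : Fin d → R) (l : ℝ) (L : Fin d → ℝ) :
    Subalgebra R (AddMonoidAlgebra R ℝ) :=
  Algebra.adjoin R {p | ∃ (lam : ℝ) (x : R), x ∈ monIdeal y u l L lam ∧
    p = AddMonoidAlgebra.single lam x}

/-- The ideal `⊕_λ I_{λ⁺}` of the Rees algebra. -/
def grIdeal {d : ℕ} (y : R) (u : Fin d → R) (l : ℝ) (L : Fin d → ℝ) :
    Ideal (ReesAlgebra y u l L) :=
  Ideal.span {p | ∃ (lam : ℝ) (x : R), (∃ lam' > lam, x ∈ monIdeal y u l L lam') ∧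
    (p : AddMonoidAlgebra R ℝ) = AddMonoidAlgebra.single lam x}

/-- The associated graded ring `gr_v(R) = ⊕_λ I_λ / I_{λ⁺}` of `R` with respect
to the monomial valuation `v`, realized as `(⊕_λ I_λ) / (⊕_λ I_{λ⁺})`. -/
abbrev GrRing {d : ℕ} (y : R) (u : Fin d → R) (l : ℝ) (L : Fin d → ℝ) : Type u :=
  ReesAlgebra y u l L ⧸ grIdeal y u l L

/-- `x ∈ gr_v(R)` is the initial form of `g ∈ R`: the class of `g` placed in
degree `v(g)`. -/
def IsInitialForm {d : ℕ} (y : R) (u : Fin d → R) (l : ℝ) (L : Fin d → ℝ) (g : R)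
    (x : GrRing y u l L) : Prop :=
  ∃ h : AddMonoidAlgebra.single (vval y u l L g) g ∈ ReesAlgebra y u l L,
    x = Ideal.Quotient.mk (grIdeal y u l L)
      ⟨AddMonoidAlgebra.single (vval y u l L g) g, h⟩

set_option linter.all false

theorem dom_aux (n : ℕ) : ∀ (A : Type u) [CommRing A] [IsLocalRing A] [IsNoetherianRing A]
    (s : Finset A), s.card ≤ n → Ideal.span (s : Set A) = maximalIdeal A →
    (n : WithBot ℕ∞) ≤ ringKrullDim A → IsDomain A := by
  classical
  induction n with
  | zero =>
    intro A _ _ _ s hs hspan _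
    have h0 : s = ∅ := by simpa using hs
    subst h0
    have hM : maximalIdeal A = ⊥ := by rw [← hspan]; simp
    exact ((IsLocalRing.isField_iff_maximalIdeal_eq).2 hM).isDomain
  | succ n ih =>
    intro A _ _ _ s hs hspan hdim
    have hht := IsLocalRing.maximalIdeal_height_eq_ringKrullDim (R := A)
    have hht1 : 1 ≤ (maximalIdeal A).height := by
      have : ((1 : ℕ∞) : WithBot ℕ∞) ≤ ((maximalIdeal A).height : WithBot ℕ∞) := by
        rw [hht]; refine le_trans ?_ hdim
        exact_mod_cast Nat.le_add_left 1 n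
      exact_mod_cast this
    have hne : ∀ p ∈ minimalPrimes A, ¬ maximalIdeal A ≤ p := by
      intro p hp hle
      haveI : p.IsPrime := Ideal.IsMinimalPrime.isPrime hp
      have : p = maximalIdeal A := le_antisymm (IsLocalRing.le_maximalIdeal ‹p.IsPrime›.ne_top) hle
      have h2 : p.height = 0 := by
        rw [Ideal.height_eq_zero_iff]; exact hp
      rw [← this, h2] at hht1
      simp at hht1
    have hne2 : ¬ maximalIdeal A ≤ (maximalIdeal A)^2 := by
      intro hle
      have hb : maximalIdeal A = ⊥ := by
        refine Submodule.eq_bot_of_le_smul_of_le_jacobson_bot (maximalIdeal A) _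
          (IsNoetherian.noetherian _) ?_ ?_
        · rw [smul_eq_mul, ← pow_two]; exact hle
        · exact IsLocalRing.maximalIdeal_le_jacobson ⊥
      have hf := ((IsLocalRing.isField_iff_maximalIdeal_eq).2 hb)
      have : (⊥ : Ideal A) ∈ minimalPrimes A := by
        haveI := hf.isDomain
        rw [IsDomain.minimalPrimes_eq_singleton_bot]; rfl
      exact hne _ this hb.le
    obtain ⟨x, hxM, hx2, hxp⟩ : ∃ x ∈ maximalIdeal A, x ∉ (maximalIdeal A)^2 ∧
        ∀ p ∈ minimalPrimes A, x ∉ p := by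
      by_contra hcon
      push Not at hcon
      have hfin := minimalPrimes.finite_of_isNoetherianRing A
      have := (Ideal.subset_union_prime (s := insert ((maximalIdeal A)^2) hfin.toFinset)
        (f := id) ((maximalIdeal A)^2) ((maximalIdeal A)^2) (I := maximalIdeal A) (by
          intro i hi h1 _
          simp only [Finset.mem_insert, Set.Finite.mem_toFinset] at hi
          rcases hi with hi | hi
          · exact absurd hi h1
          · exact Ideal.IsMinimalPrime.isPrime hi)).1 (by
          intro x hx
          simp only [Finset.coe_insert, Set.Finite.coe_toFinset, Set.mem_iUnion]
          by_cases h : x ∈ (maximalIdeal A)^2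
          · exact ⟨_, Or.inl rfl, h⟩
          · obtain ⟨p, hp, hxp⟩ := hcon x hx h
            exact ⟨p, Or.inr hp, hxp⟩)
      obtain ⟨i, hi, hle⟩ := this
      simp only [Finset.mem_insert, Set.Finite.mem_toFinset] at hi
      rcases hi with rfl | hi
      · exact hne2 hle
      · exact hne _ hi hle
    -- some coefficient is a unit
    have hxs : x ∈ Ideal.span (s : Set A) := hspan ▸ hxM
    obtain ⟨c, hc⟩ := Submodule.mem_span_finset'.1 hxs
    obtain ⟨i, hi⟩ : ∃ i : s, IsUnit (c i) := by
      by_contra hcon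
      push Not at hcon
      apply hx2
      rw [← hc, pow_two]
      refine Ideal.sum_mem _ fun i _ => Ideal.mul_mem_mul ?_ ?_
      · exact (IsLocalRing.mem_maximalIdeal _).2 (hcon i)
      · rw [← hspan]; exact Ideal.subset_span i.2
    -- quotient
    set I : Ideal A := Ideal.span {x} with hI
    have hIM : I ≤ maximalIdeal A := by
      rw [hI, Ideal.span_singleton_le_iff_mem]; exact hxM
    haveI : Nontrivial (A ⧸ I) := Ideal.Quotient.nontrivial_iff.2
      (fun h => (IsLocalRing.maximalIdeal.isMaximal A).ne_top (top_le_iff.1 (h ▸ hIM)))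
    haveI : IsLocalRing (A ⧸ I) := .of_surjective' (Ideal.Quotient.mk I) Ideal.Quotient.mk_surjective
    have hmapM : (maximalIdeal A).map (Ideal.Quotient.mk I) = maximalIdeal (A ⧸ I) := by
      have := IsLocalRing.map_maximalIdeal_of_surjective (Ideal.Quotient.mk I) Ideal.Quotient.mk_surjective
      exact this
    have hd2 : (n : WithBot ℕ∞) ≤ ringKrullDim (A ⧸ I) := by
      have h := ringKrullDim_le_ringKrullDim_quotient_add_card ({x} : Finset A)
        (by rw [IsLocalRing.ringJacobson_eq_maximalIdeal]; simpa using hxM)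
      have h2 := hdim.trans h
      rw [Finset.card_singleton] at h2
      push_cast at h2
      rw [Finset.coe_singleton] at h2
      exact ENat.WithBot.add_le_add_one_right_iff.1 h2
    have hdom : IsDomain (A ⧸ I) := by
      refine ih (A ⧸ I) ((s.erase i).image (Ideal.Quotient.mk I)) ?_ ?_ hd2
      · refine Finset.card_image_le.trans ?_
        rw [Finset.card_erase_of_mem i.2]; omega
      · rw [← hmapM, ← hspan, Ideal.map_span]
        apply le_antisymm
        · apply Ideal.span_mono
          simp only [Finset.coe_image, Finset.coe_erase]
          exact Set.image_mono Set.sdiff_subset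
        · rw [Ideal.span_le]
          rintro _ ⟨a, ha, rfl⟩
          by_cases hai : a = i
          · subst hai
            obtain ⟨v, hv⟩ := hi
            have : (Ideal.Quotient.mk I (i:A)) = Ideal.Quotient.mk I (-(↑v⁻¹ * ∑ j ∈ Finset.univ.erase i, c j * (j:A))) := by
              rw [Ideal.Quotient.eq, hI, Ideal.mem_span_singleton]
              refine ⟨↑v⁻¹, ?_⟩
              rw [← hc, ← Finset.add_sum_erase _ _ (Finset.mem_univ i)]
              simp only [smul_eq_mul]
              rw [← hv]
              have := v.inv_mul
              linear_combination (-(i:A)) * this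
            rw [this]
            simp only [map_neg, map_mul, map_sum, SetLike.mem_coe]
            refine neg_mem (Ideal.mul_mem_left _ _ (Ideal.sum_mem _ fun j hj => Ideal.mul_mem_left _ _ (Ideal.subset_span ?_)))
            simp only [Finset.coe_image, Finset.coe_erase]
            refine ⟨j, ⟨j.2, ?_⟩, rfl⟩
            intro h
            exact (Finset.mem_erase.1 hj).1 (Subtype.ext h)
          · apply Ideal.subset_span
            simp only [Finset.coe_image, Finset.coe_erase]
            exact ⟨a, ⟨ha, hai⟩, rfl⟩
    have hIprime : I.IsPrime := (Ideal.Quotient.isDomain_iff_prime I).1 hdom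
    obtain ⟨p, hp, hpI⟩ := Ideal.exists_minimalPrimes_le (I := (⊥ : Ideal A)) (J := I) bot_le
    haveI hpp : p.IsPrime := Ideal.IsMinimalPrime.isPrime hp
    have hxp' : x ∉ p := hxp p hp
    have hp0 : p = ⊥ := by
      refine Submodule.eq_bot_of_le_smul_of_le_jacobson_bot (maximalIdeal A) _
          (IsNoetherian.noetherian _) ?_ (IsLocalRing.maximalIdeal_le_jacobson ⊥)
      intro a ha
      obtain ⟨b, hb⟩ := Ideal.mem_span_singleton'.1 (hpI ha)
      have hbp : b ∈ p := by
        rcases hpp.mem_or_mem (hb ▸ ha) with h | h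
        · exact h
        · exact absurd h hxp'
      rw [← hb, mul_comm]
      exact Ideal.mul_mem_mul hxM hbp
    rw [hp0] at hpp
    exact IsDomain.of_bot_isPrime A

/-- generators of the maximal ideal, as many as the dimension -/
theorem span_prime {A : Type u} [CommRing A] [IsLocalRing A] [IsNoetherianRing A]
    {σ : Type*} [Fintype σ] (w : σ → A) (hw : Ideal.span (Set.range w) = maximalIdeal A)
    (hd : (Fintype.card σ : WithBot ℕ∞) ≤ ringKrullDim A) (s : Finset σ) :
    (Ideal.span (w '' (s : Set σ))).IsPrime := by
  classical
  set I := Ideal.span (w '' (s : Set σ)) with hI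
  have hwM : ∀ i, w i ∈ maximalIdeal A := fun i => hw ▸ Ideal.subset_span ⟨i, rfl⟩
  have hIM : I ≤ maximalIdeal A := by
    rw [hI, Ideal.span_le]; rintro _ ⟨i, _, rfl⟩; exact hwM i
  haveI : Nontrivial (A ⧸ I) := Ideal.Quotient.nontrivial_iff.2
      (fun h => (IsLocalRing.maximalIdeal.isMaximal A).ne_top (top_le_iff.1 (h ▸ hIM)))
  haveI : IsLocalRing (A ⧸ I) := .of_surjective' (Ideal.Quotient.mk I) Ideal.Quotient.mk_surjective
  have hmapM : (maximalIdeal A).map (Ideal.Quotient.mk I) = maximalIdeal (A ⧸ I) :=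
    IsLocalRing.map_maximalIdeal_of_surjective (Ideal.Quotient.mk I) Ideal.Quotient.mk_surjective
  rw [← Ideal.Quotient.isDomain_iff_prime]
  refine dom_aux (sᶜ.card) (A ⧸ I) ((sᶜ).image (fun i => Ideal.Quotient.mk I (w i)))
    Finset.card_image_le ?_ ?_
  · rw [← hmapM, ← hw, Ideal.map_span]
    apply le_antisymm
    · apply Ideal.span_mono
      intro x hx
      simp only [Finset.coe_image] at hx
      obtain ⟨i, _, rfl⟩ := hx
      exact ⟨w i, ⟨i, rfl⟩, rfl⟩
    · rw [Ideal.span_le]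
      rintro _ ⟨_, ⟨i, rfl⟩, rfl⟩
      by_cases his : i ∈ s
      · have : Ideal.Quotient.mk I (w i) = 0 :=
          Ideal.Quotient.eq_zero_iff_mem.2 (Ideal.subset_span ⟨i, his, rfl⟩)
        rw [this]; exact Ideal.zero_mem _
      · apply Ideal.subset_span
        simp only [Finset.coe_image]
        exact ⟨i, by simpa using his, rfl⟩
  · have h := ringKrullDim_le_ringKrullDim_quotient_add_card (s.image w)
        (by rw [IsLocalRing.ringJacobson_eq_maximalIdeal]; intro x hx
            simp only [Finset.coe_image] at hx
            obtain ⟨i, _, rfl⟩ := hx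
            exact hwM i)
    have h2 : ((sᶜ.card + s.card : ℕ) : WithBot ℕ∞) ≤
        ringKrullDim (A ⧸ Ideal.span (((s.image w) : Finset A) : Set A)) + (s.card : ℕ) := by
      rw [Finset.card_compl_add_card]
      refine (hd.trans h).trans ?_
      gcongr
      exact_mod_cast Finset.card_image_le
    rw [Finset.coe_image] at h2
    push_cast at h2
    exact ENat.WithBot.add_le_add_natCast_right_iff.1 h2

theorem notMem_span {A : Type u} [CommRing A] [IsLocalRing A] [IsNoetherianRing A]
    {σ : Type*} [Fintype σ] (w : σ → A) (hw : Ideal.span (Set.range w) = maximalIdeal A)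
    (hd : (Fintype.card σ : WithBot ℕ∞) ≤ ringKrullDim A) (s : Finset σ) (i : σ) (his : i ∉ s) :
    w i ∉ Ideal.span (w '' (s : Set σ)) := by
  classical
  intro hmem
  have hM : Ideal.span (((Finset.univ.erase i).image w : Finset A) : Set A) = maximalIdeal A := by
    rw [← hw]
    apply le_antisymm
    · apply Ideal.span_mono
      intro x hx
      simp only [Finset.coe_image] at hx
      obtain ⟨i, _, rfl⟩ := hx
      exact ⟨i, rfl⟩
    · rw [Ideal.span_le]
      rintro _ ⟨j, rfl⟩
      by_cases hji : j = i
      · subst hji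
        refine Ideal.span_mono ?_ hmem
        rintro _ ⟨k, hk, rfl⟩
        rw [Finset.coe_image]
        refine ⟨k, ?_, rfl⟩
        have : k ≠ j := fun h => his (h ▸ hk)
        simpa using this
      · apply Ideal.subset_span
        rw [Finset.coe_image]
        exact ⟨j, by simpa using hji, rfl⟩
  have h1 := (maximalIdeal A).height_le_spanFinrank (IsLocalRing.maximalIdeal.isMaximal A).ne_top
  have h2 : (maximalIdeal A).spanFinrank ≤ Fintype.card σ - 1 := by
    have := Submodule.spanFinrank_span_le_ncard_of_finite (R := A)
      (s := (((Finset.univ.erase i).image w : Finset A) : Set A)) (Finset.finite_toSet _)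
    change (Ideal.span _).spanFinrank ≤ _ at this
    rw [hM, Set.ncard_coe_finset] at this
    refine this.trans (Finset.card_image_le.trans ?_)
    rw [Finset.card_erase_of_mem (Finset.mem_univ _)]; simp
  rw [← IsLocalRing.maximalIdeal_height_eq_ringKrullDim] at hd
  have h3 : (Fintype.card σ : ℕ∞) ≤ (maximalIdeal A).height := by exact_mod_cast hd
  have h4 : (Fintype.card σ : ℕ∞) ≤ ((Fintype.card σ - 1 : ℕ) : ℕ∞) :=
    h3.trans (h1.trans (by exact_mod_cast h2))
  have h5 : Fintype.card σ ≤ Fintype.card σ - 1 := by exact_mod_cast h4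
  have : 0 < Fintype.card σ := Fintype.card_pos_iff.2 ⟨i⟩
  omega

/-- regularity in any order -/
def PermReg {A : Type u} [CommRing A] {σ : Type*} (w : σ → A) : Prop :=
  ∀ (s : Finset σ) (i : σ), i ∉ s → ∀ x, w i * x ∈ Ideal.span (w '' (s : Set σ)) →
    x ∈ Ideal.span (w '' (s : Set σ))

theorem permReg_of_dim {A : Type u} [CommRing A] [IsLocalRing A] [IsNoetherianRing A]
    {σ : Type*} [Fintype σ] (w : σ → A) (hw : Ideal.span (Set.range w) = maximalIdeal A)
    (hd : (Fintype.card σ : WithBot ℕ∞) ≤ ringKrullDim A) : PermReg w := by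
  intro s i his x hx
  exact ((span_prime w hw hd s).mem_or_mem hx).resolve_left (notMem_span w hw hd s i his)

theorem PermReg.comp {A : Type u} [CommRing A] {σ τ : Type*} {w : σ → A} (h : PermReg w)
    (g : τ → σ) (hg : Function.Injective g) : PermReg (fun t => w (g t)) := by
  classical
  intro s i his x hx
  have key : (fun t => w (g t)) '' (s : Set τ) = w '' ((s.image g : Finset σ) : Set σ) := by
    rw [Finset.coe_image, Set.image_image]
  rw [key] at hx ⊢
  refine h _ (g i) ?_ x hx
  simp only [Finset.mem_image, not_exists, not_and]
  intro j hj hji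
  exact his (hg hji ▸ hj)

/-- ideal generated by powers -/
def powId {A : Type u} [CommRing A] {σ : Type*} (w : σ → A) (n : σ → ℕ) (s : Finset σ) : Ideal A :=
  Ideal.span ((fun i => w i ^ n i) '' (s : Set σ))

theorem mem_powId_insert {A : Type u} [CommRing A] {σ : Type*} [DecidableEq σ] {w : σ → A}
    {n : σ → ℕ} {s : Finset σ} {j : σ} {x : A} :
    x ∈ powId w n (insert j s) ↔ ∃ a, ∃ z ∈ powId w n s, x = a * w j ^ n j + z := by
  unfold powId
  rw [Finset.coe_insert, Set.image_insert_eq, Ideal.mem_span_insert]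

theorem powId_congr {A : Type u} [CommRing A] {σ : Type*} {w : σ → A}
    {n n' : σ → ℕ} {s : Finset σ} (h : ∀ i ∈ s, n i = n' i) : powId w n s = powId w n' s := by
  unfold powId
  congr 1
  apply Set.image_congr
  intro i hi
  rw [h i hi]

theorem PermReg.pow_aux {A : Type u} [CommRing A] {σ : Type*} {w : σ → A} (h : PermReg w) (N : ℕ) :
    ∀ (s : Finset σ) (n : σ → ℕ), ∑ i ∈ s, n i ≤ N → ∀ k ∉ s, ∀ x,
      w k * x ∈ powId w n s → x ∈ powId w n s := by
  classical
  induction N using Nat.strong_induction_on with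
  | _ N ih =>
  intro s n hN k hk x hx
  by_cases h0 : ∃ j ∈ s, n j = 0
  · obtain ⟨j, hj, hn⟩ := h0
    have : (1 : A) ∈ powId w n s := Ideal.subset_span ⟨j, hj, by simp [hn]⟩
    rw [(Ideal.eq_top_iff_one _).2 this]; trivial
  by_cases h1 : ∃ j ∈ s, 1 < n j
  · obtain ⟨j, hj, hn⟩ := h1
    obtain ⟨t, hjt, rfl⟩ : ∃ t, j ∉ t ∧ insert j t = s :=
      ⟨s.erase j, Finset.notMem_erase j s, Finset.insert_erase hj⟩
    obtain ⟨p, hp⟩ : ∃ p, n j = p + 2 := ⟨n j - 2, by omega⟩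
    rw [Finset.sum_insert hjt] at hN
    have hup : ∀ q, ∀ i ∈ t, Function.update n j q i = n i := by
      intro q i hi
      rw [Function.update_of_ne]
      rintro rfl; exact hjt hi
    have hsum : ∀ q, ∑ i ∈ insert j t, Function.update n j q i = q + ∑ i ∈ t, n i := by
      intro q
      rw [Finset.sum_insert hjt, Function.update_self, Finset.sum_congr rfl (hup q)]
    have hmem : ∀ q y, y ∈ powId w (Function.update n j q) (insert j t) ↔
        ∃ a, ∃ z ∈ powId w n t, y = a * w j ^ q + z := by
      intro q y
      rw [mem_powId_insert, Function.update_self, powId_congr (hup q)]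
    rw [mem_powId_insert] at hx
    obtain ⟨a, q, hq, hax⟩ := hx
    rw [hp] at hax hN
    have hkt : k ∉ t := fun h => hk (Finset.mem_insert_of_mem h)
    have hx1 := ih (N - 1) (by omega) (insert j t) (Function.update n j (p+1))
      (by rw [hsum]; omega) k hk x ((hmem _ _).2 ⟨a * w j, q, hq, by rw [hax]; ring⟩)
    obtain ⟨b, q', hq', hbx⟩ := (hmem _ _).1 hx1
    have hpow : ∀ r z, w j ^ r * z ∈ powId w n t → z ∈ powId w n t := by
      intro r
      induction r with
      | zero => intro z hz; simpa using hz
      | succ r ihr =>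
        intro z hz
        apply ihr
        refine ih (N-1) (by omega) t n (by omega) j hjt _ ?_
        convert hz using 1; ring
    have h3 : w k * b - a * w j ∈ powId w n t := by
      apply hpow (p+1)
      have : w j ^ (p+1) * (w k * b - a * w j) = q - w k * q' := by
        rw [hbx] at hax
        linear_combination hax
      rw [this]
      exact sub_mem hq (Ideal.mul_mem_left _ _ hq')
    have h4 := ih (N - 1) (by omega) (insert j t) (Function.update n j 1)
      (by rw [hsum]; omega) k hk b ((hmem _ _).2 ⟨a, _, h3, by ring⟩)
    obtain ⟨b', q'', hq'', hbb⟩ := (hmem _ _).1 h4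
    rw [mem_powId_insert]
    refine ⟨b', q'' * w j ^ (p+1) + q', add_mem (Ideal.mul_mem_right _ _ hq'') hq', ?_⟩
    rw [hbx, hbb, hp]; ring
  · push Not at h0 h1
    have hn1 : ∀ j ∈ s, n j = 1 := fun j hj => by
      have := h0 j hj; have := h1 j hj; omega
    have : powId w n s = Ideal.span (w '' (s : Set σ)) := by
      rw [powId_congr (n' := fun _ => 1) hn1]
      unfold powId
      simp
    rw [this] at hx ⊢
    exact h s k hk x hx

theorem PermReg.pow {A : Type u} [CommRing A] {σ : Type*} {w : σ → A} (h : PermReg w)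
    (s : Finset σ) (n : σ → ℕ) (k : σ) (hk : k ∉ s) (r : ℕ) (x : A)
    (hx : w k ^ r * x ∈ powId w n s) : x ∈ powId w n s := by
  induction r generalizing x with
  | zero => simpa using hx
  | succ r ihr =>
    apply ihr
    refine h.pow_aux _ s n le_rfl k hk _ ?_
    convert hx using 1; ring

theorem PermReg.coef_aux {A : Type u} [CommRing A] {σ : Type*} [Fintype σ] [DecidableEq σ]
    {w : σ → A} (h : PermReg w)
    (e : σ → ℕ) (c : A) (s : Finset σ) (hc : c * ∏ i ∈ s, w i ^ e i ∈
      powId w (fun i => if i ∈ s then e i + 1 else 1) Finset.univ) :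
    c ∈ Ideal.span (Set.range w) := by
  induction s using Finset.induction_on with
  | empty =>
    simpa [powId] using hc
  | insert k s hks ih =>
    apply ih
    set n := (fun i => if i ∈ insert k s then e i + 1 else 1) with hn
    set n' := (fun i => if i ∈ s then e i + 1 else 1) with hn'
    have hcongr : powId w n (Finset.univ.erase k) = powId w n' (Finset.univ.erase k) := by
      apply powId_congr
      intro i hi
      have : i ≠ k := (Finset.mem_erase.1 hi).1
      simp [hn, hn', this]
    rw [← Finset.insert_erase (Finset.mem_univ k), mem_powId_insert] at hc ⊢
    obtain ⟨a, q, hq, hcq⟩ := hc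
    rw [hcongr] at hq
    have hnk : n k = e k + 1 := by simp [hn]
    have hnk' : n' k = 1 := by simp [hn', hks]
    have := h.pow (Finset.univ.erase k) n' k (Finset.notMem_erase _ _) (e k)
      (c * ∏ i ∈ s, w i ^ e i - a * w k) (by
        have h2 : w k ^ e k * (c * ∏ i ∈ s, w i ^ e i - a * w k) = q := by
          rw [Finset.prod_insert hks, hnk] at hcq
          linear_combination hcq
        rw [h2]; exact hq)
    exact ⟨a, _, this, by rw [hnk']; ring⟩

/-- Lemma M -/
theorem PermReg.coef {A : Type u} [CommRing A] {σ : Type*} [Fintype σ]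
    {w : σ → A} (h : PermReg w) (B : Set (σ → ℕ))
    (e : σ → ℕ) (c : A) (hB : ∀ β ∈ B, ¬ β ≤ e)
    (hc : c * ∏ i, w i ^ e i ∈ Ideal.span ((fun β : σ → ℕ => ∏ i, w i ^ β i) '' B)) :
    c ∈ Ideal.span (Set.range w) := by
  classical
  apply h.coef_aux e c Finset.univ
  refine (Ideal.span_le.2 ?_) hc
  rintro _ ⟨β, hβ, rfl⟩
  have := hB β hβ
  rw [Pi.le_def] at this
  push Not at this
  obtain ⟨i, hi⟩ := this
  have hd : w i ^ (e i + 1) ∣ ∏ i, w i ^ β i :=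
    (pow_dvd_pow _ hi).trans (Finset.dvd_prod_of_mem _ (Finset.mem_univ i))
  refine Ideal.mem_of_dvd _ hd (Ideal.subset_span ⟨i, by simp, by simp⟩)

section Mono

variable {A : Type u} [CommRing A] {ι : Type v} [Fintype ι]

/-- monomials over an arbitrary index type -/
def mo (y : A) (w : ι → A) (p : (ι → ℕ) × ℕ) : A := y ^ p.2 * ∏ i, w i ^ p.1 i

/-- monomial in `w` only -/
def um (w : ι → A) (e : ι → ℕ) : A := ∏ i, w i ^ e i

/-- monomial ideal -/
def mI (y : A) (w : ι → A) (B : Set ((ι → ℕ) × ℕ)) : Ideal A := Ideal.span (mo y w '' B)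

/-- the family `(y, w)` -/
def oo (y : A) (w : ι → A) : Option ι → A := fun o => o.elim y w

theorem um_add (w : ι → A) (e e' : ι → ℕ) : um w (e + e') = um w e * um w e' := by
  simp [um, pow_add, Finset.prod_mul_distrib]

theorem um_zero (w : ι → A) : um w 0 = 1 := by simp [um]

theorem um_nsmul (w : ι → A) (n : ℕ) (e : ι → ℕ) : um w (n • e) = um w e ^ n := by
  simp [um, ← Finset.prod_pow, ← pow_mul, mul_comm]

theorem um_single [DecidableEq ι] (w : ι → A) (i : ι) : um w (Pi.single i 1) = w i := by
  unfold um
  rw [Finset.prod_eq_single i]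
  · simp
  · intro j _ hj; simp [hj]
  · simp

theorem mo_eq (y : A) (w : ι → A) (p) : mo y w p = y ^ p.2 * um w p.1 := rfl

theorem mo_zero_right (y : A) (w : ι → A) (e : ι → ℕ) : mo y w (e, 0) = um w e := by
  simp [mo_eq]

theorem mo_zero_left (y : A) (w : ι → A) (b : ℕ) : mo y w (0, b) = y ^ b := by
  simp [mo_eq, um_zero]

theorem mo_add (y : A) (w : ι → A) (p q) : mo y w (p + q) = mo y w p * mo y w q := by
  simp only [mo_eq, Prod.fst_add, Prod.snd_add, um_add, pow_add]; ring

theorem um_mem (w : ι → A) (e : ι → ℕ) (he : e ≠ 0) : um w e ∈ Ideal.span (Set.range w) := by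
  obtain ⟨i, hi⟩ : ∃ i, e i ≠ 0 := by
    by_contra h; push Not at h; exact he (funext h)
  have : w i ∣ um w e := (dvd_pow_self _ hi).trans (Finset.dvd_prod_of_mem _ (Finset.mem_univ i))
  exact Ideal.mem_of_dvd _ this (Ideal.subset_span ⟨i, rfl⟩)

theorem um_dvd (w : ι → A) {e e' : ι → ℕ} (h : e ≤ e') : um w e ∣ um w e' :=
  Finset.prod_dvd_prod_of_dvd _ _ fun i _ => pow_dvd_pow _ (h i)

theorem mo_mem {y : A} {w : ι → A} {B} {p} (h : p ∈ B) : mo y w p ∈ mI y w B :=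
  Ideal.subset_span ⟨p, h, rfl⟩

theorem um_mem_mI {y : A} {w : ι → A} {B} {e} (h : (e, 0) ∈ B) : um w e ∈ mI y w B := by
  rw [← mo_zero_right y]; exact mo_mem h

theorem mI_le {y : A} {w : ι → A} {B} {I : Ideal A} : mI y w B ≤ I ↔ ∀ p ∈ B, mo y w p ∈ I := by
  unfold mI; rw [Ideal.span_le]; exact Set.image_subset_iff

theorem mI_mono {y : A} {w : ι → A} {B B'} (h : B ⊆ B') : mI y w B ≤ mI y w B' :=
  Ideal.span_mono (Set.image_mono h)

theorem mI_mul {y : A} {w : ι → A} {B B' B''} (h : ∀ p ∈ B, ∀ q ∈ B', p + q ∈ B'') :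
    mI y w B * mI y w B' ≤ mI y w B'' := by
  unfold mI
  rw [Ideal.span_mul_span', Ideal.span_le]
  rintro _ ⟨_, ⟨p, hp, rfl⟩, _, ⟨q, hq, rfl⟩, rfl⟩
  refine Ideal.subset_span ⟨p + q, h p hp q hq, mo_add _ _ _ _⟩

/-- evaluation of a finite expansion -/
def ev (y : A) (w : ι → A) (c : ((ι → ℕ) × ℕ) →₀ A) : A := c.sum fun p r => r * mo y w p

theorem mem_mI {y : A} {w : ι → A} {B} {x : A} : x ∈ mI y w B ↔
    ∃ c : ((ι → ℕ) × ℕ) →₀ A, (c.support : Set _) ⊆ B ∧ ev y w c = x := by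
  unfold mI
  constructor
  · intro h
    obtain ⟨l, hl, h⟩ := (Finsupp.mem_span_image_iff_linearCombination A).1 h
    exact ⟨l, hl, h⟩
  · rintro ⟨c, hc, rfl⟩
    exact Ideal.sum_mem _ fun p hp => Ideal.mul_mem_left _ _ (Ideal.subset_span ⟨p, hc hp, rfl⟩)

theorem range_oo (y : A) (w : ι → A) : Set.range (oo y w) = insert y (Set.range w) := by
  ext x
  simp only [Set.mem_range, Set.mem_insert_iff, oo]
  constructor
  · rintro ⟨o, rfl⟩
    cases o with
    | none => left; rfl
    | some i => right; exact ⟨i, rfl⟩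
  · rintro (rfl | ⟨i, rfl⟩)
    · exact ⟨none, rfl⟩
    · exact ⟨some i, rfl⟩

/-- Lemma M' -/
theorem mcoef {y : A} {w : ι → A} (hr : PermReg (oo y w)) {B : Set ((ι → ℕ) × ℕ)} {p} {c : A}
    (hB : ∀ β ∈ B, ¬ β ≤ p) (hc : c * mo y w p ∈ mI y w B) :
    c ∈ Ideal.span (insert y (Set.range w)) := by
  have hmo : ∀ p, mo y w p = ∏ o, oo y w o ^ ((fun o : Option ι => o.elim p.2 p.1 : Option ι → ℕ) o) := by
    intro p
    rw [Fintype.prod_option]; rfl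
  rw [← range_oo]
  refine hr.coef ((fun p : (ι → ℕ) × ℕ => (fun o : Option ι => o.elim p.2 p.1 : Option ι → ℕ)) '' B)
    (fun o : Option ι => o.elim p.2 p.1) c ?_ ?_
  · rintro _ ⟨β, hβ, rfl⟩ hle
    apply hB β hβ
    exact ⟨fun i => hle (some i), hle none⟩
  · rw [← hmo, Set.image_image]
    convert hc using 2
    unfold mI
    congr 1
    ext x
    simp only [Set.mem_image]
    constructor
    · rintro ⟨q, hq, rfl⟩; exact ⟨q, hq, hmo q⟩
    · rintro ⟨q, hq, rfl⟩; exact ⟨q, hq, (hmo q).symm⟩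

/-- Lemma E -/
theorem supp_subset {y : A} {w : ι → A} (hr : PermReg (oo y w))
    (hpr : Ideal.span (insert y (Set.range w)) ≠ ⊤)
    {c : ((ι → ℕ) × ℕ) →₀ A} (hc : ∀ p ∈ c.support, IsUnit (c p))
    {B : Set ((ι → ℕ) × ℕ)} (hB : ∀ p ∈ B, ∀ q, p ≤ q → q ∈ B)
    (hf : ev y w c ∈ mI y w B) : (c.support : Set _) ⊆ B := by
  classical
  by_contra hcon
  have hne : (c.support.filter (fun p => p ∉ B)).Nonempty := by
    obtain ⟨p, hp, hpB⟩ := Set.not_subset.1 hcon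
    exact ⟨p, Finset.mem_filter.2 ⟨hp, hpB⟩⟩
  obtain ⟨p, hp⟩ := Finset.exists_minimal hne
  have hp1 := (Finset.mem_filter.1 hp.prop)
  have : c p ∈ Ideal.span (insert y (Set.range w)) := by
    refine mcoef hr (B := B ∪ ((c.support.filter (fun p => p ∉ B)).erase p : Finset _)) (p := p) ?_ ?_
    · rintro β (hβ | hβ) hle
      · exact hp1.2 (hB β hβ p hle)
      · have hβ' := Finset.mem_erase.1 hβ
        exact hβ'.1 (le_antisymm hle (hp.le_of_le hβ'.2 hle))
    · have hsum : ev y w c = c p * mo y w p + ∑ q ∈ c.support.erase p, c q * mo y w q := by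
        unfold ev Finsupp.sum
        rw [← Finset.add_sum_erase _ _ hp1.1]
      have : c p * mo y w p = ev y w c - ∑ q ∈ c.support.erase p, c q * mo y w q := by
        rw [hsum]; ring
      rw [this]
      refine sub_mem (mI_mono Set.subset_union_left hf) (Ideal.sum_mem _ fun q hq => Ideal.mul_mem_left _ _ (mo_mem ?_))
      by_cases hqB : q ∈ B
      · exact Or.inl hqB
      · right
        have := Finset.mem_erase.1 hq
        simp [this.1, hqB, Finsupp.mem_support_iff.1 this.2]
  exact hpr (Ideal.eq_top_of_isUnit_mem _ this (hc p hp1.1))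

/-- degree -/
def dg (p : (ι → ℕ) × ℕ) : ℕ := p.2 + ∑ i, p.1 i

theorem dg_mono {p q : (ι → ℕ) × ℕ} (h : p ≤ q) : dg p ≤ dg q :=
  add_le_add h.2 (Finset.sum_le_sum fun i _ => h.1 i)

theorem dg_add (p q : (ι → ℕ) × ℕ) : dg (p + q) = dg p + dg q := by
  simp [dg, Finset.sum_add_distrib]; ring

theorem span_eq_mI (y : A) (w : ι → A) :
    Ideal.span (insert y (Set.range w)) = mI y w {p | dg p = 1} := by
  classical
  apply le_antisymm
  · rw [Ideal.span_le]
    rintro x (rfl | ⟨i, rfl⟩)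
    · have := mo_mem (y := x) (w := w) (B := {p | dg p = 1}) (p := (0, 1)) (by simp [dg])
      rw [mo_zero_left] at this
      simpa using this
    · have := um_mem_mI (y := y) (w := w) (B := {p | dg p = 1}) (e := Pi.single i 1) (by simp [dg])
      rw [um_single] at this
      exact this
  · rw [mI_le]
    intro p hp
    by_cases h : p.2 = 0
    · have hne : p.1 ≠ 0 := by
        intro h1; simp [dg, h, h1] at hp
      rw [mo_eq, h, pow_zero, one_mul]
      exact Ideal.span_mono (Set.subset_insert _ _) (um_mem w p.1 hne)
    · rw [mo_eq]
      exact Ideal.mul_mem_right _ _ (Ideal.mem_of_dvd _ (dvd_pow_self y h) (Ideal.subset_span (Or.inl rfl)))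

theorem pow_le_mI (y : A) (w : ι → A) (N : ℕ) :
    (Ideal.span (insert y (Set.range w))) ^ N ≤ mI y w {p | dg p = N} := by
  induction N with
  | zero =>
    have : (1 : A) ∈ mI y w {p | dg p = 0} := by
      have := mo_mem (y := y) (w := w) (B := {p | dg p = 0}) (p := (0, 0)) (by simp [dg])
      rw [mo_zero_left] at this
      simpa using this
    rw [(Ideal.eq_top_iff_one _).2 this]; exact le_top
  | succ N ih =>
    rw [pow_succ]
    refine (Ideal.mul_mono ih (span_eq_mI y w).le).trans (mI_mul ?_)
    intro p hp q hq
    simp only [Set.mem_setOf_eq] at *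
    rw [dg_add, hp, hq]

theorem mo_mem_pow (y : A) (w : ι → A) (p) :
    mo y w p ∈ (Ideal.span (insert y (Set.range w))) ^ (dg p) := by
  rw [mo_eq, dg, pow_add]
  have h1 : y ∈ Ideal.span (insert y (Set.range w)) := Ideal.subset_span (Or.inl rfl)
  have h2 : ∀ i, w i ∈ Ideal.span (insert y (Set.range w)) := fun i => Ideal.subset_span (Or.inr ⟨i, rfl⟩)
  refine Ideal.mul_mem_mul (Ideal.pow_mem_pow h1 _) ?_
  rw [← Finset.prod_pow_eq_pow_sum]
  exact Ideal.prod_mem_prod fun i _ => Ideal.pow_mem_pow (h2 i) _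

theorem krull_mem [IsLocalRing A] [IsNoetherianRing A] (Q : Ideal A) (f : A)
    (h : ∀ n, f ∈ Q ⊔ (maximalIdeal A) ^ n) : f ∈ Q := by
  have := Ideal.iInf_pow_smul_eq_bot_of_isLocalRing (M := A ⧸ Q) (maximalIdeal A)
    (IsLocalRing.maximalIdeal.isMaximal A).ne_top
  rw [← Ideal.Quotient.eq_zero_iff_mem, ← Submodule.mem_bot A, ← this, Submodule.mem_iInf]
  intro n
  obtain ⟨a, ha, b, hb, rfl⟩ := Submodule.mem_sup.1 (h n)
  rw [map_add, Ideal.Quotient.eq_zero_iff_mem.2 ha, zero_add]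
  have : Ideal.Quotient.mk Q b = b • (1 : A ⧸ Q) := by
    rw [Algebra.smul_def, mul_one]; rfl
  rw [this]
  exact Submodule.smul_mem_smul hb trivial

/-- Lemma U -/
theorem exists_unit_expansion [IsLocalRing A] [IsNoetherianRing A] {y : A} {w : ι → A}
    (hr : PermReg (oo y w)) (hM : Ideal.span (insert y (Set.range w)) = maximalIdeal A) (f : A) :
    ∃ c : ((ι → ℕ) × ℕ) →₀ A, (∀ p ∈ c.support, IsUnit (c p)) ∧ ev y w c = f := by
  classical
  let Ach : ℕ → (((ι → ℕ) × ℕ) →₀ A) → Prop := fun N c =>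
    (∀ p ∈ c.support, IsUnit (c p)) ∧ (∀ p ∈ c.support, dg p < N) ∧ f - ev y w c ∈ maximalIdeal A ^ N
  have hstep : ∀ N c, Ach N c → ∃ c', Ach (N+1) c' ∧ c.support ⊆ c'.support := by
    rintro N c ⟨hcu, hcd, hcf⟩
    rw [← hM] at hcf
    obtain ⟨l, hl, hlf⟩ := mem_mI.1 (pow_le_mI y w N hcf)
    set l' := l.filter (fun p => IsUnit (l p)) with hl'
    have hdisj : Disjoint c.support l'.support := by
      rw [Finset.disjoint_left]
      intro p hp hp'
      have h1 := hcd p hp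
      have h2 : dg p = N := hl (by rw [hl', Finsupp.support_filter] at hp'; exact (Finset.mem_filter.1 hp').1)
      omega
    have hsupp : (c + l').support = c.support ∪ l'.support := Finsupp.support_add_eq hdisj
    refine ⟨c + l', ⟨?_, ?_, ?_⟩, ?_⟩
    · intro p hp
      rw [hsupp, Finset.mem_union] at hp
      rcases hp with hp | hp
      · have : p ∉ l'.support := Finset.disjoint_left.1 hdisj hp
        rw [Finsupp.add_apply, Finsupp.notMem_support_iff.1 this, add_zero]
        exact hcu p hp
      · have : p ∉ c.support := Finset.disjoint_right.1 hdisj hp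
        rw [Finsupp.add_apply, Finsupp.notMem_support_iff.1 this, zero_add]
        rw [hl', Finsupp.support_filter, Finset.mem_filter] at hp
        rw [hl', Finsupp.filter_apply, if_pos hp.2]
        exact hp.2
    · intro p hp
      rw [hsupp, Finset.mem_union] at hp
      rcases hp with hp | hp
      · exact (hcd p hp).trans (Nat.lt_succ_self N)
      · have h2 : dg p = N := hl (by rw [hl', Finsupp.support_filter] at hp; exact (Finset.mem_filter.1 hp).1)
        omega
    · have hevadd : ∀ a b : ((ι → ℕ) × ℕ) →₀ A, ev y w (a + b) = ev y w a + ev y w b := by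
        intro a b
        exact Finsupp.sum_add_index' (by simp) (by intros; ring)
      have hsplit : l = l' + l.filter (fun p => ¬ IsUnit (l p)) := by
        rw [hl']; exact (Finsupp.filter_pos_add_filter_neg _ _).symm
      have : f - ev y w (c + l') = ev y w (l.filter (fun p => ¬ IsUnit (l p))) := by
        rw [hevadd]
        have h3 : ev y w l = ev y w l' + ev y w (l.filter (fun p => ¬ IsUnit (l p))) := by
          conv_lhs => rw [hsplit]
          exact hevadd _ _
        rw [hlf] at h3
        linear_combination h3
      rw [this]
      refine Ideal.sum_mem _ fun p hp => ?_
      rw [Finsupp.support_filter, Finset.mem_filter] at hp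
      simp only
      rw [Finsupp.filter_apply, if_pos hp.2, pow_succ']
      refine Ideal.mul_mem_mul ((IsLocalRing.mem_maximalIdeal _).2 hp.2) ?_
      have h2 : dg p = N := hl hp.1
      have := mo_mem_pow y w p
      rwa [hM, h2] at this
    · rw [hsupp]; exact Finset.subset_union_left
  have hsteps : ∀ N c, Ach N c → ∀ k, ∃ c', Ach (N+k) c' ∧ c.support ⊆ c'.support := by
    intro N c hc k
    induction k with
    | zero => exact ⟨c, hc, subset_rfl⟩
    | succ k ih =>
      obtain ⟨c', h1, h2⟩ := ih
      obtain ⟨c'', h3, h4⟩ := hstep _ _ h1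
      exact ⟨c'', h3, h2.trans h4⟩
  let SS : Set (Ideal A) := {Q | ∃ N c, Ach N c ∧ Q = mI y w c.support}
  have hSS : SS.Nonempty := ⟨_, 0, 0, ⟨by simp, by simp, by simp⟩, rfl⟩
  obtain ⟨Q, ⟨N, c, hc, rfl⟩, hmax⟩ := set_has_maximal_iff_noetherian.2 ‹IsNoetherianRing A› SS hSS
  have hfQ : f ∈ mI y w (c.support : Set _) := by
    apply krull_mem
    intro n
    obtain ⟨c', h1, h2⟩ := hsteps N c hc n
    have heq : mI y w (c.support : Set _) = mI y w (c'.support : Set _) := by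
      have hle : mI y w (c.support : Set _) ≤ mI y w (c'.support : Set _) :=
        mI_mono (by exact_mod_cast h2)
      by_contra hne
      exact hmax _ ⟨_, c', h1, rfl⟩ (lt_of_le_of_ne hle hne)
    rw [heq]
    have : f = ev y w c' + (f - ev y w c') := by ring
    rw [this]
    refine add_mem (Ideal.mem_sup_left (mem_mI.2 ⟨c', subset_rfl, rfl⟩)) (Ideal.mem_sup_right ?_)
    exact Ideal.pow_le_pow_right (Nat.le_add_left n N) h1.2.2
  set S0 := c.support.filter (fun p => ∀ q ∈ c.support, q ≤ p → q = p) with hS0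
  have hS0c : ∀ p ∈ c.support, ∃ q ∈ S0, q ≤ p := by
    intro p hp
    obtain ⟨q, hq1, hq2⟩ := c.support.exists_le_minimal hp
    refine ⟨q, Finset.mem_filter.2 ⟨hq2.prop, fun r hr hrq => ?_⟩, hq1⟩
    exact le_antisymm hrq (hq2.le_of_le hr hrq)
  have hfS0 : f ∈ mI y w (S0 : Set _) := by
    refine (mI_le.2 ?_) hfQ
    intro p hp
    obtain ⟨q, hq, hqp⟩ := hS0c p hp
    obtain ⟨r, rfl⟩ := exists_add_of_le hqp
    rw [mo_add]
    exact Ideal.mul_mem_right _ _ (mo_mem hq)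
  obtain ⟨r, hr1, hr2⟩ := mem_mI.1 hfS0
  refine ⟨r, ?_, hr2⟩
  intro p hp
  have hpS0 := Finset.mem_filter.1 (hr1 hp)
  have hmem : r p - c p ∈ maximalIdeal A := by
    rw [← hM]
    refine mcoef hr (p := p)
      (B := {q | dg q = N} ∪ (((r.support ∪ c.support).erase p : Finset _) : Set _)) ?_ ?_
    · rintro β (hβ | hβ) hle
      · have h1 := dg_mono hle
        have h2 := hc.2.1 p hpS0.1
        simp only [Set.mem_setOf_eq] at hβ
        omega
      · have h3 := Finset.mem_erase.1 hβ
        rcases Finset.mem_union.1 h3.2 with h4 | h4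
        · exact h3.1 (hpS0.2 β (Finset.mem_filter.1 (hr1 h4)).1 hle)
        · exact h3.1 (hpS0.2 β h4 hle)
    · have h1 : ev y w r = r p * mo y w p + ∑ q ∈ r.support.erase p, r q * mo y w q := by
        unfold ev Finsupp.sum
        rw [← Finset.add_sum_erase _ _ hp]
      have h2 : ev y w c = c p * mo y w p + ∑ q ∈ c.support.erase p, c q * mo y w q := by
        unfold ev Finsupp.sum
        rw [← Finset.add_sum_erase _ _ hpS0.1]
      have h3 : (r p - c p) * mo y w p = (f - ev y w c) - ∑ q ∈ r.support.erase p, r q * mo y w q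
          + ∑ q ∈ c.support.erase p, c q * mo y w q := by
        rw [← hr2, h1, h2]; ring
      rw [h3]
      refine add_mem (sub_mem ?_ ?_) ?_
      · apply mI_mono Set.subset_union_left
        apply pow_le_mI
        rw [hM]; exact hc.2.2
      · refine Ideal.sum_mem _ fun q hq => Ideal.mul_mem_left _ _ (mo_mem (Or.inr ?_))
        have := Finset.mem_erase.1 hq
        exact Finset.mem_erase.2 ⟨this.1, Finset.mem_union_left _ this.2⟩
      · refine Ideal.sum_mem _ fun q hq => Ideal.mul_mem_left _ _ (mo_mem (Or.inr ?_))
        have := Finset.mem_erase.1 hq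
        exact Finset.mem_erase.2 ⟨this.1, Finset.mem_union_right _ this.2⟩
  have hcu := hc.1 p hpS0.1
  by_contra hnu
  have h1 : r p ∈ maximalIdeal A := (IsLocalRing.mem_maximalIdeal _).2 hnu
  have : c p ∈ maximalIdeal A := by
    have := sub_mem h1 hmem
    simpa using this
  exact ((IsLocalRing.mem_maximalIdeal _).1 this) hcu

end Mono

section HSys

variable {A : Type u} [CommRing A] {ι : Type v} [Fintype ι]

/-- linear form -/
def lin (L : ι → ℝ) (e : ι → ℕ) : ℝ := ∑ i, L i * (e i : ℝ)

theorem lin_add (L : ι → ℝ) (e e' : ι → ℕ) : lin L (e + e') = lin L e + lin L e' := by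
  simp [lin, mul_add, Finset.sum_add_distrib]

theorem lin_zero (L : ι → ℝ) : lin L 0 = 0 := by simp [lin]

theorem lin_nsmul (L : ι → ℝ) (n : ℕ) (e : ι → ℕ) : lin L (n • e) = n * lin L e := by
  simp only [lin, Pi.smul_apply, smul_eq_mul, Nat.cast_mul, Finset.mul_sum]
  exact Finset.sum_congr rfl fun i _ => by ring

theorem lin_mono {L : ι → ℝ} (hL : ∀ i, 0 ≤ L i) {e e' : ι → ℕ} (h : e ≤ e') : lin L e ≤ lin L e' :=
  Finset.sum_le_sum fun i _ => mul_le_mul_of_nonneg_left (by exact_mod_cast h i) (hL i)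

theorem lin_nonneg {L : ι → ℝ} (hL : ∀ i, 0 ≤ L i) (e : ι → ℕ) : 0 ≤ lin L e :=
  Finset.sum_nonneg fun i _ => mul_nonneg (hL i) (by positivity)

/-- half space systems -/
def DH (H : Set ((ι → ℝ) × ℝ)) (k : ℕ) : Set (ι → ℕ) := {e | ∀ h ∈ H, k * h.2 ≤ lin h.1 e}

/-- nonnegative -/
def HNN (H : Set ((ι → ℝ) × ℝ)) : Prop := ∀ h ∈ H, ∀ i, 0 ≤ h.1 i

theorem DH_zero {H : Set ((ι → ℝ) × ℝ)} (hH : HNN H) (e) : e ∈ DH H 0 := by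
  intro h hh; simp only [Nat.cast_zero, zero_mul]; exact lin_nonneg (hH h hh) e

theorem DH_add {H : Set ((ι → ℝ) × ℝ)} {k l : ℕ} {e e'} (h1 : e ∈ DH H k) (h2 : e' ∈ DH H l) :
    e + e' ∈ DH H (k + l) := by
  intro h hh
  have := h1 h hh
  have := h2 h hh
  rw [lin_add]; push_cast; linarith

theorem DH_up {H : Set ((ι → ℝ) × ℝ)} (hH : HNN H) {k : ℕ} {e e'} (h1 : e ∈ DH H k) (h2 : e ≤ e') :
    e' ∈ DH H k := fun h hh => (h1 h hh).trans (lin_mono (hH h hh) h2)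

theorem DH_anti {H : Set ((ι → ℝ) × ℝ)} (hH : HNN H) {k l : ℕ} {e} (h1 : e ∈ DH H k) (h2 : l ≤ k) :
    e ∈ DH H l := by
  intro h hh
  have h3 := h1 h hh
  have h4 := lin_nonneg (hH h hh) e
  have h5 : (l : ℝ) ≤ k := by exact_mod_cast h2
  have h6 : (0:ℝ) ≤ l := by positivity
  by_cases h7 : 0 ≤ h.2
  · nlinarith
  · nlinarith

theorem DH_nsmul {H : Set ((ι → ℝ) × ℝ)} {k : ℕ} (hk : 1 ≤ k) {e} (h1 : k • e ∈ DH H k) :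
    e ∈ DH H 1 := by
  intro h hh
  have h3 := h1 h hh
  rw [lin_nsmul] at h3
  have : (0:ℝ) < k := by exact_mod_cast hk
  have := le_of_mul_le_mul_left h3 this
  simpa using this

/-- exponents for the ideal `TT` -/
def BT (H : Set ((ι → ℝ) × ℝ)) (m : ℕ) : Set ((ι → ℕ) × ℕ) := {p | p.1 ∈ DH H (m - p.2)}

theorem BT_up {H : Set ((ι → ℝ) × ℝ)} (hH : HNN H) (m : ℕ) : ∀ p ∈ BT H m, ∀ q, p ≤ q → q ∈ BT H m := by
  intro p hp q hpq
  exact DH_anti hH (DH_up hH hp hpq.1) (Nat.sub_le_sub_left hpq.2 m)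

/-- the ideal attached to a half space system -/
def TT (H : Set ((ι → ℝ) × ℝ)) (m : ℕ) (z : A) (w : ι → A) : Ideal A := mI z w (BT H m)

/-- the ideal of monomials in `w` -/
def JJ (H : Set ((ι → ℝ) × ℝ)) (w : ι → A) : Ideal A := Ideal.span (um w '' DH H 1)

theorem um_mem_JJ {H : Set ((ι → ℝ) × ℝ)} {w : ι → A} {e} (h : e ∈ DH H 1) : um w e ∈ JJ H w :=
  Ideal.subset_span ⟨e, h, rfl⟩

theorem TT_step {H : Set ((ι → ℝ) × ℝ)} (hH : HNN H) (k : ℕ) {z z' : A} {w : ι → A}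
    (hz : z ∈ Ideal.span {z'} ⊔ JJ H w) {x : A} (hx : x ∈ TT H k z' w) : z * x ∈ TT H (k+1) z' w := by
  have key : Ideal.span {z'} ⊔ JJ H w ≤ mI z' w {p | p = (0,1) ∨ (p.2 = 0 ∧ p.1 ∈ DH H 1)} := by
    apply sup_le
    · rw [Ideal.span_singleton_le_iff_mem]
      have := mo_mem (y := z') (w := w) (B := {p | p = (0,1) ∨ (p.2 = 0 ∧ p.1 ∈ DH H 1)}) (p := (0,1)) (Or.inl rfl)
      rw [mo_zero_left, pow_one] at this
      exact this
    · unfold JJ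
      rw [Ideal.span_le]
      rintro _ ⟨e, he, rfl⟩
      exact um_mem_mI (Or.inr ⟨rfl, he⟩)
  refine (mI_mul ?_) (Ideal.mul_mem_mul (key hz) hx)
  rintro p (rfl | ⟨h0, h1⟩) q hq
  · simp only [BT, Set.mem_setOf_eq, Prod.fst_add, Prod.snd_add, zero_add] at hq ⊢
    convert hq using 2
    omega
  · simp only [BT, Set.mem_setOf_eq, Prod.fst_add, Prod.snd_add] at hq ⊢
    rw [h0, zero_add]
    by_cases hk : q.2 ≤ k
    · have := DH_add h1 hq
      convert this using 2
      omega
    · have : k + 1 - q.2 = 0 := by omega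
      rw [this]; exact DH_zero hH _

theorem TT_le {H : Set ((ι → ℝ) × ℝ)} (hH : HNN H) (m : ℕ) {z z' : A} {w : ι → A}
    (hz : z ∈ Ideal.span {z'} ⊔ JJ H w) : TT H m z w ≤ TT H m z' w := by
  unfold TT
  rw [mI_le]
  intro p hp
  have h : ∀ b, z ^ b * um w p.1 ∈ TT H (m - p.2 + b) z' w := by
    intro b
    induction b with
    | zero =>
      rw [pow_zero, one_mul]
      exact um_mem_mI (by simpa [BT] using hp)
    | succ b ih =>
      rw [pow_succ', mul_assoc, ← add_assoc]
      exact TT_step hH _ hz ih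
  refine (mI_mono ?_) (h p.2)
  intro q hq
  exact DH_anti hH hq (by omega)

theorem TT_union {H1 H2 : Set ((ι → ℝ) × ℝ)} (m : ℕ) : BT (H1 ∪ H2) m = BT H1 m ∩ BT H2 m := by
  ext p
  simp only [BT, DH, Set.mem_setOf_eq, Set.mem_union, Set.mem_inter_iff]
  constructor
  · intro h; exact ⟨fun x hx => h x (Or.inl hx), fun x hx => h x (Or.inr hx)⟩
  · rintro ⟨h1, h2⟩ x (hx | hx)
    · exact h1 x hx
    · exact h2 x hx

section Weight

variable {Γ : Type*} [AddCommMonoid Γ] [LinearOrder Γ] [IsOrderedCancelAddMonoid Γ]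

/-- exponents of weight at least `t` -/
def BV (wt : (ι → ℕ) →+ Γ) (κ t : Γ) : Set ((ι → ℕ) × ℕ) := {p | t ≤ wt p.1 + p.2 • κ}
/-- exponents of weight bigger than `t` -/
def BW (wt : (ι → ℕ) →+ Γ) (κ t : Γ) : Set ((ι → ℕ) × ℕ) := {p | t < wt p.1 + p.2 • κ}

theorem BV_mul (y : A) (w : ι → A) (wt : (ι → ℕ) →+ Γ) (κ s t : Γ) :
    mI y w (BV wt κ s) * mI y w (BV wt κ t) ≤ mI y w (BV wt κ (s + t)) := by
  apply mI_mul
  intro p hp q hq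
  simp only [BV, Set.mem_setOf_eq, Prod.fst_add, Prod.snd_add, map_add, add_smul] at *
  calc s + t ≤ (wt p.1 + p.2 • κ) + (wt q.1 + q.2 • κ) := add_le_add hp hq
    _ = _ := by abel

theorem BVW_mul (y : A) (w : ι → A) (wt : (ι → ℕ) →+ Γ) (κ s t : Γ) :
    mI y w (BV wt κ s) * mI y w (BW wt κ t) ≤ mI y w (BW wt κ (s + t)) := by
  apply mI_mul
  intro p hp q hq
  simp only [BV, BW, Set.mem_setOf_eq, Prod.fst_add, Prod.snd_add, map_add, add_smul] at *
  calc s + t < (wt p.1 + p.2 • κ) + (wt q.1 + q.2 • κ) := add_lt_add_of_le_of_lt hp hq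
    _ = _ := by abel

theorem BV_pow (y : A) (w : ι → A) (wt : (ι → ℕ) →+ Γ) (κ t : Γ) {x : A}
    (hx : x ∈ mI y w (BV wt κ t)) (n : ℕ) : x ^ n ∈ mI y w (BV wt κ (n • t)) := by
  induction n with
  | zero =>
    rw [pow_zero, ← um_zero w]
    exact um_mem_mI (by simp [BV])
  | succ n ih =>
    rw [pow_succ, succ_nsmul]
    exact BV_mul y w wt κ _ _ (Ideal.mul_mem_mul ih hx)

/-- Lemma X (initial forms) -/
theorem lemX (wt : (ι → ℕ) →+ Γ) (hwt : ∀ e, e ≠ 0 → 0 < wt e) (κ : Γ) (hκ : 0 ≤ κ)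
    (y x z : A) (w : ι → A) (hx : x ∈ mI y w (BV wt κ κ)) (hzx : z - x ∈ mI y w (BW wt κ κ))
    (m : ℕ) (f : A) (B : Set ((ι → ℕ) × ℕ)) (hf : f ∈ mI z w B)
    (hB : ∀ p ∈ B, p.2 < m → (m - p.2) • κ < wt p.1) :
    ∃ c, f - c * z ^ m ∈ Ideal.span (Set.range w) ∧ f - c * x ^ m ∈ mI y w (BW wt κ (m • κ)) := by
  have hWV : mI y w (BW wt κ κ) ≤ mI y w (BV wt κ κ) := mI_mono fun p hp => le_of_lt hp
  have hz : z ∈ mI y w (BV wt κ κ) := by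
    have := add_mem hx (hWV hzx)
    simpa using this
  have h1 : mI z w B ≤ Ideal.span {z ^ m} ⊔ mI z w (B ∩ {p | p.1 ≠ 0}) := by
    rw [mI_le]
    intro p hp
    by_cases h0 : p.1 = 0
    · apply Ideal.mem_sup_left
      have hm : m ≤ p.2 := by
        by_contra hlt
        have := hB p hp (by omega)
        rw [h0, map_zero] at this
        exact absurd this (not_lt.2 (nsmul_nonneg hκ _))
      rw [mo_eq, h0, um_zero, mul_one, Ideal.mem_span_singleton]
      exact pow_dvd_pow _ hm
    · exact Ideal.mem_sup_right (mo_mem ⟨hp, h0⟩)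
  obtain ⟨a, ha, r, hr, har⟩ := Submodule.mem_sup.1 (h1 hf)
  obtain ⟨c, rfl⟩ := Ideal.mem_span_singleton'.1 ha
  refine ⟨c, ?_, ?_⟩
  · have : f - c * z ^ m = r := by rw [← har]; ring
    rw [this]
    refine (mI_le.2 ?_) hr
    intro p hp
    rw [mo_eq]
    exact Ideal.mul_mem_left _ _ (um_mem w p.1 hp.2)
  · have hr' : r ∈ mI y w (BW wt κ (m • κ)) := by
      refine (mI_le.2 ?_) hr
      rintro p ⟨hpB, hp0⟩
      have h2 := BV_pow y w wt κ κ hz p.2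
      rcases lt_or_ge p.2 m with hlt | hge
      · have h3 : um w p.1 ∈ mI y w (BW wt κ ((m - p.2) • κ)) :=
          um_mem_mI (by simpa [BW] using hB p hpB hlt)
        have h4 := BVW_mul y w wt κ _ _ (Ideal.mul_mem_mul h2 h3)
        rw [← add_smul] at h4
        rw [mo_eq]
        convert h4 using 4
        omega
      · have h3 : um w p.1 ∈ mI y w (BW wt κ 0) :=
          um_mem_mI (by simpa [BW] using hwt p.1 hp0)
        have h4 := BVW_mul y w wt κ _ _ (Ideal.mul_mem_mul h2 h3)
        rw [mo_eq]
        refine (mI_mono ?_) h4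
        intro q hq
        simp only [BW, Set.mem_setOf_eq, add_zero] at hq ⊢
        exact lt_of_le_of_lt (nsmul_le_nsmul_left hκ hge) hq
    have hd : z ^ m - x ^ m ∈ mI y w (BW wt κ (m • κ)) := by
      rcases Nat.eq_zero_or_pos m with rfl | hm
      · simp
      · rw [← Commute.geom_sum₂_mul (Commute.all z x)]
        have h5 : ∑ i ∈ Finset.range m, z ^ i * x ^ (m - 1 - i) ∈ mI y w (BV wt κ ((m-1) • κ)) := by
          refine Ideal.sum_mem _ fun i hi => ?_
          have := BV_mul y w wt κ _ _ (Ideal.mul_mem_mul (BV_pow y w wt κ κ hz i) (BV_pow y w wt κ κ hx (m-1-i)))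
          rw [← add_smul] at this
          have hi' := Finset.mem_range.1 hi
          convert this using 4
          omega
        have h6 := BVW_mul y w wt κ _ _ (Ideal.mul_mem_mul h5 hzx)
        rw [← succ_nsmul] at h6
        convert h6 using 4
        omega
    have : f - c * x ^ m = r + c * (z ^ m - x ^ m) := by rw [← har]; ring
    rw [this]
    exact add_mem hr' (Ideal.mul_mem_left _ _ hd)

end Weight

/-- the lexicographic weight -/
def wlex [LinearOrder ι] (L : ι → ℝ) : (ι → ℕ) →+ Lex (ℝ × Lex (ι → ℕ)) where
  toFun e := toLex (lin L e, toLex e)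
  map_zero' := by simp [lin_zero]
  map_add' e e' := by rw [lin_add]; rfl

theorem wlex_inj [LinearOrder ι] (L : ι → ℝ) : Function.Injective (wlex L) := by
  intro a b h
  have h2 : (lin L a, toLex a) = (lin L b, toLex b) := toLex.injective h
  exact toLex.injective (Prod.mk.inj h2).2

theorem wlex_lt [LinearOrder ι] {L : ι → ℝ} {e e' : ι → ℕ} (h : lin L e < lin L e') : wlex L e < wlex L e' :=
  (Prod.Lex.toLex_lt_toLex).2 (Or.inl h)

theorem wlex_le [LinearOrder ι] {L : ι → ℝ} {e e' : ι → ℕ} (h : wlex L e ≤ wlex L e') : lin L e ≤ lin L e' := by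
  by_contra hc
  push Not at hc
  exact absurd (wlex_lt hc) (not_lt.2 h)

theorem wlex_mono [LinearOrder ι] {L : ι → ℝ} (hL : ∀ i, 0 ≤ L i) {e e' : ι → ℕ} (h : e ≤ e') :
    wlex L e ≤ wlex L e' := by
  rcases (lin_mono hL h).lt_or_eq with h1 | h1
  · exact (wlex_lt h1).le
  · refine (Prod.Lex.toLex_le_toLex).2 (Or.inr ⟨h1, ?_⟩)
    exact Pi.toLex_monotone h

theorem wlex_pos [LinearOrder ι] {L : ι → ℝ} (hL : ∀ i, 0 ≤ L i) (e : ι → ℕ) (he : e ≠ 0) :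
    0 < wlex L e := by
  have h := wlex_mono hL (show (0 : ι → ℕ) ≤ e from fun i => Nat.zero_le _)
  rw [map_zero] at h
  refine lt_of_le_of_ne h fun h0 => he ?_
  apply wlex_inj L
  rw [map_zero, h0]

end HSys

section Glue

variable {A : Type u} [CommRing A] [IsLocalRing A] {ι : Type v} [Fintype ι]

/-- parameter completing `w` -/
def Par (w : ι → A) (z : A) : Prop := Ideal.span (insert z (Set.range w)) = maximalIdeal A

theorem Par.mem {w : ι → A} {z : A} (h : Par w z) : z ∈ maximalIdeal A := by
  rw [← h]; exact Ideal.subset_span (Or.inl rfl)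

theorem Par.memw {w : ι → A} {z : A} (h : Par w z) (i : ι) : w i ∈ maximalIdeal A := by
  rw [← h]; exact Ideal.subset_span (Or.inr ⟨i, rfl⟩)

theorem Par.span_le {w : ι → A} {z : A} (h : Par w z) : Ideal.span (Set.range w) ≤ maximalIdeal A := by
  rw [← h]; exact Ideal.span_mono (Set.subset_insert _ _)

theorem Par.ne_top {w : ι → A} {z : A} (h : Par w z) : Ideal.span (insert z (Set.range w)) ≠ ⊤ := by
  rw [h]; exact (IsLocalRing.maximalIdeal.isMaximal A).ne_top

theorem Par.reg [IsNoetherianRing A] {w : ι → A} {z : A} (h : Par w z)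
    (hd : ((Fintype.card ι + 1 : ℕ) : WithBot ℕ∞) ≤ ringKrullDim A) : PermReg (oo z w) := by
  apply permReg_of_dim
  · rw [range_oo]; exact h
  · rwa [Fintype.card_option]

theorem Par.notMem [IsNoetherianRing A] {w : ι → A} {z : A} (h : Par w z)
    (hd : ((Fintype.card ι + 1 : ℕ) : WithBot ℕ∞) ≤ ringKrullDim A) : z ∉ Ideal.span (Set.range w) := by
  classical
  have := notMem_span (oo z w) (by rw [range_oo]; exact h) (by rwa [Fintype.card_option])
    (Finset.univ.image some) none (by simp)
  intro hz
  apply this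
  refine Ideal.span_mono ?_ hz
  rintro _ ⟨i, rfl⟩
  exact ⟨some i, by simp, rfl⟩

theorem Par.change {w : ι → A} {z z' v : A} (h : Par w z) (hv : IsUnit v)
    (hz : z' - v * z ∈ Ideal.span (Set.range w)) : Par w z' := by
  unfold Par at *
  rw [← h]
  have hle : ∀ z, Ideal.span (Set.range w) ≤ Ideal.span (insert z (Set.range w)) :=
    fun z => Ideal.span_mono (Set.subset_insert _ _)
  apply le_antisymm
  · rw [Ideal.span_le]
    rintro x (rfl | hx)
    · have : x = (x - v * z) + v * z := by ring
      rw [this]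
      exact add_mem (hle _ hz) (Ideal.mul_mem_left _ _ (Ideal.subset_span (Or.inl rfl)))
    · exact hle _ (Ideal.subset_span hx)
  · rw [Ideal.span_le]
    rintro x (rfl | hx)
    · obtain ⟨v, rfl⟩ := hv
      have : x = ↑v⁻¹ * (z' - (z' - v * x)) := by
        have := v.inv_mul
        linear_combination (-x) * this
      rw [this]
      exact Ideal.mul_mem_left _ _ (sub_mem (Ideal.subset_span (Or.inl rfl)) (hle _ hz))
    · exact hle _ (Ideal.subset_span hx)

theorem sum_um_mem {w : ι → A} {G : Finset (ι → ℕ)} {C : (ι → ℕ) → A} (h0 : 0 ∉ G) :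
    ∑ a ∈ G, C a * um w a ∈ Ideal.span (Set.range w) :=
  Ideal.sum_mem _ fun a ha => Ideal.mul_mem_left _ _ (um_mem w a fun h => h0 (h ▸ ha))

variable [IsNoetherianRing A]

theorem Par.unit_of_eq {w : ι → A} {z1 z2 : A} (h1 : Par w z1) (h2 : Par w z2)
    (hd : ((Fintype.card ι + 1 : ℕ) : WithBot ℕ∞) ≤ ringKrullDim A) {g : A}
    (h : z1 - g * z2 ∈ Ideal.span (Set.range w)) : IsUnit g := by
  by_contra hg
  have hgM : g ∈ maximalIdeal A := (IsLocalRing.mem_maximalIdeal _).2 hg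
  have hle : maximalIdeal A ≤ Ideal.span (Set.range w) ⊔ maximalIdeal A • maximalIdeal A := by
    conv_lhs => rw [← h1]
    rw [Ideal.span_le]
    rintro x (rfl | hx)
    · have : x = (x - g * z2) + g * z2 := by ring
      rw [this]
      exact add_mem (Ideal.mem_sup_left h) (Ideal.mem_sup_right (Ideal.mul_mem_mul hgM h2.mem))
    · exact Ideal.mem_sup_left (Ideal.subset_span hx)
  have := Submodule.le_of_le_smul_of_le_jacobson_bot (IsNoetherian.noetherian (maximalIdeal A))
    (IsLocalRing.maximalIdeal_le_jacobson ⊥) hle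
  exact h2.notMem hd (this h2.mem)

theorem Par.decomp {w : ι → A} {z1 z2 : A} (h1 : Par w z1) (h2 : Par w z2)
    (hd : ((Fintype.card ι + 1 : ℕ) : WithBot ℕ∞) ≤ ringKrullDim A) :
    ∃ (g : A) (G : Finset (ι → ℕ)) (C : (ι → ℕ) → A), IsUnit g ∧ (∀ a ∈ G, IsUnit (C a)) ∧ 0 ∉ G ∧
      z1 = g * z2 + ∑ a ∈ G, C a * um w a := by
  classical
  obtain ⟨c, hc, hev⟩ := exists_unit_expansion (h2.reg hd) h2 z1
  set g := ∑ p ∈ c.support.filter (fun p => ¬ p.2 = 0), c p * (z2 ^ (p.2 - 1) * um w p.1) with hg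
  set G := (c.support.filter (fun p => p.2 = 0)).image Prod.fst with hG
  have hGm : ∀ a, a ∈ G ↔ (a, 0) ∈ c.support := by
    intro a
    simp only [hG, Finset.mem_image, Finset.mem_filter]
    constructor
    · rintro ⟨⟨a', b⟩, ⟨h, h'⟩, rfl⟩
      simp only at h'
      rw [← h']; exact h
    · intro h; exact ⟨(a, 0), ⟨h, rfl⟩, rfl⟩
  have hsum : z1 = g * z2 + ∑ a ∈ G, c (a, 0) * um w a := by
    rw [← hev]
    unfold ev Finsupp.sum
    rw [← Finset.sum_filter_add_sum_filter_not c.support (fun p => p.2 = 0), add_comm]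
    congr 1
    · rw [hg, Finset.sum_mul]
      refine Finset.sum_congr rfl fun p hp => ?_
      have hp2 := (Finset.mem_filter.1 hp).2
      obtain ⟨k, hk⟩ := Nat.exists_eq_succ_of_ne_zero hp2
      show c p * mo z2 w p = _
      rw [mo_eq, hk]
      simp only [Nat.succ_eq_add_one, Nat.add_sub_cancel, pow_succ]
      ring
    · rw [hG, Finset.sum_image]
      · refine Finset.sum_congr rfl fun p hp => ?_
        have hp2 := (Finset.mem_filter.1 hp).2
        have : p = (p.1, 0) := Prod.ext rfl hp2
        conv_lhs => rw [this]
        show c (p.1, 0) * mo z2 w (p.1, 0) = _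
        rw [mo_zero_right]
      · intro p hp q hq hpq
        exact Prod.ext hpq ((Finset.mem_filter.1 hp).2.trans (Finset.mem_filter.1 hq).2.symm)
  have h0 : 0 ∉ G := by
    intro h0
    have hu := hc _ ((hGm 0).1 h0)
    rw [← Finset.add_sum_erase _ _ h0, um_zero, mul_one] at hsum
    have h3 : ∑ a ∈ G.erase 0, c (a, 0) * um w a ∈ maximalIdeal A :=
      h2.span_le (sum_um_mem (C := fun a => c (a, 0)) (Finset.notMem_erase _ _))
    have : c (0, 0) ∈ maximalIdeal A := by
      have h4 : c (0, 0) = z1 - g * z2 - ∑ a ∈ G.erase 0, c (a, 0) * um w a := by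
        rw [hsum]; ring
      rw [h4]
      exact sub_mem (sub_mem h1.mem (Ideal.mul_mem_left _ _ h2.mem)) h3
    exact ((IsLocalRing.mem_maximalIdeal _).1 this) hu
  refine ⟨g, G, fun a => c (a, 0), ?_, fun a ha => hc _ ((hGm a).1 ha), h0, hsum⟩
  apply h1.unit_of_eq h2 hd
  have : z1 - g * z2 = ∑ a ∈ G, c (a, 0) * um w a := by
    conv_lhs => rw [hsum]
    ring
  rw [this]
  exact sum_um_mem (C := fun a => c (a, 0)) h0

theorem unit_of_not_mem {w : ι → A} {z f c : A} {m : ℕ} (hz : z ∈ maximalIdeal A)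
    (hfn : f ∉ maximalIdeal A ^ (m+1) ⊔ Ideal.span (Set.range w))
    (hc : f - c * z ^ m ∈ Ideal.span (Set.range w)) : IsUnit c := by
  by_contra hu
  apply hfn
  have : f = c * z ^ m + (f - c * z ^ m) := by ring
  rw [this]
  refine add_mem (Ideal.mem_sup_left ?_) (Ideal.mem_sup_right hc)
  rw [pow_succ']
  exact Ideal.mul_mem_mul ((IsLocalRing.mem_maximalIdeal _).2 hu) (Ideal.pow_mem_pow hz _)

theorem sum_mem_JJ {H : Set ((ι → ℝ) × ℝ)} {w : ι → A} {G : Finset (ι → ℕ)} {C : (ι → ℕ) → A}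
    (h : ∀ a ∈ G, a ∈ DH H 1) : ∑ a ∈ G, C a * um w a ∈ JJ H w :=
  Ideal.sum_mem _ fun a ha => Ideal.mul_mem_left _ _ (um_mem_JJ (h a ha))

theorem compare [LinearOrder ι] {w : ι → A}
    (hd : ((Fintype.card ι + 1 : ℕ) : WithBot ℕ∞) ≤ ringKrullDim A)
    {H1 H2 : Set ((ι → ℝ) × ℝ)} (hH1 : HNN H1) (hH2 : HNN H2) {m : ℕ} (hm : 1 ≤ m)
    {z1 z2 : A} (h1 : Par w z1) (h2 : Par w z2) {f : A}
    (hf1 : f ∈ TT H1 m z1 w) (hf2 : f ∈ TT H2 m z2 w)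
    (hfn : f ∉ maximalIdeal A ^ (m+1) ⊔ Ideal.span (Set.range w))
    {g : A} (hg : IsUnit g) {G : Finset (ι → ℕ)} {C : (ι → ℕ) → A} (hC : ∀ a ∈ G, IsUnit (C a))
    (h0 : 0 ∉ G) (hz : z1 = g * z2 + ∑ a ∈ G, C a * um w a) :
    ∀ a ∈ G, a ∈ DH H1 1 ∨ a ∈ DH H2 1 := by
  classical
  by_contra hcon
  push Not at hcon
  obtain ⟨a0, ha0G, ha01, ha02⟩ := hcon
  set G1 := G.filter (fun a => a ∈ DH H1 1) with hG1
  set G2 := (G.filter (fun a => ¬ a ∈ DH H1 1)).filter (fun a => a ∈ DH H2 1) with hG2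
  set G3 := (G.filter (fun a => ¬ a ∈ DH H1 1)).filter (fun a => ¬ a ∈ DH H2 1) with hG3
  have hsplit : ∑ a ∈ G, C a * um w a = ∑ a ∈ G1, C a * um w a +
      (∑ a ∈ G2, C a * um w a + ∑ a ∈ G3, C a * um w a) := by
    rw [hG2, hG3, Finset.sum_filter_add_sum_filter_not, hG1, Finset.sum_filter_add_sum_filter_not]
  set s1 := ∑ a ∈ G1, C a * um w a with hs1
  set s2 := ∑ a ∈ G2, C a * um w a with hs2
  have hs1J : s1 ∈ JJ H1 w := sum_mem_JJ fun a ha => (Finset.mem_filter.1 ha).2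
  have hs2J : s2 ∈ JJ H2 w := sum_mem_JJ fun a ha => (Finset.mem_filter.1 ha).2
  have hs1w : s1 ∈ Ideal.span (Set.range w) := sum_um_mem fun h => h0 (Finset.mem_filter.1 h).1
  have hs2w : s2 ∈ Ideal.span (Set.range w) :=
    sum_um_mem fun h => h0 (Finset.mem_filter.1 (Finset.mem_filter.1 h).1).1
  set z := z1 - s1 with hzd
  set y := g * z2 + s2 with hyd
  have hzp : Par w z := h1.change (v := 1) isUnit_one (by
    rw [hzd]; have : z1 - s1 - 1 * z1 = - s1 := by ring
    rw [this]; exact neg_mem hs1w)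
  have hyp : Par w y := h2.change hg (by
    rw [hyd]; have : g * z2 + s2 - g * z2 = s2 := by ring
    rw [this]; exact hs2w)
  have hfz : f ∈ TT H1 m z w := by
    refine TT_le hH1 m ?_ hf1
    have : z1 = z + s1 := by rw [hzd]; ring
    rw [this]
    exact add_mem (Ideal.mem_sup_left (Ideal.mem_span_singleton_self z)) (Ideal.mem_sup_right hs1J)
  have hfy : f ∈ TT H2 m y w := by
    refine TT_le hH2 m ?_ hf2
    obtain ⟨g, rfl⟩ := hg
    have : z2 = ↑g⁻¹ * y - ↑g⁻¹ * s2 := by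
      rw [hyd]; have := g.inv_mul; linear_combination (-z2) * this
    rw [this]
    exact sub_mem (Ideal.mem_sup_left (Ideal.mul_mem_left _ _ (Ideal.mem_span_singleton_self y)))
      (Ideal.mem_sup_right (Ideal.mul_mem_left _ _ hs2J))
  have hzy : z = y + ∑ a ∈ G3, C a * um w a := by
    rw [hzd, hz, hsplit, hyd]; ring
  have ha0 : a0 ∈ G3 := by simp [hG3, ha0G, ha01, ha02]
  obtain ⟨h, hh, hlt⟩ : ∃ h ∈ H1, lin h.1 a0 < h.2 := by
    by_contra hc; push Not at hc
    exact ha01 fun h hh => by simpa using hc h hh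
  set wt := wlex h.1 with hwt
  obtain ⟨α, hα, hmin⟩ := Finset.exists_min_image G3 wt ⟨a0, ha0⟩
  set κ := wt α with hκ
  have hLn := hH1 h hh
  have hlα : lin h.1 α ≤ lin h.1 a0 := wlex_le (hmin a0 ha0)
  have hαG := (Finset.mem_filter.1 (Finset.mem_filter.1 hα).1)
  have hα2 := (Finset.mem_filter.1 hα).2
  have hα0 : α ≠ 0 := fun h => h0 (h ▸ hαG.1)
  set x := y + C α * um w α with hx
  obtain ⟨c, hc1, hc2⟩ := lemX wt (wlex_pos hLn) κ (wlex_pos hLn α hα0).le y x z w (by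
      rw [hx]
      refine add_mem ?_ (Ideal.mul_mem_left _ _ (um_mem_mI ?_))
      · have := mo_mem (y := y) (w := w) (B := BV wt κ κ) (p := (0,1)) (by simp [BV])
        rwa [mo_zero_left, pow_one] at this
      · simp [BV, hκ]) (by
      have : z - x = ∑ a ∈ G3.erase α, C a * um w a := by
        rw [hzy, hx, ← Finset.add_sum_erase _ _ hα]; ring
      rw [this]
      refine Ideal.sum_mem _ fun a ha => Ideal.mul_mem_left _ _ (um_mem_mI ?_)
      have ha' := Finset.mem_erase.1 ha
      simp only [BW, Set.mem_setOf_eq, zero_smul, add_zero]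
      exact lt_of_le_of_ne (hmin a ha'.2) fun he => ha'.1 (wlex_inj _ he).symm)
    m f (BT H1 m) hfz (by
      intro p hp hpm
      have h3 := hp h hh
      rw [hκ, ← map_nsmul]
      apply wlex_lt
      rw [lin_nsmul]
      have h4 : (0 : ℝ) < ((m - p.2 : ℕ) : ℝ) := by
        have : 0 < m - p.2 := by omega
        exact_mod_cast this
      refine lt_of_lt_of_le ?_ h3
      exact mul_lt_mul_of_pos_left (lt_of_le_of_lt hlα hlt) h4)
  have hcu := unit_of_not_mem hzp.mem hfn hc1
  have hfin : c * C α ^ m ∈ Ideal.span (insert y (Set.range w)) := by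
    refine mcoef (hyp.reg hd) (B := {p | ¬ p ≤ (m • α, 0)}) (p := (m • α, 0)) (fun β hβ => hβ) ?_
    have hy : y ∈ mI y w {p | ¬ p ≤ (m • α, 0)} := by
      have := mo_mem (y := y) (w := w) (B := {p | ¬ p ≤ (m • α, 0)}) (p := (0,1)) (by
        intro h; have := h.2; simp at this)
      rwa [mo_zero_left, pow_one] at this
    have e1 : c * C α ^ m * mo y w (m • α, 0) = f - (f - c * x ^ m) - c * (x ^ m - (C α * um w α) ^ m) := by
      rw [mo_zero_right, um_nsmul, mul_pow]; ring
    rw [e1]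
    refine sub_mem (sub_mem ?_ ?_) (Ideal.mul_mem_left _ _ ?_)
    · refine (mI_mono ?_) hfy
      intro p hp hle
      have hp2 : p.2 = 0 := by have := hle.2; simpa using this
      simp only [BT, Set.mem_setOf_eq, hp2, Nat.sub_zero] at hp
      exact hα2 (DH_nsmul hm (DH_up hH2 hp hle.1))
    · refine (mI_mono ?_) hc2
      intro p hp hle
      have hp2 : p.2 = 0 := by have := hle.2; simpa using this
      simp only [BW, Set.mem_setOf_eq, hp2, zero_smul, add_zero] at hp
      rw [hκ, ← map_nsmul] at hp
      exact absurd (wlex_mono hLn hle.1) (not_le.2 hp)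
    · have hdvd := sub_dvd_pow_sub_pow x (C α * um w α) m
      have : x - C α * um w α = y := by rw [hx]; ring
      rw [this] at hdvd
      exact Ideal.mem_of_dvd _ hdvd hy
  exact hyp.ne_top (Ideal.eq_top_of_isUnit_mem _ hfin (hcu.mul ((hC α hαG.1).pow m)))

theorem mem_TT_union {w : ι → A} (hd : ((Fintype.card ι + 1 : ℕ) : WithBot ℕ∞) ≤ ringKrullDim A)
    {H1 H2 : Set ((ι → ℝ) × ℝ)} (hH1 : HNN H1) (hH2 : HNN H2) {m : ℕ}
    {z : A} (hz : Par w z) {f : A}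
    (hf1 : f ∈ TT H1 m z w) (hf2 : f ∈ TT H2 m z w) : f ∈ TT (H1 ∪ H2) m z w := by
  obtain ⟨c, hc, rfl⟩ := exists_unit_expansion (hz.reg hd) hz f
  have e1 := supp_subset (hz.reg hd) hz.ne_top hc (BT_up hH1 m) hf1
  have e2 := supp_subset (hz.reg hd) hz.ne_top hc (BT_up hH2 m) hf2
  exact mem_mI.2 ⟨c, by rw [TT_union]; exact Set.subset_inter e1 e2, rfl⟩

theorem HNN.union {H1 H2 : Set ((ι → ℝ) × ℝ)} (hH1 : HNN H1) (hH2 : HNN H2) : HNN (H1 ∪ H2) := by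
  rintro h (hh | hh)
  · exact hH1 h hh
  · exact hH2 h hh

theorem glue [LinearOrder ι] {w : ι → A}
    (hd : ((Fintype.card ι + 1 : ℕ) : WithBot ℕ∞) ≤ ringKrullDim A)
    {H1 H2 : Set ((ι → ℝ) × ℝ)} (hH1 : HNN H1) (hH2 : HNN H2) {m : ℕ} (hm : 1 ≤ m)
    {z1 z2 : A} (h1 : Par w z1) (h2 : Par w z2) {f : A}
    (hf1 : f ∈ TT H1 m z1 w) (hf2 : f ∈ TT H2 m z2 w)
    (hfn : f ∉ maximalIdeal A ^ (m+1) ⊔ Ideal.span (Set.range w)) :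
    ∃ z, Par w z ∧ f ∈ TT (H1 ∪ H2) m z w := by
  classical
  obtain ⟨g, G, C, hg, hC, h0, hz⟩ := h1.decomp h2 hd
  have hcomp := compare hd hH1 hH2 hm h1 h2 hf1 hf2 hfn hg hC h0 hz
  set G1 := G.filter (fun a => a ∈ DH H1 1) with hG1
  set G2 := G.filter (fun a => ¬ a ∈ DH H1 1) with hG2
  have hsplit : ∑ a ∈ G, C a * um w a = ∑ a ∈ G1, C a * um w a + ∑ a ∈ G2, C a * um w a := by
    rw [hG2, hG1, Finset.sum_filter_add_sum_filter_not]
  set s1 := ∑ a ∈ G1, C a * um w a with hs1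
  set s2 := ∑ a ∈ G2, C a * um w a with hs2
  have hs1J : s1 ∈ JJ H1 w := sum_mem_JJ fun a ha => (Finset.mem_filter.1 ha).2
  have hs2J : s2 ∈ JJ H2 w := sum_mem_JJ fun a ha => by
    have := Finset.mem_filter.1 ha
    exact (hcomp a this.1).resolve_left this.2
  have hs1w : s1 ∈ Ideal.span (Set.range w) := sum_um_mem fun h => h0 (Finset.mem_filter.1 h).1
  have hzp : Par w (z1 - s1) := h1.change (v := 1) isUnit_one (by
    have : z1 - s1 - 1 * z1 = - s1 := by ring
    rw [this]; exact neg_mem hs1w)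
  refine ⟨z1 - s1, hzp, mem_TT_union hd hH1 hH2 hzp ?_ ?_⟩
  · refine TT_le hH1 m ?_ hf1
    have : z1 = (z1 - s1) + s1 := by ring
    have h5 := add_mem (Ideal.mem_sup_left (Ideal.mem_span_singleton_self (z1 - s1)))
      (Ideal.mem_sup_right (S := Ideal.span {z1 - s1}) hs1J)
    rwa [← this] at h5
  · refine TT_le hH2 m ?_ hf2
    obtain ⟨g, rfl⟩ := hg
    have : z2 = ↑g⁻¹ * (z1 - s1) - ↑g⁻¹ * s2 := by
      rw [hz, hsplit]; have := g.inv_mul; linear_combination (-z2) * this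
    have h5 := sub_mem (Ideal.mem_sup_left (Ideal.mul_mem_left _ (↑g⁻¹) (Ideal.mem_span_singleton_self (z1 - s1))))
      (Ideal.mem_sup_right (S := Ideal.span {z1 - s1}) (Ideal.mul_mem_left _ (↑g⁻¹) hs2J))
    rwa [← this] at h5

end Glue

section compl
variable {A : Type u} [CommRing A] [IsLocalRing A] [IsNoetherianRing A]

theorem compl_noeth : IsNoetherianRing (Completion A) := by
  obtain ⟨s, hs⟩ := (maximalIdeal A).fg_of_isNoetherianRing
  let M := maximalIdeal A
  let w : s → A := fun i => i
  let φ : MvPolynomial s A →ₐ[A] A := MvPolynomial.aeval w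
  have hφ : (MvPolynomial.idealOfVars s A) ≤ M.comap φ := by
    rw [MvPolynomial.idealOfVars, Ideal.span_le]
    rintro _ ⟨i, rfl⟩
    simp only [SetLike.mem_coe, Ideal.mem_comap]
    have : φ (MvPolynomial.X i) = i := by simp [φ, w]
    rw [this]
    show (i : A) ∈ maximalIdeal A
    rw [← hs]; exact Ideal.subset_span i.2
  have hφn : ∀ n, (MvPolynomial.idealOfVars s A)^n ≤ (M^n).comap (φ : MvPolynomial s A →+* A) := by
    intro n
    refine le_trans (Ideal.pow_right_mono hφ n) ?_
    exact Ideal.le_comap_pow _ n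
  let g : (n : ℕ) → MvPowerSeries s A →+* A ⧸ M ^ n := fun n =>
    (Ideal.quotientMap (M^n) (φ : MvPolynomial s A →+* A) (hφn n)).comp
      (MvPowerSeries.truncTotalAlgHom s A n : MvPowerSeries s A →+* _)
  have hg : ∀ {m n : ℕ} (hle : m ≤ n), (Ideal.Quotient.factorPow M hle).comp (g n) = g m := by
    intro m n hle
    ext p
    simp only [g, RingHom.comp_apply]
    have h1 := MvPowerSeries.truncTotal_sub_truncTotal_mem_pow_idealOfVars hle le_rfl p
    simp only [RingHom.coe_coe, MvPowerSeries.truncTotalAlgHom_apply, Ideal.quotientMap_mk]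
    erw [Ideal.Quotient.factor_mk]
    rw [Ideal.Quotient.eq, ← map_sub]
    exact hφn m h1
  let G := AdicCompletion.liftRingHom M g hg
  have hGp : ∀ p : MvPolynomial s A, G (p : MvPowerSeries s A) = algebraMap A _ (φ p) := by
    intro p
    apply AdicCompletion.ext_evalₐ
    intro n
    rw [AdicCompletion.evalₐ_liftRingHom]
    have h1 : (MvPowerSeries.truncTotalAlgHom s A n) (p : MvPowerSeries s A) =
      Ideal.Quotient.mk _ p := (MvPowerSeries.truncTotalAlgHom s A n).commutes p
    simp only [g, RingHom.comp_apply, RingHom.coe_coe, h1, Ideal.quotientMap_mk]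
    rw [AlgHomClass.commutes]
    rfl
  let I : Ideal (MvPowerSeries s A) := .span (.range MvPowerSeries.X)
  have hI : I.map G = maximalIdeal (Completion A) := by
    have hs2 : (maximalIdeal A).map (algebraMap A (Completion A)) =
        Ideal.span ((algebraMap A (Completion A)) '' (s : Set A)) := by
      rw [← Ideal.map_span]; exact congrArg _ hs.symm
    rw [AdicCompletion.maximalIdeal_eq_map, hs2, Ideal.map_span]
    congr 1
    ext x
    constructor
    · rintro ⟨_, ⟨i, rfl⟩, rfl⟩
      refine ⟨i, i.2, ?_⟩
      rw [← MvPolynomial.coe_X, hGp]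
      simp [φ, w]
      rfl
    · rintro ⟨a, ha, rfl⟩
      refine ⟨_, ⟨⟨a, ha⟩, rfl⟩, ?_⟩
      rw [← MvPolynomial.coe_X, hGp]
      simp [φ, w]
      rfl
  have hh : IsHausdorff (I.map G) (Completion A) := by
    rw [hI]; infer_instance
  have hsurj : Function.Surjective G := by
    apply surjective_of_mk_map_comp_surjective (I := I)
    intro x
    obtain ⟨x, rfl⟩ := Ideal.Quotient.mk_surjective x
    obtain ⟨r, hr⟩ := (AdicCompletion.residueField_map_bijective A).2 (residue _ x)
    obtain ⟨r, rfl⟩ := residue_surjective r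
    refine ⟨((MvPolynomial.C r : MvPolynomial s A) : MvPowerSeries s A), ?_⟩
    rw [RingHom.comp_apply, Ideal.Quotient.eq, hI, hGp]
    rw [IsLocalRing.ResidueField.map_residue] at hr
    have := Ideal.Quotient.eq.1 hr
    have e : φ (MvPolynomial.C r) = r := by simp [φ]
    rw [e]; exact this
  exact isNoetherianRing_of_surjective _ _ G hsurj

instance : IsNoetherianRing (Completion A) := compl_noeth

theorem compl_flat : Module.FaithfullyFlat A (Completion A) :=
  Module.FaithfullyFlat.of_flat_of_isLocalHom

theorem compl_dim : ringKrullDim A ≤ ringKrullDim (Completion A) := by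
  rw [← IsLocalRing.maximalIdeal_height_eq_ringKrullDim, ← IsLocalRing.maximalIdeal_height_eq_ringKrullDim]
  haveI : (maximalIdeal (Completion A)).LiesOver (maximalIdeal A) :=
    ⟨(IsLocalRing.maximalIdeal_comap (algebraMap A (Completion A))).symm⟩
  rw [Ideal.height_eq_height_add_of_liesOver_of_hasGoingDown (maximalIdeal A) (maximalIdeal (Completion A))]
  exact_mod_cast le_self_add

/-- if `I B ∩ A = I`. -/
theorem ff_mem {A B : Type u} [CommRing A] [CommRing B] [Algebra A B] [Module.FaithfullyFlat A B] (I : Ideal A) (x : A)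
    (h : algebraMap A B x ∈ I.map (algebraMap A B)) : x ∈ I := by
  rw [← Ideal.comap_map_eq_self_of_faithfullyFlat (B := B) I]; exact h

theorem ordRes_spec {d : ℕ} (u : Fin d → A) (f : A) (hf : f ∈ maximalIdeal A)
    (hfu : f ∉ Ideal.span (Set.range u)) : 1 ≤ ordRes f u ∧ f ∈ maximalIdeal A ^ ordRes f u ⊔ Ideal.span (Set.range u)
      ∧ f ∉ maximalIdeal A ^ (ordRes f u + 1) ⊔ Ideal.span (Set.range u) := by
  have h1 : ∃ n, f ∉ maximalIdeal A ^ n ⊔ Ideal.span (Set.range u) := by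
    by_contra h
    push Not at h
    exact hfu (krull_mem _ _ fun n => by rw [sup_comm]; exact h n)
  obtain ⟨N, hN⟩ := h1
  have hbd : BddAbove {n : ℕ | f ∈ (maximalIdeal A) ^ n ⊔ Ideal.span (Set.range u)} := by
    refine ⟨N, fun n hn => ?_⟩
    by_contra hlt
    push Not at hlt
    have h3 : maximalIdeal A ^ n ⊔ Ideal.span (Set.range u) ≤ maximalIdeal A ^ N ⊔ Ideal.span (Set.range u) :=
      sup_le_sup_right (Ideal.pow_le_pow_right hlt.le) _
    exact hN (h3 hn)
  have hmem := Nat.sSup_mem (s := {n : ℕ | f ∈ (maximalIdeal A) ^ n ⊔ Ideal.span (Set.range u)})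
    ⟨0, by simp⟩ hbd
  refine ⟨le_csSup hbd ?_, hmem, fun h => ?_⟩
  · simpa using Ideal.mem_sup_left hf
  · have := le_csSup hbd h
    unfold ordRes at this
    omega
end compl

section cones

theorem fm_step {V : Type*} [AddCommGroup V] [Module ℝ V] (T : Finset V) (g : V →ₗ[ℝ] ℝ) :
    ∃ T' : Finset V, (∀ t ∈ T', (0 ≤ g t ∧ t ∈ Submodule.span NNReal (T : Set V))) ∧
      ∀ x ∈ Submodule.span NNReal (T : Set V), 0 ≤ g x → x ∈ Submodule.span NNReal (T' : Set V) := by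
  classical
  let T1 := T.filter fun t => 0 ≤ g t
  let T2 := T.filter fun t => ¬ 0 ≤ g t
  let T' := T1 ∪ (T1 ×ˢ T2).image fun p => g p.1 • p.2 - g p.2 • p.1
  have hT1 : ∀ t ∈ T1, t ∈ T ∧ 0 ≤ g t := fun t ht => by simpa [T1] using ht
  have hT2 : ∀ t ∈ T2, t ∈ T ∧ g t < 0 := fun t ht => by simpa [T2] using ht
  refine ⟨T', ?_, ?_⟩
  · intro t ht
    rcases Finset.mem_union.1 ht with h | h
    · exact ⟨(hT1 t h).2, Submodule.subset_span (hT1 t h).1⟩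
    · obtain ⟨⟨a, b⟩, hp, rfl⟩ := Finset.mem_image.1 h
      obtain ⟨ha, hb⟩ := Finset.mem_product.1 hp
      simp only at ha hb ⊢
      obtain ⟨ha, ha'⟩ := hT1 a ha
      obtain ⟨hb, hb'⟩ := hT2 b hb
      refine ⟨by simp; linarith [mul_comm (g a) (g b)], ?_⟩
      have e : g a • b - g b • a = (⟨g a, ha'⟩ : NNReal) • b + (⟨-g b, by linarith⟩ : NNReal) • a := by
        simp only [NNReal.smul_def, NNReal.coe_mk, neg_smul, sub_eq_add_neg]
        show g a • b + -(g b • a) = g a • b + (-g b) • a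
        rw [neg_smul]
      rw [e]
      exact add_mem (Submodule.smul_mem _ _ (Submodule.subset_span hb))
        (Submodule.smul_mem _ _ (Submodule.subset_span ha))
  · intro x hx hgx
    obtain ⟨c, -, hc⟩ := Submodule.mem_span_finset.1 hx
    have hsplit : x = ∑ t ∈ T1, c t • t + ∑ t ∈ T2, c t • t := by
      rw [← hc]; exact (Finset.sum_filter_add_sum_filter_not _ _ _).symm
    set P : ℝ := ∑ t ∈ T1, (c t : ℝ) * g t with hP
    set Q : ℝ := ∑ t ∈ T2, (c t : ℝ) * (- g t) with hQ
    have hgPQ : g x = P - Q := by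
      rw [hsplit, map_add, map_sum, map_sum, hP, hQ, sub_eq_add_neg, ← Finset.sum_neg_distrib]
      simp [NNReal.smul_def]
    have hQ0 : 0 ≤ Q := Finset.sum_nonneg fun t ht => mul_nonneg (c t).2 (by linarith [(hT2 t ht).2])
    have hmem1 : ∀ t ∈ T1, t ∈ Submodule.span NNReal (T' : Set V) := fun t ht =>
      Submodule.subset_span (Finset.mem_coe.2 (Finset.mem_union_left _ ht))
    have hmem2 : ∀ a ∈ T1, ∀ b ∈ T2, g a • b - g b • a ∈ Submodule.span NNReal (T' : Set V) := 
      fun a ha b hb => Submodule.subset_span (Finset.mem_coe.2 (Finset.mem_union_right _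
        (Finset.mem_image.2 ⟨(a, b), Finset.mem_product.2 ⟨ha, hb⟩, rfl⟩)))
    rcases hQ0.eq_or_lt with h0 | h0
    · have : ∀ t ∈ T2, c t = 0 := by
        intro t ht
        have := (Finset.sum_eq_zero_iff_of_nonneg (fun t ht => mul_nonneg (c t).2 (by linarith [(hT2 t ht).2]))).1 h0.symm t ht
        rcases mul_eq_zero.1 this with h | h
        · exact NNReal.coe_eq_zero.1 h
        · linarith [(hT2 t ht).2]
      rw [hsplit, Finset.sum_eq_zero (s := T2) fun t ht => by rw [this t ht, zero_smul], add_zero]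
      exact Submodule.sum_mem _ fun t ht => Submodule.smul_mem _ _ (hmem1 t ht)
    · have hPpos : 0 < P := by linarith
      have e : x = ∑ t ∈ T1, ((1 - Q / P) * c t) • t + ∑ a ∈ T1, ∑ b ∈ T2, (c a * c b / P : ℝ) • (g a • b - g b • a) := by
        have e2 : ∑ a ∈ T1, ∑ b ∈ T2, (c a * c b / P : ℝ) • (g a • b - g b • a)
            = ∑ b ∈ T2, (c b : ℝ) • b + ∑ a ∈ T1, (Q / P * c a) • a := by
          simp only [smul_sub, smul_smul, Finset.sum_sub_distrib]
          rw [sub_eq_add_neg]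
          congr 1
          · rw [Finset.sum_comm]
            refine Finset.sum_congr rfl fun b hb => ?_
            rw [← Finset.sum_smul]
            congr 1
            have : ∀ a, (c a * c b / P * g a : ℝ) = (c a * g a) * (c b / P) := fun a => by ring
            simp only [this]
            rw [← Finset.sum_mul, ← hP]; field_simp
          · rw [← Finset.sum_neg_distrib]
            refine Finset.sum_congr rfl fun a ha => ?_
            rw [← Finset.sum_smul, ← neg_smul]
            congr 1
            have : ∀ b, (c a * c b / P * g b : ℝ) = (c b * (- g b)) * (- (c a / P)) := fun b => by ring
            simp only [this]
            rw [← Finset.sum_mul, ← hQ]; ring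
        rw [e2, hsplit, add_comm (∑ b ∈ T2, _), ← add_assoc, ← Finset.sum_add_distrib]
        congr 1
        refine Finset.sum_congr rfl fun a ha => ?_
        rw [← add_smul, NNReal.smul_def]
        congr 1; ring
      rw [e]
      have hQP : 0 ≤ 1 - Q / P := by
        rw [sub_nonneg, div_le_one hPpos]; linarith
      refine add_mem (Submodule.sum_mem _ fun a ha => ?_) (Submodule.sum_mem _ fun a ha => Submodule.sum_mem _ fun b hb => ?_)
      · exact Submodule.smul_mem _ (⟨(1 - Q / P) * c a, mul_nonneg hQP (c a).2⟩ : NNReal) (hmem1 a ha)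
      · exact Submodule.smul_mem _ (⟨c a * c b / P, by positivity⟩ : NNReal) (hmem2 a ha b hb)

variable {ι : Type v} [Fintype ι]

/-- linear functional -/
def lfun (e : ι → ℕ) (k : ℕ) : ((ι → ℝ) × ℝ) →ₗ[ℝ] ℝ where
  toFun h := lin h.1 e - k * h.2
  map_add' a b := by simp [lin, add_mul, Finset.sum_add_distrib]; ring
  map_smul' a b := by simp [lin, mul_sub, Finset.mul_sum, mul_assoc]; ring

theorem lfun_apply (e : ι → ℕ) (k : ℕ) (h) : lfun e k h = lin h.1 e - k * h.2 := rfl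

theorem fg_cone (S : Finset ((ι → ℕ) × ℕ)) :
    ∃ T : Finset ((ι → ℝ) × ℝ), (∀ h ∈ T, (∀ i, 0 ≤ h.1 i) ∧ ∀ p ∈ S, p.2 * h.2 ≤ lin h.1 p.1) ∧
      ∀ h : (ι → ℝ) × ℝ, (∀ i, 0 ≤ h.1 i) → (∀ p ∈ S, p.2 * h.2 ≤ lin h.1 p.1) →
        h ∈ Submodule.span NNReal (T : Set ((ι → ℝ) × ℝ)) := by
  classical
  induction S using Finset.induction_on with
  | empty =>
    refine ⟨Finset.univ.image (fun i : ι => (Pi.single i (1:ℝ), (0:ℝ))) ∪ {(0, 1), (0, -1)}, ?_, ?_⟩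
    · intro h hh
      simp only [Finset.mem_union, Finset.mem_image, Finset.mem_univ, true_and, Finset.mem_insert, Finset.mem_singleton] at hh
      refine ⟨fun i => ?_, by simp⟩
      rcases hh with ⟨j, rfl⟩ | rfl | rfl
      · simp only [Pi.single_apply]; split_ifs <;> norm_num
      · simp
      · simp
    · intro h hh _
      set T : Finset ((ι → ℝ) × ℝ) := Finset.univ.image (fun i : ι => (Pi.single i (1:ℝ), (0:ℝ))) ∪ {(0, 1), (0, -1)} with hT
      have e : h = ∑ i, h.1 i • ((Pi.single i (1:ℝ), (0:ℝ)) : (ι → ℝ) × ℝ) + (0, h.2) := by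
        ext i
        · simp [Prod.fst_sum, Finset.sum_apply, Pi.single_apply]
        · simp [Prod.snd_sum]
      rw [e]
      refine add_mem (Submodule.sum_mem _ fun i _ => ?_) ?_
      · exact Submodule.smul_mem _ (⟨h.1 i, hh i⟩ : NNReal) (Submodule.subset_span (by simp [hT]))
      · rcases le_total 0 h.2 with h0 | h0
        · have : ((0, h.2) : (ι → ℝ) × ℝ) = (⟨h.2, h0⟩ : NNReal) • ((0, 1) : (ι → ℝ) × ℝ) := by
            simp [NNReal.smul_def]
          rw [this]
          exact Submodule.smul_mem _ _ (Submodule.subset_span (by simp [hT]))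
        · have : ((0, h.2) : (ι → ℝ) × ℝ) = (⟨-h.2, by linarith⟩ : NNReal) • ((0, -1) : (ι → ℝ) × ℝ) := by
            simp [NNReal.smul_def]
          rw [this]
          exact Submodule.smul_mem _ _ (Submodule.subset_span (by simp [hT]))
  | insert p S hp ih =>
    obtain ⟨T, h1, h2⟩ := ih
    obtain ⟨T', h3, h4⟩ := fm_step T (lfun p.1 p.2)
    refine ⟨T', ?_, ?_⟩
    · intro h hh
      obtain ⟨h5, h6⟩ := h3 h hh
      have h7 : (∀ i, 0 ≤ h.1 i) ∧ ∀ p ∈ S, p.2 * h.2 ≤ lin h.1 p.1 := by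
        clear h5
        refine ⟨fun i => ?_, fun q hq => ?_⟩
        · refine Submodule.span_induction (p := fun h _ => 0 ≤ h.1 i) (fun x hx => (h1 x hx).1 i) (by simp) ?_ ?_ h6
          · intro x y _ _ hx hy; simp only [Prod.fst_add, Pi.add_apply]; linarith
          · intro c x _ hx; simp only [Prod.smul_fst, Pi.smul_apply, NNReal.smul_def, smul_eq_mul]; positivity
        · suffices 0 ≤ lfun q.1 q.2 h by rw [lfun_apply] at this; linarith
          refine Submodule.span_induction (p := fun h _ => 0 ≤ lfun q.1 q.2 h) (fun x hx => ?_) (by simp) ?_ ?_ h6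
          · have := (h1 x hx).2 q hq
            rw [lfun_apply]; linarith
          · intro x y _ _ hx hy; rw [map_add]; linarith
          · intro c x _ hx; rw [NNReal.smul_def, map_smul, smul_eq_mul]; positivity
      refine ⟨h7.1, fun q hq => ?_⟩
      rcases Finset.mem_insert.1 hq with rfl | hq
      · rw [lfun_apply] at h5; linarith
      · exact h7.2 q hq
    · intro h hh hS
      refine h4 h (h2 h hh fun q hq => hS q (Finset.mem_insert_of_mem hq)) ?_
      have := hS p (Finset.mem_insert_self _ _)
      rw [lfun_apply]; linarith

theorem DH_of_span {T H : Set ((ι → ℝ) × ℝ)} (h : ∀ x ∈ H, x ∈ Submodule.span NNReal T) {k : ℕ} {e : ι → ℕ}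
    (he : e ∈ DH T k) : e ∈ DH H k := by
  intro x hx
  suffices 0 ≤ lfun e k x by rw [lfun_apply] at this; linarith
  refine Submodule.span_induction (p := fun h _ => 0 ≤ lfun e k h) (fun x hx => ?_) (by simp) ?_ ?_ (h x hx)
  · have := he x hx
    rw [lfun_apply]; linarith
  · intro x y _ _ hx hy; rw [map_add]; linarith
  · intro c x _ hx; rw [NNReal.smul_def, map_smul, smul_eq_mul]; positivity

end cones

section opt

variable {A : Type u} [CommRing A] [IsLocalRing A] [IsNoetherianRing A] {ι : Type v} [Fintype ι] [LinearOrder ι]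

theorem TT_empty {m : ℕ} {z : A} {w : ι → A} (f : A) : f ∈ TT ∅ m z w := by
  have : (1 : A) ∈ TT ∅ m z w := by
    have h := mo_mem (y := z) (w := w) (B := BT ∅ m) (p := (0,0)) (by intro h hh; exact absurd hh (Set.notMem_empty _))
    rw [mo_zero_left, pow_zero] at h
    exact h
  rw [(Ideal.eq_top_iff_one _).2 this]; trivial

theorem glue_fin {w : ι → A}
    (hd : ((Fintype.card ι + 1 : ℕ) : WithBot ℕ∞) ≤ ringKrullDim A)
    {m : ℕ} (hm : 1 ≤ m) {f : A} (hfn : f ∉ maximalIdeal A ^ (m+1) ⊔ Ideal.span (Set.range w))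
    {z0 : A} (hz0 : Par w z0) (H : Set ((ι → ℝ) × ℝ)) (hfin : H.Finite) (hH : HNN H)
    (hv : ∀ h ∈ H, ∃ z, Par w z ∧ f ∈ TT {h} m z w) : ∃ z, Par w z ∧ f ∈ TT H m z w := by
  induction H, hfin using Set.Finite.induction_on with
  | empty => exact ⟨z0, hz0, TT_empty f⟩
  | insert hnot hfin ih =>
    rename_i a s
    obtain ⟨z1, h1, h2⟩ := ih (fun h hh => hH h (Or.inr hh)) (fun h hh => hv h (Or.inr hh))
    obtain ⟨z2, h3, h4⟩ := hv a (Or.inl rfl)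
    rw [Set.insert_eq]
    exact glue hd (fun h hh => hH h (Or.inl hh)) (fun h hh => hH h (Or.inr hh)) hm h3 h1 h4 h2 hfn

theorem DH_sub {H1 H2 : Set ((ι → ℝ) × ℝ)} (h : H1 ⊆ H2) {k : ℕ} {e : ι → ℕ} (he : e ∈ DH H2 k) : e ∈ DH H1 k :=
  fun x hx => he x (h hx)

theorem TT_sub {H1 H2 : Set ((ι → ℝ) × ℝ)} (h : H1 ⊆ H2) (m : ℕ) (z : A) (w : ι → A) : TT H2 m z w ≤ TT H1 m z w :=
  mI_mono fun p hp => DH_sub h hp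

theorem JJ_sub {H1 H2 : Set ((ι → ℝ) × ℝ)} (h : H1 ⊆ H2) (w : ι → A) : JJ H2 w ≤ JJ H1 w :=
  Ideal.span_mono (Set.image_mono fun p hp => DH_sub h hp)

theorem um_pow_mem {w : ι → A} (hw : ∀ i, w i ∈ maximalIdeal A) {a : ι → ℕ} {n : ℕ} {i : ι} (h : n ≤ a i) :
    um w a ∈ maximalIdeal A ^ n := by
  unfold um
  rw [← Finset.mul_prod_erase _ _ (Finset.mem_univ i)]
  exact Ideal.mul_mem_right _ _ (Ideal.pow_le_pow_right h (Ideal.pow_mem_pow (hw i) _))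

theorem optimal [IsAdicComplete (maximalIdeal A) A] {w : ι → A}
    (hd : ((Fintype.card ι + 1 : ℕ) : WithBot ℕ∞) ≤ ringKrullDim A)
    {m : ℕ} (hm : 1 ≤ m) {f : A} (hfn : f ∉ maximalIdeal A ^ (m+1) ⊔ Ideal.span (Set.range w))
    {z0 : A} (hz0 : Par w z0) (Hv : Set ((ι → ℝ) × ℝ)) (hH : HNN Hv)
    (hv : ∀ h ∈ Hv, ∃ z, Par w z ∧ f ∈ TT {h} m z w) : ∃ z, Par w z ∧ f ∈ TT Hv m z w := by
  classical
  have hw : ∀ (e : ι → ℕ) (k : ℕ), ∃ h : (ι → ℝ) × ℝ, e ∉ DH Hv k → h ∈ Hv ∧ ¬ (k * h.2 ≤ lin h.1 e) := by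
    intro e k
    by_cases he : e ∈ DH Hv k
    · exact ⟨0, fun h => absurd he h⟩
    · simp only [DH, Set.mem_setOf_eq] at he
      push Not at he
      obtain ⟨h, h1, h2⟩ := he
      exact ⟨h, fun _ => ⟨h1, by linarith⟩⟩
  choose wit hwit using hw
  let H : ℕ → Set ((ι → ℝ) × ℝ) := fun n => (fun p : (ι → ℕ) × ℕ => wit p.1 p.2) ''
    {p | p ∈ Set.Iic (((fun _ => n), m) : (ι → ℕ) × ℕ) ∧ p.1 ∉ DH Hv p.2}
  have hHfin : ∀ n, (H n).Finite := fun n => Set.Finite.image _ ((Set.finite_Iic _).subset fun p hp => hp.1)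
  have hHsub : ∀ n, H n ⊆ Hv := by
    rintro n _ ⟨p, hp, rfl⟩
    exact (hwit p.1 p.2 hp.2).1
  have hHmono : Monotone H := by
    intro n n' hn
    rintro _ ⟨p, hp, rfl⟩
    exact ⟨p, ⟨⟨fun i => (hp.1.1 i).trans hn, hp.1.2⟩, hp.2⟩, rfl⟩
  have hHNN : ∀ n, HNN (H n) := fun n h hh => hH h (hHsub n hh)
  have hkey : ∀ n (e : ι → ℕ) k, (∀ i, e i ≤ n) → k ≤ m → e ∈ DH (H n) k → e ∈ DH Hv k := by
    intro n e k he hk hek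
    by_contra hno
    exact (hwit e k hno).2 (hek _ ⟨(e,k), ⟨⟨he, hk⟩, hno⟩, rfl⟩)
  have hstep : ∀ n z, (Par w z ∧ f ∈ TT (H n) m z w) → ∃ z', (Par w z' ∧ f ∈ TT (H (n+1)) m z' w) ∧
      z' - z ∈ maximalIdeal A ^ (n+1) ∧ z' - z ∈ JJ (H n) w ∧ z' - z ∈ Ideal.span (Set.range w) := by
    rintro n z ⟨hz, hfz⟩
    obtain ⟨y, hy, hfy⟩ := glue_fin hd hm hfn hz0 (H (n+1)) (hHfin _) (hHNN _) (fun h hh => hv h (hHsub _ hh))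
    obtain ⟨g, G, C, hg, hC, h0, heq⟩ := hy.decomp hz hd
    have hcmp : ∀ a ∈ G, a ∈ DH (H n) 1 := by
      intro a ha
      rcases compare hd (hHNN n) (hHNN n) hm hy hz (TT_sub (hHmono n.le_succ) _ _ _ hfy) hfz hfn hg hC h0 heq a ha with h | h <;> exact h
    obtain ⟨g, rfl⟩ := hg
    let G1 := G.filter fun a => a ∈ DH Hv 1
    let G2 := G.filter fun a => ¬ a ∈ DH Hv 1
    have hsum : ∑ a ∈ G, C a * um w a = ∑ a ∈ G1, C a * um w a + ∑ a ∈ G2, C a * um w a :=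
      (Finset.sum_filter_add_sum_filter_not _ _ _).symm
    set z' := z + (↑g⁻¹ : A) * ∑ a ∈ G2, C a * um w a with hz'
    have hy' : y = g * z' + ∑ a ∈ G1, C a * um w a := by
      rw [heq, hsum, hz', mul_add, ← mul_assoc (g : A), Units.mul_inv]; ring
    have hdiff : z' - z = (↑g⁻¹ : A) * ∑ a ∈ G2, C a * um w a := by rw [hz']; ring
    have hsp : z' - z ∈ Ideal.span (Set.range w) := by
      rw [hdiff]
      exact Ideal.mul_mem_left _ _ (sum_um_mem fun h => h0 (Finset.mem_filter.1 h).1)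
    refine ⟨z', ⟨hz.change isUnit_one (by rw [one_mul]; exact hsp), ?_⟩, ?_, ?_, hsp⟩
    · refine TT_le (hHNN _) m ?_ hfy
      rw [hy']
      refine add_mem (Ideal.mem_sup_left (Ideal.mem_span_singleton'.2 ⟨_, rfl⟩)) (Ideal.mem_sup_right (sum_mem_JJ fun a ha => ?_))
      exact DH_sub (hHsub _) (Finset.mem_filter.1 ha).2
    · rw [hdiff]
      refine Ideal.mul_mem_left _ _ (Ideal.sum_mem _ fun a ha => Ideal.mul_mem_left _ _ ?_)
      obtain ⟨ha1, ha2⟩ := Finset.mem_filter.1 ha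
      by_contra hno
      apply ha2
      refine hkey n a 1 (fun i => ?_) hm (hcmp a ha1)
      by_contra hi
      exact hno (um_pow_mem (fun i => hz0.memw i) (by omega : n + 1 ≤ a i))
    · rw [hdiff]
      exact Ideal.mul_mem_left _ _ (sum_mem_JJ fun a ha => hcmp a (Finset.mem_filter.1 ha).1)
  obtain ⟨y0, hy0⟩ := glue_fin hd hm hfn hz0 (H 0) (hHfin _) (hHNN _) (fun h hh => hv h (hHsub _ hh))
  let seq : (n : ℕ) → {z // Par w z ∧ f ∈ TT (H n) m z w} := fun n =>
    Nat.rec (motive := fun n => {z // Par w z ∧ f ∈ TT (H n) m z w}) ⟨y0, hy0⟩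
      (fun n z => ⟨(hstep n z.1 z.2).choose, (hstep n z.1 z.2).choose_spec.1⟩) n
  have hseq : ∀ n, (seq (n+1)).1 - (seq n).1 ∈ maximalIdeal A ^ (n+1) ∧ (seq (n+1)).1 - (seq n).1 ∈ JJ (H n) w ∧
      (seq (n+1)).1 - (seq n).1 ∈ Ideal.span (Set.range w) := fun n => (hstep n (seq n).1 (seq n).2).choose_spec.2
  have hseq2 : ∀ n k, (seq (n+k)).1 - (seq n).1 ∈ maximalIdeal A ^ (n+1) ∧ (seq (n+k)).1 - (seq n).1 ∈ JJ (H n) w ∧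
      (seq (n+k)).1 - (seq n).1 ∈ Ideal.span (Set.range w) := by
    intro n k
    induction k with
    | zero => simp
    | succ k ih =>
      have e : (seq (n+(k+1))).1 - (seq n).1 = ((seq (n+k+1)).1 - (seq (n+k)).1) + ((seq (n+k)).1 - (seq n).1) := by
        rw [← add_assoc]; ring
      obtain ⟨h1, h2, h3⟩ := hseq (n+k)
      rw [e]
      exact ⟨add_mem (Ideal.pow_le_pow_right (by omega) h1) ih.1, add_mem (JJ_sub (hHmono (by omega)) w h2) ih.2.1, add_mem h3 ih.2.2⟩
  obtain ⟨z, hz⟩ := IsPrecomplete.prec (I := maximalIdeal A) (M := A) inferInstance (f := fun n => (seq n).1) (by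
    intro a b hab
    obtain ⟨k, rfl⟩ := Nat.exists_eq_add_of_le hab
    rw [SModEq.comm, SModEq.sub_mem, smul_eq_mul, Ideal.mul_top]
    exact Ideal.pow_le_pow_right (by omega) (hseq2 a k).1)
  have hz' : ∀ n, z - (seq n).1 ∈ maximalIdeal A ^ n := by
    intro n
    have := hz n
    rw [SModEq.comm, SModEq.sub_mem, smul_eq_mul, Ideal.mul_top] at this
    exact this
  have hcl : ∀ (Q : Ideal A) n, (∀ k, (seq (n+k)).1 - (seq n).1 ∈ Q) → z - (seq n).1 ∈ Q := by
    intro Q n h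
    apply krull_mem
    intro k
    have e : z - (seq n).1 = ((seq (n+k)).1 - (seq n).1) + (z - (seq (n+k)).1) := by ring
    rw [e]
    exact add_mem (Ideal.mem_sup_left (h k)) (Ideal.mem_sup_right (Ideal.pow_le_pow_right (by omega) (hz' (n+k))))
  have hzP : Par w z := (seq 0).2.1.change isUnit_one (by rw [one_mul]; exact hcl _ 0 fun k => (hseq2 0 k).2.2)
  have hfk : ∀ n, f ∈ TT (H n) m z w := by
    intro n
    refine TT_le (hHNN _) m ?_ (seq n).2.2
    have e : (seq n).1 = z + -(z - (seq n).1) := by ring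
    rw [e]
    exact add_mem (Ideal.mem_sup_left (Ideal.mem_span_singleton_self z)) (Ideal.mem_sup_right (neg_mem (hcl _ n fun k => (hseq2 n k).2.1)))
  refine ⟨z, hzP, ?_⟩
  obtain ⟨c, hc, hev⟩ := exists_unit_expansion (hzP.reg hd) hzP f
  refine mem_mI.2 ⟨c, ?_, hev⟩
  intro p hp
  let n := ∑ i, p.1 i
  have h1 := supp_subset (hzP.reg hd) hzP.ne_top hc (BT_up (hHNN n) m) (by rw [hev]; exact hfk n) hp
  exact hkey n p.1 _ (fun i => Finset.single_le_sum (f := p.1) (fun _ _ => Nat.zero_le _) (Finset.mem_univ i)) (Nat.sub_le _ _) h1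

end opt

section keyfacts

theorem reduced_of_regular {B : Type u} [CommRing B] (h : IsRegularRing B) : IsReduced B := by
  obtain ⟨hN, hP⟩ := h
  constructor
  rintro x ⟨n, hx⟩
  apply eq_zero_of_localization
  intro J hJ
  haveI : J.IsPrime := hJ.isPrime
  obtain ⟨h1, k, s, h2, h3⟩ := hP J
  classical
  haveI : IsDomain (Localization.AtPrime J) := by
    refine dom_aux k (Localization.AtPrime J) (Finset.univ.image s) ?_ ?_ h3.ge
    · exact Finset.card_image_le.trans (by simp)
    · rw [← h2]; simp
  have : (algebraMap B (Localization.AtPrime J) x) ^ n = 0 := by rw [← map_pow, hx, map_zero]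
  exact IsReduced.eq_zero _ ⟨n, this⟩

/-- consequences of geometric regularity of formal fibres -/
def KF (R S : Type u) [CommRing R] [CommRing S] [Algebra R S] : Prop :=
  ∀ P : Ideal R, P.IsPrime →
    (∀ (x : S) (m : ℕ), x ^ m ∈ P.map (algebraMap R S) → x ∈ P.map (algebraMap R S)) ∧
    (∀ (m : ℕ) (hm : 1 ≤ m) (lam c : S) (t : ℕ → R), IsUnit c →
      (∀ j ≤ m, algebraMap R S (t j) - c * (m.choose j * (-lam) ^ j) ∈ P.map (algebraMap R S)) →
      ∃ r : R, lam - algebraMap R S r ∈ P.map (algebraMap R S))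

variable {R S : Type u} [CommRing R] [CommRing S] [Algebra R S]

theorem fib_inj [Module.Flat R S] (P : Ideal R) [P.IsPrime] (x : S)
    (h : (1 : ResidueField (Localization.AtPrime P)) ⊗ₜ[R] x = 0) : x ∈ P.map (algebraMap R S) := by
  let K := ResidueField (Localization.AtPrime P)
  let ψ : (R ⧸ P) →ₐ[R] K := (Ideal.Quotient.liftₐ P (Algebra.ofId R K) (by
    intro a ha
    have : algebraMap R K a = 0 := by
      rw [IsScalarTower.algebraMap_apply R (Localization.AtPrime P) K]
      apply (residue_eq_zero_iff _).2
      exact (IsLocalization.AtPrime.to_map_mem_maximal_iff (Localization.AtPrime P) P a).2 ha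
    exact this))
  let φ : (R ⧸ P) →ₗ[R] K := ψ.toLinearMap
  have hφ : Function.Injective φ := by
    rw [← LinearMap.ker_eq_bot, LinearMap.ker_eq_bot']
    intro a ha
    obtain ⟨a, rfl⟩ := Ideal.Quotient.mk_surjective a
    rw [Ideal.Quotient.eq_zero_iff_mem]
    have h2 : algebraMap R K a = 0 := ha
    rw [IsScalarTower.algebraMap_apply R (Localization.AtPrime P) K] at h2
    exact (IsLocalization.AtPrime.to_map_mem_maximal_iff (Localization.AtPrime P) P a).1 ((residue_eq_zero_iff _).1 h2)
  have hinj := Module.Flat.rTensor_preserves_injective_linearMap (M := S) φ hφ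
  have h0 : (1 : R ⧸ P) ⊗ₜ[R] x = 0 := by
    apply hinj
    rw [map_zero, LinearMap.rTensor_tmul]
    have : φ 1 = 1 := map_one ψ
    rw [this]; exact h
  have h1 := congrArg (TensorProduct.quotTensorEquivQuotSMul S P) h0
  rw [map_zero] at h1
  have h2 : (TensorProduct.quotTensorEquivQuotSMul S P) ((1 : R ⧸ P) ⊗ₜ[R] x) = Submodule.Quotient.mk x := by
    have := TensorProduct.quotTensorEquivQuotSMul_mk_tmul (M := S) P 1 x
    rw [one_smul] at this
    exact this
  rw [h2, Submodule.Quotient.mk_eq_zero, Ideal.smul_top_eq_map] at h1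
  exact h1

theorem fib_zero (P : Ideal R) [P.IsPrime] (x : S) (hx : x ∈ P.map (algebraMap R S)) :
    (1 : ResidueField (Localization.AtPrime P)) ⊗ₜ[R] x = 0 := by
  let K := ResidueField (Localization.AtPrime P)
  have : P.map (algebraMap R S) ≤ RingHom.ker (Algebra.TensorProduct.includeRight : S →ₐ[R] K ⊗[R] S) := by
    rw [Ideal.map_le_iff_le_comap]
    intro a ha
    rw [Ideal.mem_comap, RingHom.mem_ker, AlgHom.commutes]
    have h0 : algebraMap R K a = 0 := by
      rw [IsScalarTower.algebraMap_apply R (Localization.AtPrime P) K]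
      apply (residue_eq_zero_iff _).2
      exact (IsLocalization.AtPrime.to_map_mem_maximal_iff (Localization.AtPrime P) P a).2 ha
    rw [Algebra.TensorProduct.algebraMap_apply, h0, TensorProduct.zero_tmul]
  exact this hx

theorem app_aux {K K' W : Type u} [Field K] [CommRing K'] [Algebra K K'] [CommRing W] [Algebra K W]
    (φ : K' →ₗ[K] K) (θ : K') (l : W) (h : θ ⊗ₜ[K] (1 : W) = (1 : K') ⊗ₜ[K] l) :
    φ θ • (1 : W) = φ 1 • l := by
  have := congrArg (fun x => TensorProduct.lid K W (LinearMap.rTensor W φ x)) h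
  simpa only [LinearMap.rTensor_tmul, TensorProduct.lid_tmul] using this

set_option maxHeartbeats 1000000 in
theorem KF_of_fib [Module.FaithfullyFlat R S]
    (h : ∀ (P : Ideal R) [P.IsPrime], IsGeometricallyRegularAlgebra (ResidueField (Localization.AtPrime P))
      (ResidueField (Localization.AtPrime P) ⊗[R] S)) : KF R S := by
  intro P hP
  let K := ResidueField (Localization.AtPrime P)
  let W := K ⊗[R] S
  let inc : S →ₐ[R] W := Algebra.TensorProduct.includeRight
  have hinc0 : ∀ x ∈ P.map (algebraMap R S), inc x = 0 := fun x hx => fib_zero P x hx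
  have hinc1 : ∀ x, inc x = 0 → x ∈ P.map (algebraMap R S) := fun x hx => fib_inj P x hx
  have hred : IsReduced W := by
    haveI := reduced_of_regular (h P K)
    exact isReduced_of_injective (Algebra.TensorProduct.includeRight : W →ₐ[K] K ⊗[K] W) 
      (Algebra.TensorProduct.includeRight_injective (algebraMap K K).injective)
  refine ⟨?_, ?_⟩
  · intro x m hx
    apply hinc1
    have := hinc0 _ hx
    rw [map_pow] at this
    exact hred.eq_zero _ ⟨m, this⟩
  · intro m hm lam c t hc ht
    by_cases hWs : Subsingleton W
    · exact ⟨0, hinc1 _ (Subsingleton.elim _ _)⟩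
    haveI : Nontrivial W := not_subsingleton_iff_nontrivial.1 hWs
    let F : Polynomial K := ∑ j ∈ Finset.range (m+1), Polynomial.C (algebraMap R K (t j)) * Polynomial.X ^ (m - j)
    have hcoef : F.coeff m = algebraMap R K (t 0) := by
      simp only [F, Polynomial.finset_sum_coeff, Polynomial.coeff_C_mul, Polynomial.coeff_X_pow]
      rw [Finset.sum_eq_single 0]
      · simp
      · intro b hb hb0
        rw [if_neg (by have := Finset.mem_range.1 hb; omega), mul_zero]
      · simp
    have hRW : ∀ r : R, inc (algebraMap R S r) = algebraMap K W (algebraMap R K r) := by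
      intro r
      rw [AlgHom.commutes]; rfl
    have htj : ∀ j ≤ m, algebraMap K W (algebraMap R K (t j)) = inc c * (m.choose j * (- inc lam) ^ j) := by
      intro j hj
      have := hinc0 _ (ht j hj)
      rw [map_sub, sub_eq_zero, hRW] at this
      rw [this]; simp
    have ht0 : algebraMap R K (t 0) ≠ 0 := by
      intro h0
      have := htj 0 (Nat.zero_le _)
      rw [h0, map_zero] at this
      simp only [Nat.choose_zero_right, Nat.cast_one, pow_zero, mul_one] at this
      exact (hc.map inc).ne_zero this.symm
    have hFdeg : F.natDegree ≠ 0 := by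
      have : m ≤ F.natDegree := Polynomial.le_natDegree_of_ne_zero (by rw [hcoef]; exact ht0)
      omega
    obtain ⟨μ, hμ, hdvd⟩ := Polynomial.exists_irreducible_of_natDegree_ne_zero hFdeg
    haveI : Fact (Irreducible μ) := ⟨hμ⟩
    let K' := AdjoinRoot μ
    haveI : Module.Finite K K' := (AdjoinRoot.powerBasis hμ.ne_zero).finite
    haveI := reduced_of_regular (h P K')
    let θ : K' := AdjoinRoot.root μ
    have hFθ : Polynomial.aeval θ F = 0 := by
      obtain ⟨q, hq⟩ := hdvd
      rw [hq, map_mul, AdjoinRoot.aeval_eq, AdjoinRoot.mk_self, zero_mul]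
    let j1 : K' →ₐ[K] K' ⊗[K] W := Algebra.TensorProduct.includeLeft
    let j2 : W →ₐ[K] K' ⊗[K] W := Algebra.TensorProduct.includeRight
    have hpow : j2 (inc c) * (j1 θ - j2 (inc lam)) ^ m = 0 := by
      have e0 := congrArg j1 hFθ
      rw [map_zero, ← Polynomial.aeval_algHom_apply] at e0
      simp only [F, map_sum, map_mul, map_pow, Polynomial.aeval_C, Polynomial.aeval_X] at e0
      rw [← e0, sub_eq_add_neg, add_comm, add_pow, Finset.mul_sum]
      refine Finset.sum_congr rfl fun j hj => ?_
      have hj' : j ≤ m := by have := Finset.mem_range.1 hj; omega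
      have e1 : algebraMap K (K' ⊗[K] W) (algebraMap R K (t j)) = j2 (algebraMap K W (algebraMap R K (t j))) :=
        (j2.commutes _).symm
      rw [e1, htj j hj', map_mul, map_mul, map_pow, map_neg, map_natCast]
      ring
    have heq : j1 θ = j2 (inc lam) := by
      have h1 : (j1 θ - j2 (inc lam)) ^ m = 0 := ((hc.map inc).map j2).mul_right_eq_zero.1 hpow
      exact sub_eq_zero.1 (IsReduced.eq_zero _ ⟨m, h1⟩)
    have heq' : θ ⊗ₜ[K] (1 : W) = (1 : K') ⊗ₜ[K] inc lam := heq
    have happ : ∀ φ : K' →ₗ[K] K, φ θ • (1 : W) = φ 1 • inc lam := by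
      intro φ
      exact app_aux φ θ (inc lam) heq'
    obtain ⟨κ0, hκ0⟩ : ∃ κ0 : K, κ0 • (1 : K') = θ := by
      rw [← Submodule.mem_span_singleton]
      by_contra hno
      obtain ⟨φ, hφ1, hφ2⟩ := Submodule.exists_le_ker_of_notMem hno
      have hφ0 : φ 1 = 0 := hφ2 (Submodule.mem_span_singleton_self _)
      have := happ φ
      rw [hφ0, zero_smul] at this
      rcases smul_eq_zero.1 this with h1 | h1
      · exact hφ1 h1
      · exact one_ne_zero h1
    obtain ⟨φ, hφ1⟩ : ∃ φ : K' →ₗ[K] K, φ 1 ≠ 0 := by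
      obtain ⟨φ, hφ1, -⟩ := Submodule.exists_le_ker_of_notMem (p := (⊥ : Submodule K K')) (v := (1 : K')) (by simp)
      exact ⟨φ, hφ1⟩
    have hlam : algebraMap K W κ0 = inc lam := by
      have := happ φ
      rw [← hκ0, map_smul, smul_eq_mul, mul_comm, mul_smul] at this
      have h2 := smul_right_injective W hφ1 this
      rw [Algebra.algebraMap_eq_smul_one]; exact h2
    obtain ⟨κ1, hκ1⟩ := residue_surjective κ0
    obtain ⟨⟨a, s⟩, has⟩ := IsLocalization.surj P.primeCompl κ1
    have has' : κ0 * algebraMap R K s = algebraMap R K a := by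
      have := congrArg (residue (Localization.AtPrime P)) has
      rw [map_mul, hκ1] at this
      exact this
    have hs0 : algebraMap R K s ≠ 0 := by
      intro h0
      rw [IsScalarTower.algebraMap_apply R (Localization.AtPrime P) K] at h0
      exact s.2 ((IsLocalization.AtPrime.to_map_mem_maximal_iff (Localization.AtPrime P) P s).1 ((residue_eq_zero_iff _).1 h0))
    have h1 : lam * algebraMap R S s - algebraMap R S a ∈ P.map (algebraMap R S) := by
      apply hinc1
      rw [map_sub, map_mul, hRW, hRW, ← hlam, ← has', map_mul, sub_self]
    have h2 : a ∈ Ideal.span {(s : R)} ⊔ P := by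
      apply ff_mem (B := S)
      rw [Ideal.map_sup, Ideal.map_span, Set.image_singleton]
      have e : algebraMap R S a = lam * algebraMap R S s + -(lam * algebraMap R S s - algebraMap R S a) := by ring
      rw [e]
      exact add_mem (Ideal.mem_sup_left (Ideal.mem_span_singleton'.2 ⟨_, rfl⟩)) (Ideal.mem_sup_right (neg_mem h1))
    obtain ⟨x, hx, p, hp, hxp⟩ := Submodule.mem_sup.1 h2
    obtain ⟨r, rfl⟩ := Ideal.mem_span_singleton'.1 hx
    refine ⟨r, hinc1 _ ?_⟩
    have h3 : inc (lam - algebraMap R S r) * algebraMap K W (algebraMap R K s) = 0 := by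
      rw [← hRW, ← map_mul]
      apply hinc0
      have e : (lam - algebraMap R S r) * algebraMap R S s = (lam * algebraMap R S s - algebraMap R S a) + algebraMap R S p := by
        rw [← hxp, map_add, map_mul]; ring
      rw [e]
      exact add_mem h1 (Ideal.mem_map_of_mem _ hp)
    have hu : IsUnit (algebraMap K W (algebraMap R K s)) := (isUnit_iff_ne_zero.2 hs0).map _
    exact hu.mul_left_eq_zero.1 h3

end keyfacts

section transport

theorem KF_congr {R S R' S' : Type u} [CommRing R] [CommRing S] [Algebra R S] [CommRing R'] [CommRing S'] [Algebra R' S']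
    (e : R ≃+* R') (E : S ≃+* S') (hE : ∀ r, E (algebraMap R S r) = algebraMap R' S' (e r))
    (h : KF R' S') : KF R S := by
  intro P hP
  have key : ∀ x, x ∈ P.map (algebraMap R S) ↔ E x ∈ (P.map (e : R →+* R')).map (algebraMap R' S') := by
    intro x
    have h1 : (P.map (e : R →+* R')).map (algebraMap R' S') = (P.map (algebraMap R S)).map (E : S →+* S') := by
      rw [Ideal.map_map, Ideal.map_map]
      congr 1
      ext r
      exact (hE r).symm
    rw [h1]
    constructor
    · intro hx
      exact Ideal.mem_map_of_mem (E : S →+* S') hx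
    · intro hx
      obtain ⟨y, hy, hyx⟩ := (Ideal.mem_map_iff_of_surjective (E : S →+* S') E.surjective).1 hx
      have : y = x := E.injective hyx
      rwa [← this]
  have hP' : (P.map (e : R →+* R')).IsPrime := Ideal.map_isPrime_of_equiv e
  obtain ⟨ha, hb⟩ := h _ hP'
  refine ⟨?_, ?_⟩
  · intro x m hx
    rw [key] at hx ⊢
    rw [map_pow] at hx
    exact ha _ _ hx
  · intro m hm lam c t hc ht
    obtain ⟨r, hr⟩ := hb m hm (E lam) (E c) (fun j => e (t j)) (hc.map E) (by
      intro j hj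
      have := (key _).1 (ht j hj)
      rw [map_sub, hE] at this
      simpa using this)
    refine ⟨e.symm r, ?_⟩
    rw [key, map_sub, hE, e.apply_symm_apply]
    exact hr

theorem cmap_exists {R R' : Type u} [CommRing R] [IsLocalRing R] [CommRing R'] [IsLocalRing R']
    (φ : R →+* R') (hφ : maximalIdeal R ≤ (maximalIdeal R').comap φ) :
    ∃ G : Completion R →+* Completion R', ∀ (a : AdicCompletion.AdicCauchySequence (maximalIdeal R) R) (n : ℕ),
      AdicCompletion.evalₐ (maximalIdeal R') n (G (AdicCompletion.mk (maximalIdeal R) R a)) =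
        Ideal.Quotient.mk _ (φ (a.val n)) := by
  have hφn : ∀ n, (maximalIdeal R)^n ≤ ((maximalIdeal R')^n).comap φ := by
    intro n
    refine le_trans (Ideal.pow_right_mono hφ n) ?_
    exact Ideal.le_comap_pow _ n
  let g : (n : ℕ) → Completion R →+* R' ⧸ (maximalIdeal R') ^ n := fun n =>
    (Ideal.quotientMap ((maximalIdeal R')^n) φ (hφn n)).comp
      (AdicCompletion.evalₐ (maximalIdeal R) n : AdicCompletion (maximalIdeal R) R →+* _)
  have hga : ∀ n (a : AdicCompletion.AdicCauchySequence (maximalIdeal R) R), g n (AdicCompletion.mk (maximalIdeal R) R a) =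
     Ideal.Quotient.mk _ (φ (a.val n)) := by
    intro n a
    show (Ideal.quotientMap ((maximalIdeal R')^n) φ (hφn n)) (AdicCompletion.evalₐ (maximalIdeal R) n (AdicCompletion.mk (maximalIdeal R) R a)) = _
    rw [AdicCompletion.evalₐ_mk, Ideal.quotientMap_mk]
  have hg : ∀ {m n : ℕ} (hle : m ≤ n), (Ideal.Quotient.factorPow (maximalIdeal R') hle).comp (g n) = g m := by
    intro m n hle
    ext x
    obtain ⟨a, rfl⟩ := AdicCompletion.mk_surjective (maximalIdeal R) R x
    rw [RingHom.comp_apply, hga, hga]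
    erw [Ideal.Quotient.factor_mk]
    have h1 := AdicCompletion.Ideal.mk_eq_mk (maximalIdeal R) hle a
    rw [Ideal.Quotient.eq] at h1 ⊢
    rw [← map_sub]
    exact hφn m h1
  refine ⟨AdicCompletion.liftRingHom (maximalIdeal R') g hg, ?_⟩
  intro a n
  rw [AdicCompletion.evalₐ_liftRingHom]
  exact hga n a

theorem compl_equiv {R R' : Type u} [CommRing R] [IsLocalRing R] [CommRing R'] [IsLocalRing R']
    (e : R ≃+* R') : ∃ E : Completion R ≃+* Completion R', ∀ r, E (algebraMap R _ r) = algebraMap R' _ (e r) := by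
  have h1 : maximalIdeal R ≤ (maximalIdeal R').comap (e : R →+* R') := by
    intro x hx
    rw [Ideal.mem_comap, mem_maximalIdeal, mem_nonunits_iff] at *
    intro h
    apply hx
    have := h.map e.symm
    simpa using this
  have h2 : maximalIdeal R' ≤ (maximalIdeal R).comap (e.symm : R' →+* R) := by
    intro x hx
    rw [Ideal.mem_comap, mem_maximalIdeal, mem_nonunits_iff] at *
    intro h
    apply hx
    have := h.map e
    simpa using this
  obtain ⟨G, hG⟩ := cmap_exists (e : R →+* R') h1
  obtain ⟨G', hG'⟩ := cmap_exists (e.symm : R' →+* R) h2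
  have comp : ∀ {R R' : Type u} [CommRing R] [IsLocalRing R] [CommRing R'] [IsLocalRing R'] (e : R ≃+* R')
    (h2 : maximalIdeal R' ≤ (maximalIdeal R).comap (e.symm : R' →+* R))
    (G : Completion R →+* Completion R') (G' : Completion R' →+* Completion R)
    (hG : ∀ (a : AdicCompletion.AdicCauchySequence (maximalIdeal R) R) (n : ℕ),
      AdicCompletion.evalₐ (maximalIdeal R') n (G (AdicCompletion.mk (maximalIdeal R) R a)) =
        Ideal.Quotient.mk _ ((e : R →+* R') (a.val n)))
    (hG' : ∀ (a : AdicCompletion.AdicCauchySequence (maximalIdeal R') R') (n : ℕ),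
      AdicCompletion.evalₐ (maximalIdeal R) n (G' (AdicCompletion.mk (maximalIdeal R') R' a)) =
        Ideal.Quotient.mk _ ((e.symm : R' →+* R) (a.val n))), ∀ x, G' (G x) = x := by
    intro R R' _ _ _ _ e h2 G G' hG hG' x
    obtain ⟨a, rfl⟩ := AdicCompletion.mk_surjective (maximalIdeal R) R x
    obtain ⟨b, hb⟩ := AdicCompletion.mk_surjective (maximalIdeal R') R' (G (AdicCompletion.mk (maximalIdeal R) R a))
    apply AdicCompletion.ext_evalₐ
    intro n
    have hab := hG a n
    rw [← hb, AdicCompletion.evalₐ_mk, Ideal.Quotient.eq] at hab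
    rw [← hb, hG', AdicCompletion.evalₐ_mk, Ideal.Quotient.eq]
    have h3 : b.val n - (e : R →+* R') (a.val n) ∈ ((maximalIdeal R)^n).comap (e.symm : R' →+* R) :=
      (le_trans (Ideal.pow_right_mono h2 n) (Ideal.le_comap_pow _ n)) hab
    rw [Ideal.mem_comap, map_sub] at h3
    simpa using h3
  refine ⟨RingEquiv.ofRingHom G G' ?_ ?_, ?_⟩
  · ext1 x
    exact comp e.symm h1 G' G hG' hG x
  · ext1 x
    exact comp e h2 G G' hG hG' x
  · intro r
    show G (algebraMap R _ r) = _
    have hr : algebraMap R (Completion R) r = AdicCompletion.mk (maximalIdeal R) R (AdicCompletion.AdicCauchySequence.mk (maximalIdeal R) R (fun _ => r) (by intro n; exact SModEq.refl _)) := by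
      apply AdicCompletion.ext_evalₐ
      intro n
      rw [AdicCompletion.evalₐ_mk, AlgHom.commutes]; rfl
    rw [hr]
    apply AdicCompletion.ext_evalₐ
    intro n
    rw [hG, AlgHom.commutes]; rfl

theorem KF_completion {R : Type u} [CommRing R] [IsLocalRing R] (h : IsGRing R) : KF R (Completion R) := by
  obtain ⟨hN, hP⟩ := h
  let R' := Localization.AtPrime (maximalIdeal R)
  let e : R ≃ₐ[R] R' := IsLocalization.atUnits R (maximalIdeal R).primeCompl (S := R') (by
    intro x hx
    have : x ∉ maximalIdeal R := hx
    rw [mem_maximalIdeal, mem_nonunits_iff, not_not] at this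
    exact this)
  haveI : IsNoetherianRing R' := IsLocalization.isNoetherianRing (maximalIdeal R).primeCompl R' hN
  obtain ⟨E, hE⟩ := compl_equiv e.toRingEquiv
  refine KF_congr e.toRingEquiv E hE ?_
  haveI := compl_flat (A := R')
  exact KF_of_fib (hP (maximalIdeal R))

end transport

section descent

theorem map_mo {R S : Type u} [CommRing R] [CommRing S] (φ : R →+* S) {ι : Type v} [Fintype ι] (y : R) (w : ι → R) (p) :
    φ (mo y w p) = mo (φ y) (fun i => φ (w i)) p := by
  simp [mo, map_prod]

theorem map_um {R S : Type u} [CommRing R] [CommRing S] (φ : R →+* S) {ι : Type v} [Fintype ι] (w : ι → R) (p) :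
    φ (um w p) = um (fun i => φ (w i)) p := by
  simp [um, map_prod]

theorem map_mI {R S : Type u} [CommRing R] [CommRing S] (φ : R →+* S) {ι : Type v} [Fintype ι] (y : R) (w : ι → R) (B) :
    (mI y w B).map φ = mI (φ y) (fun i => φ (w i)) B := by
  unfold mI
  rw [Ideal.map_span, ← Set.image_comp]
  congr 1
  apply Set.image_congr
  intro p _
  exact map_mo φ y w p

theorem map_spanrange {R S : Type u} [CommRing R] [CommRing S] (φ : R →+* S) {ι : Type v} (w : ι → R) :
    (Ideal.span (Set.range w)).map φ = Ideal.span (Set.range fun i => φ (w i)) := by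
  rw [Ideal.map_span, ← Set.range_comp]; rfl

theorem insert_span_eq {A : Type u} [CommRing A] {s : Set A} {y z g : A} (hg : IsUnit g)
    (h : y - g * z ∈ Ideal.span s) : Ideal.span (insert y s) = Ideal.span (insert z s) := by
  have hs : ∀ x, Ideal.span s ≤ Ideal.span (insert x s) := fun x => Ideal.span_mono (Set.subset_insert _ _)
  have hx : ∀ x, x ∈ Ideal.span (insert x s) := fun x => Ideal.subset_span (Or.inl rfl)
  apply le_antisymm
  · rw [Ideal.span_le, Set.insert_subset_iff]
    refine ⟨?_, fun x hx => hs z (Ideal.subset_span hx)⟩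
    have e : y = g * z + (y - g * z) := by ring
    rw [e]
    exact add_mem (Ideal.mul_mem_left _ _ (hx z)) (hs z h)
  · rw [Ideal.span_le, Set.insert_subset_iff]
    refine ⟨?_, fun x hx => hs y (Ideal.subset_span hx)⟩
    obtain ⟨g, rfl⟩ := hg
    have e : z = ↑g⁻¹ * y - ↑g⁻¹ * (y - g * z) := by
      have := g.inv_mul; linear_combination (-z) * this
    rw [e]
    exact sub_mem (Ideal.mul_mem_left _ _ (hx y)) (Ideal.mul_mem_left _ _ (hs y h))

theorem exists_coefs {A : Type u} [CommRing A] (v : ℕ → A) (n : ℕ) (W : Ideal A) (x : A)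
    (h : x ∈ Ideal.span (v '' (Finset.range n : Set ℕ)) ⊔ W) :
    ∃ s : ℕ → A, x - ∑ j ∈ Finset.range n, s j * v j ∈ W := by
  obtain ⟨a, ha, b, hb, rfl⟩ := Submodule.mem_sup.1 h
  obtain ⟨s, rfl⟩ := (Submodule.mem_span_image_finset_iff_exists_fun' A).1 ha
  refine ⟨s, ?_⟩
  simpa using hb

variable {A : Type u} [CommRing A] {ι : Type v} [Fintype ι] [LinearOrder ι]

theorem compare_coefs {L : ι → ℝ} (hL : ∀ i, 0 ≤ L i) (y : A) (w : ι → A) (hr : PermReg (oo y w)) (α : ι → ℕ)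
    (hα : α ≠ 0) (m : ℕ) (d : ℕ → A)
    (h : ∑ j ∈ Finset.range (m+1), d j * mo y w (j • α, m - j) ∈ mI y w (BW (wlex L) (wlex L α) (m • wlex L α))) :
    ∀ j ≤ m, d j ∈ Ideal.span (insert y (Set.range w)) := by
  intro j hj
  set W := BW (wlex L) (wlex L α) (m • wlex L α)
  have hw0 : (0 : Lex (ℝ × Lex (ι → ℕ))) ≤ wlex L α := (wlex_pos hL α hα).le
  refine mcoef hr (B := W ∪ {p | ∃ i ≤ m, i ≠ j ∧ p = (i • α, m - i)}) (p := (j • α, m - j)) ?_ ?_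
  · rintro β (hβ | ⟨i, hi, hij, rfl⟩) hle
    · have h1 : m • wlex L α < wlex L β.1 + β.2 • wlex L α := hβ
      have h2 : wlex L β.1 ≤ wlex L (j • α) := wlex_mono hL hle.1
      have h3 : β.2 • wlex L α ≤ (m - j) • wlex L α := nsmul_le_nsmul_left hw0 hle.2
      have h4 := h1.trans_le (add_le_add h2 h3)
      rw [map_nsmul, ← add_nsmul, Nat.add_sub_cancel' hj] at h4
      exact lt_irrefl _ h4
    · obtain ⟨k, hk⟩ : ∃ k, α k ≠ 0 := by
        by_contra hc; push Not at hc; exact hα (funext hc)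
      have h1 : i * α k ≤ j * α k := hle.1 k
      have h2 : m - i ≤ m - j := hle.2
      have h3 := Nat.le_of_mul_le_mul_right h1 (Nat.pos_of_ne_zero hk)
      omega
  · have hmem : j ∈ Finset.range (m+1) := Finset.mem_range.2 (by omega)
    rw [← Finset.add_sum_erase _ _ hmem] at h
    have e : d j * mo y w (j • α, m - j) = (d j * mo y w (j • α, m - j) + ∑ j ∈ (Finset.range (m+1)).erase j, d j * mo y w (j • α, m - j))
      - ∑ j ∈ (Finset.range (m+1)).erase j, d j * mo y w (j • α, m - j) := by ring
    rw [e]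
    refine sub_mem (mI_mono Set.subset_union_left h) (Ideal.sum_mem _ fun i hi => Ideal.mul_mem_left _ _ (mo_mem (Or.inr ⟨i, ?_, ?_, rfl⟩)))
    · have := Finset.mem_range.1 (Finset.mem_of_mem_erase hi); omega
    · exact Finset.ne_of_mem_erase hi

end descent

section descent2
variable {R S : Type u} [CommRing R] [CommRing S] [Algebra R S] [IsLocalRing S]
  [Module.FaithfullyFlat R S] {ι : Type v} [Fintype ι] [LinearOrder ι]

theorem descent_step (hKF : KF R S) {L : ι → ℝ} (hL : ∀ i, 0 < L i) {w : ι → R} {ws : ι → S}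
    (hws : ws = fun i => algebraMap R S (w i)) {z : S} {m : ℕ} (hm : 1 ≤ m) {f : R}
    (hf : algebraMap R S f ∈ TT {(L, 1)} m z ws)
    (hprime : (Ideal.span (insert z (Set.range ws))).IsPrime)
    (hPS : ((Ideal.span (insert z (Set.range ws))).comap (algebraMap R S)).map (algebraMap R S) =
      Ideal.span (insert z (Set.range ws)))
    (hwM : ∀ i, ws i ∈ maximalIdeal S)
    (hreg : ∀ Y g, IsUnit g → Y - g * z ∈ Ideal.span (Set.range ws) → PermReg (oo Y ws))
    (hunit : ∀ c, algebraMap R S f - c * z ^ m ∈ Ideal.span (Set.range ws) → IsUnit c)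
    (X : Finset (ι → ℕ)) (h0 : ∀ a ∈ X, a ≠ 0 ∧ a ∉ DH {(L, (1:ℝ))} 1)
    (hup : ∀ a ∈ X, ∀ b, a ≤ b → b ∈ X ∨ b ∈ DH {(L, (1:ℝ))} 1) (hne : X.Nonempty)
    (y : R) (g : S) (hg : IsUnit g)
    (hy : algebraMap R S y - g * z ∈ Ideal.span (um ws '' (↑X ∪ DH {(L, (1:ℝ))} 1))) :
    ∃ α ∈ X, (∀ a ∈ X.erase α, ∀ b, a ≤ b → b ∈ X.erase α ∨ b ∈ DH {(L, (1:ℝ))} 1) ∧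
    ∃ (y' : R) (g' : S), IsUnit g' ∧ algebraMap R S y' - g' * z ∈ Ideal.span (um ws '' (↑(X.erase α) ∪ DH {(L, (1:ℝ))} 1)) := by
  classical
  set D := DH {(L, (1:ℝ))} 1 with hD
  have hL0 : ∀ i, 0 ≤ L i := fun i => (hL i).le
  have hDm : ∀ e, e ∈ D ↔ 1 ≤ lin L e := by
    intro e; simp [hD, DH]
  have hD0 : ∀ e ∈ D, e ≠ 0 := by
    rintro e he rfl
    rw [hDm, lin_zero] at he; linarith
  have hHNN : HNN {(L, (1:ℝ))} := by
    rintro h rfl i; exact hL0 i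
  obtain ⟨α, hαX, hαmin⟩ := Finset.exists_min_image X (wlex L) hne
  obtain ⟨hα0, hαD⟩ := h0 α hαX
  have hαlt : lin L α < 1 := by rw [hDm] at hαD; exact not_le.1 hαD
  have hset : (↑X ∪ D : Set (ι → ℕ)) = insert α (↑(X.erase α) ∪ D) := by
    rw [← Set.insert_union, ← Finset.coe_insert, Finset.insert_erase hαX]
  refine ⟨α, hαX, ?_, ?_⟩
  · intro a ha b hab
    rcases hup a (Finset.mem_of_mem_erase ha) b hab with h1 | h1
    · left
      refine Finset.mem_erase.2 ⟨?_, h1⟩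
      rintro rfl
      have h2 := hαmin a (Finset.mem_of_mem_erase ha)
      have h3 := wlex_mono hL0 hab
      exact Finset.ne_of_mem_erase ha (wlex_inj L (le_antisymm h3 h2))
    · exact Or.inr h1
  set Y := algebraMap R S y with hY
  rw [hset, Set.image_insert_eq, Ideal.mem_span_insert] at hy
  obtain ⟨C, j, hj, hyj⟩ := hy
  have hsub : Ideal.span (um ws '' (↑(X.erase α) ∪ D)) ≤ Ideal.span (Set.range ws) := by
    rw [Ideal.span_le]
    rintro _ ⟨e, he, rfl⟩
    refine um_mem ws e ?_
    rcases he with he | he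
    · exact (h0 e (Finset.mem_of_mem_erase he)).1
    · exact hD0 e he
  have hYz : Y - g * z ∈ Ideal.span (Set.range ws) := by
    rw [hyj]
    exact add_mem (Ideal.mul_mem_left _ _ (um_mem ws α hα0)) (hsub hj)
  have hspan : Ideal.span (insert Y (Set.range ws)) = Ideal.span (insert z (Set.range ws)) := insert_span_eq hg hYz
  have hregY : PermReg (oo Y ws) := hreg Y g hg hYz
  set κ := wlex L α with hκ
  have hκ0 : 0 ≤ κ := (wlex_pos hL0 α hα0).le
  -- lemX
  have hfg : algebraMap R S f ∈ TT {(L, 1)} m (g * z) ws := by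
    refine TT_le hHNN m ?_ hf
    apply Ideal.mem_sup_left
    obtain ⟨g, rfl⟩ := hg
    exact Ideal.mem_span_singleton'.2 ⟨↑g⁻¹, by rw [← mul_assoc, g.inv_mul, one_mul]⟩
  have hYmem : Y ∈ mI Y ws (BV (wlex L) κ κ) := by
    have := mo_mem (y := Y) (w := ws) (B := BV (wlex L) κ κ) (p := (0, 1)) (by simp [BV])
    rwa [mo_zero_left, pow_one] at this
  have humem : um ws α ∈ mI Y ws (BV (wlex L) κ κ) := um_mem_mI (by simp [BV, hκ])
  obtain ⟨c, hc1, hc2⟩ := lemX (wlex L) (fun e he => wlex_pos hL0 e he) κ hκ0 Y (Y - C * um ws α) (g * z) ws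
    (sub_mem hYmem (Ideal.mul_mem_left _ _ humem)) (by
      have e : g * z - (Y - C * um ws α) = - j := by linear_combination -hyj
      rw [e]
      refine neg_mem ?_
      have hle : Ideal.span (um ws '' (↑(X.erase α) ∪ D)) ≤ mI Y ws (BW (wlex L) κ κ) := by
        rw [Ideal.span_le]
        rintro _ ⟨e, he, rfl⟩
        refine um_mem_mI ?_
        simp only [BW, Set.mem_setOf_eq, zero_smul, add_zero]
        rcases he with he | he
        · refine lt_of_le_of_ne (hαmin e (Finset.mem_of_mem_erase he)) fun h => ?_
          exact Finset.ne_of_mem_erase he (wlex_inj L h).symm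
        · exact wlex_lt (lt_of_lt_of_le hαlt ((hDm e).1 he))
      exact hle hj) m (algebraMap R S f) (BT {(L, 1)} m) hfg (by
      intro p hp hpm
      have h1 := hp (L, 1) rfl
      rw [hκ, ← map_nsmul]
      apply wlex_lt
      rw [lin_nsmul]
      have h2 : (0:ℝ) < ((m - p.2 : ℕ) : ℝ) := by exact_mod_cast Nat.sub_pos_of_lt hpm
      have h3 : ((m - p.2 : ℕ) : ℝ) * lin L α < ((m - p.2 : ℕ) : ℝ) * 1 := mul_lt_mul_of_pos_left hαlt h2
      exact lt_of_lt_of_le h3 h1)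
  have hcu : IsUnit c := by
    have : IsUnit (c * g ^ m) := by
      apply hunit
      have e : algebraMap R S f - c * g ^ m * z ^ m = algebraMap R S f - c * (g * z) ^ m := by ring
      rw [e]; exact hc1
    exact isUnit_of_mul_isUnit_left this
  set W := BW (wlex L) κ (m • κ) with hW
  have hexp : c * (Y - C * um ws α) ^ m = ∑ j ∈ Finset.range (m+1), c * (m.choose j * (-C) ^ j) * mo Y ws (j • α, m - j) := by
    rw [sub_eq_add_neg, add_comm, add_pow, Finset.mul_sum]
    refine Finset.sum_congr rfl fun j hj => ?_
    rw [mo_eq, um_nsmul]; dsimp only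
    ring
  have hfR : f ∈ Ideal.span ((fun j => mo y w (j • α, m - j)) '' (Finset.range (m+1) : Set ℕ)) ⊔ mI y w W := by
    apply ff_mem (B := S)
    rw [Ideal.map_sup, map_mI, Ideal.map_span, ← Set.image_comp, ← hY, ← hws]
    have e : algebraMap R S f = c * (Y - C * um ws α) ^ m + (algebraMap R S f - c * (Y - C * um ws α) ^ m) := by ring
    rw [e]
    refine add_mem (Ideal.mem_sup_left ?_) (Ideal.mem_sup_right hc2)
    rw [hexp]
    refine Ideal.sum_mem _ fun j hj => Ideal.mul_mem_left _ _ (Ideal.subset_span ⟨j, hj, ?_⟩)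
    rw [Function.comp_apply, map_mo, ← hws]
  obtain ⟨s, hs⟩ := exists_coefs _ _ _ _ hfR
  have hsS : algebraMap R S f - ∑ j ∈ Finset.range (m+1), algebraMap R S (s j) * mo Y ws (j • α, m - j) ∈ mI Y ws W := by
    have h1 := Ideal.mem_map_of_mem (algebraMap R S) hs
    rw [map_mI, ← hws, ← hY, map_sub, map_sum] at h1
    simp only [map_mul, map_mo, ← hws, ← hY] at h1
    exact h1
  have hcoef := compare_coefs hL0 Y ws hregY α hα0 m (fun j => algebraMap R S (s j) - c * (m.choose j * (-C) ^ j)) (by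
    have e : ∑ j ∈ Finset.range (m+1), (algebraMap R S (s j) - c * (m.choose j * (-C) ^ j)) * mo Y ws (j • α, m - j) =
      (algebraMap R S f - c * (Y - C * um ws α) ^ m) - (algebraMap R S f - ∑ j ∈ Finset.range (m+1), algebraMap R S (s j) * mo Y ws (j • α, m - j)) := by
      rw [hexp]
      simp only [sub_mul, Finset.sum_sub_distrib]
      ring
    rw [e]
    exact sub_mem hc2 hsS)
  rw [hspan, ← hPS] at hcoef
  obtain ⟨-, hb⟩ := hKF _ (hprime.comap (algebraMap R S))
  obtain ⟨r, hr⟩ := hb m hm C c s hcu hcoef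
  rw [hPS, Ideal.mem_span_insert] at hr
  obtain ⟨a, b, hbm, hab⟩ := hr
  refine ⟨y - r * um w α, g + a * um ws α, ?_, ?_⟩
  · by_contra hn
    have h1 : g + a * um ws α ∈ maximalIdeal S := (mem_maximalIdeal _).2 hn
    have h2 : um ws α ∈ maximalIdeal S :=
      (Ideal.span_le.2 (by rintro _ ⟨i, rfl⟩; exact hwM i) : Ideal.span (Set.range ws) ≤ maximalIdeal S) (um_mem ws α hα0)
    have h3 : g ∈ maximalIdeal S := by
      have := sub_mem h1 (Ideal.mul_mem_left _ a h2)
      simpa using this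
    exact (mem_maximalIdeal _).1 h3 hg
  · have e : algebraMap R S (y - r * um w α) - (g + a * um ws α) * z = b * um ws α + j := by
      rw [map_sub, map_mul, map_um, ← hws, ← hY]
      linear_combination hyj + um ws α * hab
    rw [e]
    refine add_mem ?_ hj
    have hle : Ideal.span (Set.range ws) * Ideal.span {um ws α} ≤ Ideal.span (um ws '' (↑(X.erase α) ∪ D)) := by
      rw [Ideal.span_mul_span', Ideal.span_le]
      rintro _ ⟨_, ⟨i, rfl⟩, _, rfl, rfl⟩
      have e2 : ws i * um ws α = um ws (Pi.single i 1 + α) := by rw [um_add, um_single]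
      show ws i * um ws α ∈ _
      rw [e2]
      refine Ideal.subset_span ⟨_, ?_, rfl⟩
      rcases hup α hαX (Pi.single i 1 + α) (le_add_of_nonneg_left (fun _ => Nat.zero_le _)) with h1 | h1
      · left
        refine Finset.mem_coe.2 (Finset.mem_erase.2 ⟨fun h => ?_, h1⟩)
        have := congrFun h i
        simp at this
      · right; exact h1
    exact hle (Ideal.mul_mem_mul hbm (Ideal.mem_span_singleton_self _))

end descent2

section descent3
variable {R S : Type u} [CommRing R] [CommRing S] [Algebra R S] [IsLocalRing S]
  [Module.FaithfullyFlat R S] {ι : Type v} [Fintype ι] [LinearOrder ι]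

theorem descent_core (hKF : KF R S) {L : ι → ℝ} (hL : ∀ i, 0 < L i) {w : ι → R} {ws : ι → S}
    (hws : ws = fun i => algebraMap R S (w i)) {z : S} {m : ℕ} (hm : 1 ≤ m) {f : R}
    (hf : algebraMap R S f ∈ TT {(L, 1)} m z ws)
    (hprime : (Ideal.span (insert z (Set.range ws))).IsPrime)
    (hwM : ∀ i, ws i ∈ maximalIdeal S) (hznot : z ∉ Ideal.span (Set.range ws))
    (hreg : ∀ Y g, IsUnit g → Y - g * z ∈ Ideal.span (Set.range ws) → PermReg (oo Y ws))
    (hunit : ∀ c, algebraMap R S f - c * z ^ m ∈ Ideal.span (Set.range ws) → IsUnit c) :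
    ∃ (y : R) (g : S), IsUnit g ∧ algebraMap R S y - g * z ∈ Ideal.span (Set.range ws) ∧ f ∈ TT {(L, 1)} m y w := by
  classical
  have hL0 : ∀ i, 0 ≤ L i := fun i => (hL i).le
  set D := DH {(L, (1:ℝ))} 1 with hD
  have hDm : ∀ e, e ∈ D ↔ 1 ≤ lin L e := by
    intro e; simp [hD, DH]
  have hD0 : ∀ e ∈ D, e ≠ 0 := by
    rintro e he rfl
    rw [hDm, lin_zero] at he; linarith
  have hHNN : HNN {(L, (1:ℝ))} := by
    rintro h rfl i; exact hL0 i
  set Ph := Ideal.span (insert z (Set.range ws)) with hPh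
  have hzPh : z ∈ Ph := Ideal.subset_span (Or.inl rfl)
  have hwPh : Ideal.span (Set.range ws) ≤ Ph := Ideal.span_mono (Set.subset_insert _ _)
  -- f = c z^m mod ws
  have hfc : ∃ c, algebraMap R S f - c * z ^ m ∈ Ideal.span (Set.range ws) := by
    have hle : TT {(L, (1:ℝ))} m z ws ≤ Ideal.span {z ^ m} ⊔ Ideal.span (Set.range ws) := by
      unfold TT
      rw [mI_le]
      intro p hp
      rw [mo_eq]
      by_cases hpm : p.2 < m
      · refine Ideal.mem_sup_right (Ideal.mul_mem_left _ _ (um_mem ws _ ?_))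
        intro h0
        have h1 := hp (L, 1) rfl
        rw [h0, lin_zero] at h1
        have h2 : (0:ℝ) < ((m - p.2 : ℕ) : ℝ) := by exact_mod_cast Nat.sub_pos_of_lt hpm
        simp only [mul_one] at h1
        linarith
      · refine Ideal.mem_sup_left (Ideal.mul_mem_right _ _ (Ideal.mem_span_singleton.2 (pow_dvd_pow z (not_lt.1 hpm))))
    obtain ⟨a, ha, b, hb, hab⟩ := Submodule.mem_sup.1 (hle hf)
    obtain ⟨c, rfl⟩ := Ideal.mem_span_singleton'.1 ha
    exact ⟨c, by rw [← hab]; simpa using hb⟩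
  obtain ⟨c, hc⟩ := hfc
  have hcu := hunit c hc
  set P := Ph.comap (algebraMap R S) with hP
  haveI : P.IsPrime := hprime.comap _
  have hfP : f ∈ P := by
    rw [hP, Ideal.mem_comap]
    have e : algebraMap R S f = c * z ^ m + (algebraMap R S f - c * z ^ m) := by ring
    rw [e]
    exact add_mem (Ideal.mul_mem_left _ _ (Ideal.pow_mem_of_mem _ hzPh m hm)) (hwPh hc)
  have hwPS : Ideal.span (Set.range ws) ≤ P.map (algebraMap R S) := by
    rw [Ideal.span_le]
    rintro _ ⟨i, rfl⟩
    have : w i ∈ P := by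
      rw [hP, Ideal.mem_comap]
      have : algebraMap R S (w i) = ws i := by rw [hws]
      rw [this]; exact hwPh (Ideal.subset_span ⟨i, rfl⟩)
    have h2 := Ideal.mem_map_of_mem (algebraMap R S) this
    rw [hws]; exact h2
  have hzPS : z ∈ P.map (algebraMap R S) := by
    refine (hKF P inferInstance).1 z m ?_
    have h1 : c * z ^ m ∈ P.map (algebraMap R S) := by
      have e : c * z ^ m = algebraMap R S f - (algebraMap R S f - c * z ^ m) := by ring
      rw [e]
      exact sub_mem (Ideal.mem_map_of_mem _ hfP) (hwPS hc)
    exact (Ideal.unit_mul_mem_iff_mem _ hcu).1 h1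
  have hPS : P.map (algebraMap R S) = Ph := by
    apply le_antisymm Ideal.map_comap_le
    rw [hPh, Ideal.span_le, Set.insert_subset_iff]
    exact ⟨hzPS, fun x hx => hwPS (Ideal.subset_span hx)⟩
  -- find y
  obtain ⟨y0, g0, hg0, hy0⟩ : ∃ (y : R) (g : S), IsUnit g ∧ algebraMap R S y - g * z ∈ Ideal.span (Set.range ws) := by
    by_contra hcon
    push Not at hcon
    have hle : P.map (algebraMap R S) ≤ maximalIdeal S * Ideal.span {z} ⊔ Ideal.span (Set.range ws) := by
      rw [Ideal.map_le_iff_le_comap]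
      intro a ha
      have h1 : algebraMap R S a ∈ Ph := ha
      rw [hPh, Ideal.mem_span_insert] at h1
      obtain ⟨g, b, hb, hab⟩ := h1
      have hgM : g ∈ maximalIdeal S := by
        rw [mem_maximalIdeal, mem_nonunits_iff]
        intro hg
        refine hcon a g hg ?_
        rw [hab]; simpa using hb
      rw [Ideal.mem_comap, hab]
      exact add_mem (Ideal.mem_sup_left (Ideal.mul_mem_mul hgM (Ideal.mem_span_singleton_self z))) (Ideal.mem_sup_right hb)
    obtain ⟨a, ha, b, hb, hab⟩ := Submodule.mem_sup.1 (hle hzPS)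
    obtain ⟨q, hq, rfl⟩ := Ideal.mem_mul_span_singleton.1 ha
    apply hznot
    have hu : IsUnit (1 - q) := by
      by_contra hn
      have h1 : 1 - q ∈ maximalIdeal S := (mem_maximalIdeal _).2 hn
      have h2 := add_mem h1 hq
      rw [sub_add_cancel] at h2
      exact (mem_maximalIdeal _).1 h2 isUnit_one
    refine (Ideal.unit_mul_mem_iff_mem _ hu).1 ?_
    have e : (1 - q) * z = b := by linear_combination -hab
    rw [e]; exact hb
  -- induction
  have main : ∀ (n : ℕ) (X : Finset (ι → ℕ)), X.card = n → (∀ a ∈ X, a ≠ 0 ∧ a ∉ D) →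
      (∀ a ∈ X, ∀ b, a ≤ b → b ∈ X ∨ b ∈ D) →
      (∃ (y : R) (g : S), IsUnit g ∧ algebraMap R S y - g * z ∈ Ideal.span (um ws '' (↑X ∪ D))) →
      ∃ (y : R) (g : S), IsUnit g ∧ algebraMap R S y - g * z ∈ Ideal.span (um ws '' D) := by
    intro n
    induction n with
    | zero =>
      intro X hX _ _ h
      rw [Finset.card_eq_zero] at hX
      subst hX
      simpa using h
    | succ n ih =>
      rintro X hX h0 hup ⟨y, g, hg, hy⟩
      obtain ⟨α, hα, hup', h⟩ := descent_step hKF hL hws hm hf hprime hPS hwM hreg hunit X h0 hup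
        (Finset.card_pos.1 (by omega)) y g hg hy
      refine ih (X.erase α) ?_ (fun a ha => h0 a (Finset.mem_of_mem_erase ha)) hup' h
      rw [Finset.card_erase_of_mem hα, hX]; rfl
  have hfin : {a : ι → ℕ | a ≠ 0 ∧ a ∉ D}.Finite := by
    refine Set.Finite.subset (Set.finite_Iic (fun i => ⌈1 / L i⌉₊)) ?_
    rintro a ⟨-, ha⟩ i
    rw [hDm, not_le] at ha
    have h1 : L i * (a i : ℝ) ≤ lin L a :=
      Finset.single_le_sum (f := fun i => L i * (a i : ℝ)) (fun j _ => mul_nonneg (hL0 j) (Nat.cast_nonneg _)) (Finset.mem_univ i)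
    have h2 : (a i : ℝ) ≤ 1 / L i := by
      rw [le_div_iff₀ (hL i)]; linarith
    exact_mod_cast h2.trans (Nat.le_ceil _)
  obtain ⟨y, g, hg, hy⟩ := main _ hfin.toFinset rfl (fun a ha => by simpa using ha) (by
    intro a ha b hab
    have ha' : a ≠ 0 ∧ a ∉ D := by simpa using ha
    by_cases hb : b ∈ D
    · exact Or.inr hb
    · left
      rw [Set.Finite.mem_toFinset]
      refine ⟨?_, hb⟩
      rintro rfl
      exact ha'.1 (le_antisymm hab (fun _ => Nat.zero_le _))) ⟨y0, g0, hg0, by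
      refine (Ideal.span_le.2 ?_ : Ideal.span (Set.range ws) ≤ _) hy0
      rintro _ ⟨i, rfl⟩
      rw [← um_single ws i]
      refine Ideal.subset_span ⟨_, ?_, rfl⟩
      by_cases hb : (Pi.single i 1 : ι → ℕ) ∈ D
      · exact Or.inr hb
      · left
        rw [Set.Finite.coe_toFinset]
        refine ⟨?_, hb⟩
        intro h
        have := congrFun h i
        simp at this⟩
  have hyJ : algebraMap R S y - g * z ∈ JJ {(L, (1:ℝ))} ws := hy
  refine ⟨y, g, hg, ?_, ?_⟩
  · refine (Ideal.span_le.2 ?_ : Ideal.span (um ws '' D) ≤ _) hy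
    rintro _ ⟨e, he, rfl⟩
    exact um_mem ws e (hD0 e he)
  · apply ff_mem (B := S)
    unfold TT
    rw [map_mI, ← hws]
    refine TT_le hHNN m ?_ hf
    obtain ⟨g, rfl⟩ := hg
    have e : z = ↑g⁻¹ * algebraMap R S y - ↑g⁻¹ * (algebraMap R S y - g * z) := by
      have := g.inv_mul; linear_combination (-z) * this
    rw [e]
    exact sub_mem (Ideal.mem_sup_left (Ideal.mul_mem_left _ _ (Ideal.mem_span_singleton_self _)))
      (Ideal.mem_sup_right (Ideal.mul_mem_left _ _ hyJ))

theorem TT_restrict {A : Type u} [CommRing A] {L : ι → ℝ} (hL : ∀ i, 0 ≤ L i) (m : ℕ) (z : A) (w : ι → A) :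
    TT {(L, (1:ℝ))} m z w = TT {((fun i : {i // 0 < L i} => L i), (1:ℝ))} m z (fun i : {i // 0 < L i} => w i) := by
  classical
  have hlin : ∀ e : ι → ℕ, lin L e = lin (fun i : {i // 0 < L i} => L i) (fun i : {i // 0 < L i} => e i) := by
    intro e
    unfold lin
    refine Eq.trans ?_ (Finset.sum_subtype (p := fun i => 0 < L i) (Finset.univ.filter (fun i => 0 < L i)) (by simp) (fun i => L i * (e i : ℝ)))
    symm
    apply Finset.sum_filter_of_ne
    intro i _ hi
    exact lt_of_le_of_ne (hL i) fun h => hi (by rw [← h, zero_mul])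
  have hum : ∀ e : ι → ℕ, um (fun i : {i // 0 < L i} => w i) (fun i : {i // 0 < L i} => e i) = ∏ i ∈ Finset.univ.filter (fun i => 0 < L i), w i ^ e i := by
    intro e
    exact (Finset.prod_subtype (p := fun i => 0 < L i) (Finset.univ.filter (fun i => 0 < L i)) (by simp) (fun i => w i ^ e i)).symm
  apply le_antisymm
  · unfold TT
    rw [mI_le]
    intro p hp
    have h1 : mo z (fun i : {i // 0 < L i} => w i) ((fun i : {i // 0 < L i} => p.1 i), p.2) ∣ mo z w p := by
      rw [mo_eq, mo_eq]
      refine mul_dvd_mul_left _ ?_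
      dsimp only
      rw [hum]
      exact Finset.prod_dvd_prod_of_subset _ _ _ (Finset.filter_subset _ _)
    refine Ideal.mem_of_dvd _ h1 (mo_mem ?_)
    rintro h rfl
    have := hp (L, 1) rfl
    rw [hlin] at this
    exact this
  · unfold TT
    rw [mI_le]
    intro p hp
    let e : ι → ℕ := fun i => if h : 0 < L i then p.1 ⟨i, h⟩ else 0
    have he : (fun i : {i // 0 < L i} => e i) = p.1 := by
      funext i; simp [e, i.2]
    have h1 : mo z (fun i : {i // 0 < L i} => w i) p = mo z w (e, p.2) := by
      rw [mo_eq, mo_eq, ← he, hum]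
      congr 1
      unfold um
      rw [Finset.prod_filter_of_ne]
      intro i _ hi
      by_contra hn
      exact hi (by simp [e, hn])
    rw [h1]
    refine mo_mem ?_
    rintro h rfl
    have := hp _ rfl
    rw [← he, ← hlin] at this
    exact this

theorem descent [IsLocalRing R] [IsNoetherianRing S] (hKF : KF R S) (hMS : (maximalIdeal R).map (algebraMap R S) = maximalIdeal S)
    (hd : ((Fintype.card ι + 1 : ℕ) : WithBot ℕ∞) ≤ ringKrullDim S)
    {h : (ι → ℝ) × ℝ} (hL : ∀ i, 0 ≤ h.1 i) {w : ι → R}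
    {z : S} {m : ℕ} (hm : 1 ≤ m) {f : R} {z0 : R} (hz0 : Par w z0)
    (hz : Par (fun i => algebraMap R S (w i)) z)
    (hfn : algebraMap R S f ∉ maximalIdeal S ^ (m+1) ⊔ Ideal.span (Set.range (fun i => algebraMap R S (w i))))
    (hf : algebraMap R S f ∈ TT {h} m z (fun i => algebraMap R S (w i))) :
    ∃ y : R, Par w y ∧ f ∈ TT {h} m y w := by
  classical
  obtain ⟨L0, lam⟩ := h
  dsimp only at hL
  by_cases hlam : lam ≤ 0
  · refine ⟨z0, hz0, ?_⟩
    have h1 : (1 : R) ∈ TT {(L0, lam)} m z0 w := by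
      have := mo_mem (y := z0) (w := w) (B := BT {(L0, lam)} m) (p := (0,0)) (by
        rintro h rfl
        simp only [lin_zero]
        exact mul_nonpos_of_nonneg_of_nonpos (Nat.cast_nonneg _) hlam)
      rwa [mo_zero_left, pow_zero] at this
    rw [(Ideal.eq_top_iff_one _).2 h1]; trivial
  push Not at hlam
  obtain ⟨L, hLdef⟩ : ∃ L : ι → ℝ, L = fun i => L0 i / lam := ⟨_, rfl⟩
  have hlin : ∀ e, lin L0 e = lam * lin L e := by
    intro e
    simp only [lin, hLdef, Finset.mul_sum]
    refine Finset.sum_congr rfl fun i _ => ?_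
    field_simp
  have hBT : BT {(L0, lam)} m = BT {(L, (1:ℝ))} m := by
    ext p
    simp only [BT, DH, Set.mem_setOf_eq, Set.mem_singleton_iff, forall_eq, hlin, mul_one]
    rw [mul_comm, mul_le_mul_iff_right₀ hlam]
  have hTT : ∀ {A : Type u} [CommRing A] (z : A) (w : ι → A), TT {(L0, lam)} m z w = TT {(L, (1:ℝ))} m z w := by
    intro A _ z w; unfold TT; rw [hBT]
  rw [hTT] at hf
  simp only [hTT]
  have hL' : ∀ i, 0 ≤ L i := fun i => by rw [hLdef]; exact div_nonneg (hL i) hlam.le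
  rw [TT_restrict hL'] at hf
  simp only [TT_restrict hL']
  set ws := fun i => algebraMap R S (w i) with hws
  have hsub : Ideal.span (Set.range (fun i : {i // 0 < L i} => ws i)) ≤ Ideal.span (Set.range ws) :=
    Ideal.span_mono (by rintro _ ⟨i, rfl⟩; exact ⟨i, rfl⟩)
  obtain ⟨y, g, hg, hyg, hfy⟩ := descent_core (ι := {i // 0 < L i}) hKF (L := fun i => L i) (fun i => i.2) (w := fun i => w i)
    (ws := fun i => ws i) rfl hm hf (by
      have := span_prime (oo z ws) (by rw [range_oo]; exact hz) (by rwa [Fintype.card_option])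
        (insert none ((Finset.univ.filter (fun i => 0 < L i)).image some))
      convert this using 2
      ext x
      simp only [Set.mem_insert_iff, Set.mem_range, Finset.coe_insert, Finset.coe_image, Set.image_insert_eq, Set.mem_image,
        Finset.coe_filter, Finset.mem_univ, true_and, Set.mem_setOf_eq, exists_exists_and_eq_and]
      constructor
      · rintro (h1 | ⟨i, rfl⟩)
        · exact Or.inl h1
        · exact Or.inr ⟨i, i.2, rfl⟩
      · rintro (h1 | ⟨i, hi, rfl⟩)
        · exact Or.inl h1
        · exact Or.inr ⟨⟨i, hi⟩, rfl⟩)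
    (fun i => hz.memw i) (fun h => hz.notMem hd (hsub h)) (by
      intro Y g hg hY
      have hYp : Par ws Y := hz.change hg (hsub hY)
      have := (hYp.reg hd).comp (Option.map (Subtype.val : {i // 0 < L i} → ι)) (Option.map_injective Subtype.val_injective)
      convert this using 2 with o
      cases o <;> rfl) (by
      intro c hc
      exact unit_of_not_mem hz.mem hfn (hsub hc))
  refine ⟨y, ?_, hfy⟩
  have hYp : Par ws (algebraMap R S y) := hz.change hg (hsub hyg)
  unfold Par
  have e : (Ideal.span (insert y (Set.range w))).map (algebraMap R S) = (maximalIdeal R).map (algebraMap R S) := by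
    rw [hMS, ← hYp, Ideal.map_span, Set.image_insert_eq, ← Set.range_comp]; rfl
  rw [← Ideal.comap_map_eq_self_of_faithfullyFlat (B := S) (Ideal.span (insert y (Set.range w))), e,
    Ideal.comap_map_eq_self_of_faithfullyFlat]

end descent3

section final

theorem orthant_isF (d : ℕ) : IsFSubset (orthant d) := by
  refine ⟨subset_rfl, ?_, ?_, ?_⟩
  · have : orthant d = ⋂ i, {x : Fin d → ℝ | 0 ≤ x i} := by ext x; simp [orthant]
    rw [this]
    exact isClosed_iInter fun i => isClosed_le continuous_const (continuous_apply i)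
  · intro x hx y hy a b ha hb _ i
    have h1 := mul_nonneg ha (hx i)
    have h2 := mul_nonneg hb (hy i)
    simp only [Pi.add_apply, Pi.smul_apply, smul_eq_mul]
    linarith
  · intro v hv w hw i
    exact add_nonneg (hv i) (hw i)

theorem isF_smallest {d : ℕ} {X : Set (Fin d → ℝ)} (hX : X ⊆ orthant d) : IsFSubset (smallestFSubset X) := by
  refine ⟨?_, ?_, ?_, ?_⟩
  · intro x hx
    exact Set.mem_sInter.1 hx _ ⟨orthant_isF d, hX⟩
  · exact isClosed_sInter fun t ht => ht.1.2.1
  · exact convex_sInter fun t ht => ht.1.2.2.1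
  · intro v hv w hw
    exact Set.mem_sInter.2 fun t ht => ht.1.2.2.2 v (Set.mem_sInter.1 hv t ht) w hw

theorem sub_smallest {d : ℕ} {X : Set (Fin d → ℝ)} : X ⊆ smallestFSubset X :=
  fun x hx => Set.mem_sInter.2 fun t ht => ht.2 hx

theorem smallest_sub {d : ℕ} {X Δ : Set (Fin d → ℝ)} (h : IsFSubset Δ) (hX : X ⊆ Δ) : smallestFSubset X ⊆ Δ :=
  fun x hx => Set.mem_sInter.1 hx _ ⟨h, hX⟩

theorem projPoint_orthant {d m : ℕ} {p : (Fin d → ℕ) × ℕ} (h : p.2 < m) : projPoint m p ∈ orthant d := by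
  intro i
  have : (p.2 : ℝ) < m := by exact_mod_cast h
  exact div_nonneg (Nat.cast_nonneg _) (by linarith)

theorem delta_isF {A : Type u} [CommRing A] {d : ℕ} (f y : A) (w : Fin d → A) (m : ℕ) :
    IsFSubset (DeltaOf f y w m) := by
  refine isF_smallest ?_
  intro x hx
  obtain ⟨c, hc, p, hp, hpm, rfl⟩ := Set.mem_iUnion₂.1 hx
  exact projPoint_orthant hpm

theorem proj_mem_delta {A : Type u} [CommRing A] {d : ℕ} {f y : A} {w : Fin d → A} {m : ℕ}
    {c : ((Fin d → ℕ) × ℕ) →₀ A} (hc : IsUnitExpansion f y w c) {p} (hp : p ∈ c.support) (hpm : p.2 < m) :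
    projPoint m p ∈ DeltaOf f y w m :=
  sub_smallest (Set.mem_iUnion₂.2 ⟨c, hc, p, hp, hpm, rfl⟩)

theorem delta_sub {A : Type u} [CommRing A] {d : ℕ} {f y : A} {w : Fin d → A} {m : ℕ} {Δ : Set (Fin d → ℝ)}
    (hΔ : IsFSubset Δ)
    (h : ∀ c, IsUnitExpansion f y w c → ∀ p ∈ c.support, p.2 < m → projPoint m p ∈ Δ) :
    DeltaOf f y w m ⊆ Δ := by
  refine smallest_sub hΔ ?_
  intro x hx
  obtain ⟨c, hc, p, hp, hpm, rfl⟩ := Set.mem_iUnion₂.1 hx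
  exact h c hc p hp hpm

theorem sep {d : ℕ} {Δ : Set (Fin d → ℝ)} (hΔ : IsFSubset Δ) {x : Fin d → ℝ} (hx : x ∉ Δ) :
    ∃ (L : Fin d → ℝ) (l : ℝ), (∀ i, 0 ≤ L i) ∧ (∀ v ∈ Δ, l ≤ ∑ i, L i * v i) ∧ ∑ i, L i * x i < l := by
  classical
  rcases Δ.eq_empty_or_nonempty with h0 | ⟨v, hv⟩
  · refine ⟨0, 1, fun i => le_rfl, ?_, by simp⟩
    rw [h0]; intro v hv; exact absurd hv (Set.notMem_empty v)
  · obtain ⟨g, l, h1, h2⟩ := geometric_hahn_banach_point_closed hΔ.2.2.1 hΔ.2.1 hx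
    have hg : ∀ v : Fin d → ℝ, g v = ∑ i, g (Pi.single i 1) * v i := by
      intro v
      have := LinearMap.pi_apply_eq_sum_univ (g : (Fin d → ℝ) →ₗ[ℝ] ℝ) v
      simp only [ContinuousLinearMap.coe_coe, smul_eq_mul] at this
      rw [this]
      refine Finset.sum_congr rfl fun i _ => ?_
      rw [mul_comm]
      congr 2
      ext j
      simp [Pi.single_apply, eq_comm]
    refine ⟨fun i => g (Pi.single i 1), l, ?_, ?_, ?_⟩
    · intro i
      by_contra hneg
      push Not at hneg
      have h3 := h2 v hv
      set t := (g v - l) / (- g (Pi.single i 1)) with ht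
      have htp : 0 ≤ t := div_nonneg (by linarith) (by linarith)
      have h4 := h2 (v + t • Pi.single i 1) (hΔ.2.2.2 v hv _ (by
        intro j
        simp only [Pi.smul_apply, smul_eq_mul, Pi.single_apply]
        split_ifs <;> simp [htp]))
      rw [map_add, map_smul, smul_eq_mul] at h4
      have h5 : t * (- g (Pi.single i 1)) = g v - l := div_mul_cancel₀ _ (by linarith)
      linarith
    · intro v hv
      rw [← hg]; exact (h2 v hv).le
    · rw [← hg]; exact h1

theorem lin_proj {d m : ℕ} {L : Fin d → ℝ} {p : (Fin d → ℕ) × ℕ} (h : p.2 < m) :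
    lin L p.1 = ((m - p.2 : ℕ) : ℝ) * ∑ i, L i * projPoint m p i := by
  have h1 : (p.2 : ℝ) < m := by exact_mod_cast h
  rw [Nat.cast_sub h.le, Finset.mul_sum]
  unfold lin projPoint
  refine Finset.sum_congr rfl fun i _ => ?_
  have : (m : ℝ) - p.2 ≠ 0 := by linarith
  field_simp

theorem supp_BT {A : Type u} [CommRing A] {d : ℕ} {f y : A} {w : Fin d → A} {m : ℕ}
    {c : ((Fin d → ℕ) × ℕ) →₀ A} (hc : IsUnitExpansion f y w c) {L : Fin d → ℝ} {l : ℝ} (hL : ∀ i, 0 ≤ L i)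
    (hl : ∀ v ∈ DeltaOf f y w m, l ≤ ∑ i, L i * v i) : (c.support : Set _) ⊆ BT {(L, l)} m := by
  intro p hp h hh
  rw [Set.mem_singleton_iff] at hh
  subst hh
  by_cases hpm : p.2 < m
  · rw [lin_proj hpm]
    exact mul_le_mul_of_nonneg_left (hl _ (proj_mem_delta hc hp hpm)) (Nat.cast_nonneg _)
  · rw [Nat.sub_eq_zero_of_le (not_lt.1 hpm)]
    simp only [Nat.cast_zero, zero_mul]
    exact lin_nonneg hL _

theorem proj_up {d m : ℕ} {Δ : Set (Fin d → ℝ)} (hΔ : IsFSubset Δ) {p q : (Fin d → ℕ) × ℕ} (hpq : p ≤ q)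
    (hq : q.2 < m) (hp : projPoint m p ∈ Δ) : projPoint m q ∈ Δ := by
  have := hΔ.2.2.2 _ hp (projPoint m q - projPoint m p) (by
    intro i
    simp only [Pi.sub_apply, projPoint, sub_nonneg]
    have h1 : (p.2 : ℝ) ≤ q.2 := by exact_mod_cast hpq.2
    have h2 : (q.2 : ℝ) < m := by exact_mod_cast hq
    have h3 : (p.1 i : ℝ) ≤ q.1 i := by exact_mod_cast hpq.1 i
    exact div_le_div₀ (Nat.cast_nonneg _) h3 (by linarith) (by linarith))
  rwa [add_sub_cancel] at this

theorem final_eq {d : ℕ} {R : Type u} [CommRing R] [IsLocalRing R]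
    (hreg : IsRegularLocalRing R) (hG : IsGRing R)
    (y : R) (u : Fin d → R) (hrsp : IsRSP R y u)
    (f : R) (hfM : f ∈ maximalIdeal R) (hfu : f ∉ Ideal.span (Set.range u)) :
    ∃ z : R, IsRSP R z u ∧ Delta f z u = CharPolyhedron f u := by
  classical
  haveI : IsNoetherianRing R := hreg.1
  haveI : Module.FaithfullyFlat R (Completion R) := compl_flat
  obtain ⟨hm, -, hfn⟩ := ordRes_spec u f hfM hfu
  unfold Delta CharPolyhedron
  set m := ordRes f u with hmdef
  set w : Fin d → Completion R := fun i => algebraMap R (Completion R) (u i) with hw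
  have hMS : (maximalIdeal R).map (algebraMap R (Completion R)) = maximalIdeal (Completion R) :=
    (AdicCompletion.maximalIdeal_eq_map).symm
  have hPar : ∀ z : R, IsRSP R z u ↔ Par u z := by
    intro z
    unfold IsRSP IsSysOfParams Par
    rw [Fin.range_cons]
    exact ⟨fun h => h.1, fun h => ⟨h, hrsp.2⟩⟩
  have hParS : ∀ z : Completion R, IsRSPhat R z u ↔ Par w z := by
    intro z
    unfold IsRSPhat Par
    rw [← hMS]; rfl
  have hdR : ((Fintype.card (Fin d) + 1 : ℕ) : WithBot ℕ∞) ≤ ringKrullDim R := by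
    rw [Fintype.card_fin]; exact hrsp.2.ge
  have hdS : ((Fintype.card (Fin d) + 1 : ℕ) : WithBot ℕ∞) ≤ ringKrullDim (Completion R) := hdR.trans compl_dim
  have hy : Par u y := (hPar y).1 hrsp
  have hmapPar : ∀ z : R, Par u z → Par w (algebraMap R (Completion R) z) := by
    intro z hz
    unfold Par at hz ⊢
    have h1 := congrArg (Ideal.map (algebraMap R (Completion R))) hz
    rw [hMS, Ideal.map_span, Set.image_insert_eq, ← Set.range_comp] at h1
    exact h1
  have hfnS : algebraMap R (Completion R) f ∉ maximalIdeal (Completion R) ^ (m+1) ⊔ Ideal.span (Set.range w) := by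
    intro h
    refine hfn (ff_mem (B := Completion R) _ _ ?_)
    rw [Ideal.map_sup, Ideal.map_pow, hMS, map_spanrange]
    exact h
  set fS := algebraMap R (Completion R) f with hfS
  let Hv : Set ((Fin d → ℝ) × ℝ) := {h | (∀ i, 0 ≤ h.1 i) ∧ ∃ z, Par w z ∧ fS ∈ TT {h} m z w}
  have hHv : HNN Hv := fun h hh => hh.1
  obtain ⟨zh, hzh, hfzh⟩ := optimal hdS hm hfnS (hmapPar y hy) Hv hHv (fun h hh => hh.2)
  obtain ⟨c, hc1, hc2⟩ := exists_unit_expansion (hzh.reg hdS) hzh fS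
  have hcHv : (c.support : Set _) ⊆ BT Hv m :=
    supp_subset (hzh.reg hdS) hzh.ne_top hc1 (BT_up hHv m) (by rw [hc2]; exact hfzh)
  obtain ⟨T, hT1, hT2⟩ := fg_cone (c.support.image fun p => (p.1, m - p.2))
  have hTNN : HNN (T : Set ((Fin d → ℝ) × ℝ)) := fun h hh => (hT1 h hh).1
  have hTv : ∀ h ∈ (T : Set ((Fin d → ℝ) × ℝ)), ∃ z, Par u z ∧ f ∈ TT {h} m z u := by
    intro h hh
    refine descent (S := Completion R) (KF_completion hG) hMS hdS (hT1 h hh).1 hm hy hzh hfnS ?_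
    refine mem_mI.2 ⟨c, ?_, hc2⟩
    intro p hp h' hh'
    rw [Set.mem_singleton_iff] at hh'
    subst hh'
    exact (hT1 _ hh).2 _ (Finset.mem_image_of_mem _ hp)
  have hspan : ∀ h ∈ Hv, h ∈ Submodule.span NNReal (T : Set ((Fin d → ℝ) × ℝ)) := by
    intro h hh
    refine hT2 h hh.1 ?_
    intro q hq
    obtain ⟨p, hp, rfl⟩ := Finset.mem_image.1 hq
    exact hcHv hp h hh
  obtain ⟨z, hz, hfz⟩ := glue_fin hdR hm hfn hy (T : Set ((Fin d → ℝ) × ℝ)) T.finite_toSet hTNN hTv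
  refine ⟨z, (hPar z).2 hz, ?_⟩
  apply Set.Subset.antisymm
  · refine Set.subset_iInter₂ fun yh hyh => ?_
    have hyh' : Par w yh := (hParS yh).1 hyh
    refine delta_sub (delta_isF _ _ _ _) ?_
    intro c' hc' p hp hpm
    by_contra hcon
    obtain ⟨L, l, hL, hl, hlt⟩ := sep (delta_isF _ _ _ _) hcon
    obtain ⟨e, he1, he2⟩ := exists_unit_expansion (hyh'.reg hdS) hyh' fS
    have hmem : (L, l) ∈ Hv := by
      refine ⟨hL, yh, hyh', mem_mI.2 ⟨e, ?_, he2⟩⟩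
      exact supp_BT (f := fS) (y := yh) (w := w) ⟨he1, he2.symm⟩ hL hl
    have hpT : p ∈ BT (T : Set ((Fin d → ℝ) × ℝ)) m :=
      supp_subset (hz.reg hdR) hz.ne_top hc'.1 (BT_up hTNN m)
        (by have : ev z u c' = f := hc'.2.symm
            rw [this]; exact hfz) hp
    have hpH := DH_of_span hspan hpT (L, l) hmem
    simp only at hpH
    rw [lin_proj hpm] at hpH
    have hpos : (0 : ℝ) < ((m - p.2 : ℕ) : ℝ) := by exact_mod_cast Nat.sub_pos_of_lt hpm
    have := le_of_mul_le_mul_left hpH hpos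
    linarith
  · refine (Set.iInter₂_subset (algebraMap R (Completion R) z) ((hParS _).2 (hmapPar z hz))).trans ?_
    have hzS := hmapPar z hz
    refine delta_sub (delta_isF _ _ _ _) ?_
    intro c' hc' q hq hqm
    obtain ⟨e, he1, he2⟩ := exists_unit_expansion (hz.reg hdR) hz f
    have h1 : f ∈ mI z u {q | ∃ p ∈ e.support, p ≤ q} :=
      mem_mI.2 ⟨e, fun p hp => ⟨p, hp, le_rfl⟩, he2⟩
    have h2 := Ideal.mem_map_of_mem (algebraMap R (Completion R)) h1
    rw [map_mI] at h2
    have h3 := supp_subset (hzS.reg hdS) hzS.ne_top hc'.1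
      (B := {q | ∃ p ∈ e.support, p ≤ q}) (by rintro a ⟨p, hp, hpa⟩ b hab; exact ⟨p, hp, hpa.trans hab⟩)
      (by have : ev (algebraMap R (Completion R) z) w c' = fS := hc'.2.symm
          rw [this]; exact h2) hq
    obtain ⟨p, hp, hpq⟩ := h3
    exact proj_up (delta_isF _ _ _ _) hpq hqm
      (proj_mem_delta ⟨he1, he2.symm⟩ hp (lt_of_le_of_lt hpq.2 hqm))

end final

/-- **Theorem II.3.** For a regular local G-ring `R` with r.s.p. `(y, u_1, ..., u_d)`
and `f ∈ M`, `f ∉ (u_1, ..., u_d)`, the characteristic polyhedron is computed by some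
regular system of parameters `(z, u_1, ..., u_d)` of `R` itself. -/
theorem characteristic_polyhedron_without_completion
    {d : ℕ} (R : Type u) [CommRing R] [IsLocalRing R]
    (hreg : IsRegularLocalRing R) (hG : IsGRing R)
    (y : R) (u : Fin d → R) (hrsp : IsRSP R y u)
    (f : R) (hfM : f ∈ maximalIdeal R) (hfu : f ∉ Ideal.span (Set.range u)) :
    ∃ z : R, IsRSP R z u ∧ Delta f z u = CharPolyhedron f u := by
  exact final_eq hreg hG y u hrsp f hfM hfu

end CharPolyhedra
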